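/- Let n ≥ 3 be an integer, let τ > (n−2)/2, and let g be a C² metric on ℝ^n_+ that is C²-asymptotically flat of rate τ. Let α ∈ (0,1) and suppose u ∈ C^{2,α}_τ(ℝ^n_+) satisfies u(x) < 0 for all x ∈ ℝ^n_+, and that for some λ₀ > 1 the following hold: Δ_g u(x) ≥ 0 for all x ∈ ℝ^n_+ with |x| ≥ λ₀; Δ_g u is Lebesgue-integrable over ℝ^n_+; and D_{ν_g}u(y) = 0 for all y ∈ ∂ℝ^n_+ with |y| ≥ λ₀. Then the limit lim_{λ→∞} λ^{-1} ∫_{ℝ^n_+ ∩ S_λ} Σ_{i=1}^n x^i ∂_i u(x) dμ(ḡ) exists and is strictly positive. -/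

import Mathlib

open MeasureTheory Real Filter Topology Finset

noncomputable section

/-- Partial derivative of `f` in the `i`-th coordinate direction. -/
def pd {n : ℕ} (i : Fin n) (f : EuclideanSpace ℝ (Fin n) → ℝ)
    (x : EuclideanSpace ℝ (Fin n)) : ℝ :=
  fderiv ℝ f x (EuclideanSpace.single i 1)

/-- The closed upper half-space `{x : x iN ≥ 0}`. -/
def halfSpace {n : ℕ} (iN : Fin n) : Set (EuclideanSpace ℝ (Fin n)) :=
  {x | 0 ≤ x iN}

/-- The boundary hyperplane `{x : x iN = 0}`. -/
def bdry {n : ℕ} (iN : Fin n) : Set (EuclideanSpace ℝ (Fin n)) :=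
  {x | x iN = 0}

/-- Christoffel symbols `Γ^k_{ij}` of a metric `g`. -/
def christoffel {n : ℕ} (g : EuclideanSpace ℝ (Fin n) → Matrix (Fin n) (Fin n) ℝ)
    (k i j : Fin n) (x : EuclideanSpace ℝ (Fin n)) : ℝ :=
  (1 / 2) * ∑ l, (g x)⁻¹ k l *
    (pd i (fun y => g y j l) x + pd j (fun y => g y i l) x - pd l (fun y => g y i j) x)

/-- The Laplace–Beltrami operator of the metric `g`. -/
def laplaceBeltrami {n : ℕ} (g : EuclideanSpace ℝ (Fin n) → Matrix (Fin n) (Fin n) ℝ)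
    (u : EuclideanSpace ℝ (Fin n) → ℝ) (x : EuclideanSpace ℝ (Fin n)) : ℝ :=
  ∑ i, ∑ j, (g x)⁻¹ i j *
    (pd i (pd j u) x - ∑ k, christoffel g k i j x * pd k u x)

/-- The inward-pointing `g`-unit normal to the boundary hyperplane, as a vector. -/
def nuVec {n : ℕ} (iN : Fin n) (g : EuclideanSpace ℝ (Fin n) → Matrix (Fin n) (Fin n) ℝ)
    (y : EuclideanSpace ℝ (Fin n)) : EuclideanSpace ℝ (Fin n) :=
  (WithLp.equiv 2 (Fin n → ℝ)).symm fun i =>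
    (g y)⁻¹ i iN / Real.sqrt ((g y)⁻¹ iN iN)

/-- Normal derivative `D_{ν_g} u` at a boundary point. -/
def nuDeriv {n : ℕ} (iN : Fin n) (g : EuclideanSpace ℝ (Fin n) → Matrix (Fin n) (Fin n) ℝ)
    (u : EuclideanSpace ℝ (Fin n) → ℝ) (y : EuclideanSpace ℝ (Fin n)) : ℝ :=
  ∑ i, nuVec iN g y i * pd i u y

/-- `g` is a `C^m` Riemannian metric on the half-space. -/
def IsCmMetric {n : ℕ} (m : ℕ) (iN : Fin n)
    (g : EuclideanSpace ℝ (Fin n) → Matrix (Fin n) (Fin n) ℝ) : Prop :=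
  (∀ i j, ContDiffOn ℝ m (fun y => g y i j) (halfSpace iN)) ∧
    ∀ x ∈ halfSpace iN, (g x).IsSymm ∧ (g x).PosDef

/-- `g` is `C²`-asymptotically flat of rate `τ` on the half-space. -/
def IsAsymptoticallyFlat {n : ℕ} (iN : Fin n) (τ : ℝ)
    (g : EuclideanSpace ℝ (Fin n) → Matrix (Fin n) (Fin n) ℝ) : Prop :=
  ∃ C₀ > 0, ∀ x ∈ halfSpace iN, 1 ≤ ‖x‖ →
    (∀ i j, |g x i j - (1 : Matrix (Fin n) (Fin n) ℝ) i j| ≤ C₀ * ‖x‖ ^ (-τ)) ∧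
    (∀ i j k, |pd k (fun y => g y i j) x| ≤ C₀ * ‖x‖ ^ (-1 - τ)) ∧
    (∀ i j k l, |pd l (pd k (fun y => g y i j)) x| ≤ C₀ * ‖x‖ ^ (-2 - τ))

/-- The closed upper half-sphere of radius `lam`. -/
def halfSphere {n : ℕ} (iN : Fin n) (lam : ℝ) : Set (EuclideanSpace ℝ (Fin n)) :=
  {x | ‖x‖ = lam ∧ 0 ≤ x iN}

/-- The flux integral `∫_{ℝⁿ₊ ∩ S_λ} Σᵢ xⁱ ∂ᵢu dμ(ḡ)`, with `dμ(ḡ)` the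
`(n-1)`-dimensional Euclidean (Hausdorff) surface measure. -/
def flux {n : ℕ} (iN : Fin n) (u : EuclideanSpace ℝ (Fin n) → ℝ) (lam : ℝ) : ℝ :=
  ∫ x in halfSphere iN lam, (∑ i, x i * pd i u x) ∂(μH[(n : ℝ) - 1])

/-- Euclidean norm of the gradient. -/
def gradNorm {n : ℕ} (u : EuclideanSpace ℝ (Fin n) → ℝ) (x : EuclideanSpace ℝ (Fin n)) : ℝ :=
  Real.sqrt (∑ i, (pd i u x) ^ 2)

/-- Frobenius norm of the Hessian. -/
def hessNorm {n : ℕ} (u : EuclideanSpace ℝ (Fin n) → ℝ) (x : EuclideanSpace ℝ (Fin n)) : ℝ :=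
  Real.sqrt (∑ i, ∑ j, (pd i (pd j u) x) ^ 2)

/-- The Euclidean Laplacian. -/
def euclLap {n : ℕ} (u : EuclideanSpace ℝ (Fin n) → ℝ) (x : EuclideanSpace ℝ (Fin n)) : ℝ :=
  ∑ i, pd i (pd i u) x

/-- The barrier function associated to `τ` and `η`. -/
def barrier {n : ℕ} (iN : Fin n) (τ : ℝ) (η : ℝ → ℝ)
    (x : EuclideanSpace ℝ (Fin n)) : ℝ :=
  -(Real.log ‖x‖)⁻¹ * ‖x‖ ^ ((2 : ℝ) - n) + η (x iN / ‖x‖) * ‖x‖ ^ ((2 : ℝ) - n - τ)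

/-- The Euclidean area of the unit `(n-1)`-sphere in `ℝⁿ`. -/
def sphereArea (n : ℕ) : ℝ :=
  (μH[(n : ℝ) - 1] (Metric.sphere (0 : EuclideanSpace ℝ (Fin n)) 1)).toReal

/-- The quantity whose limit (after normalization) is the half-space mass. -/
def massExpr {n : ℕ} (iN : Fin n)
    (g : EuclideanSpace ℝ (Fin n) → Matrix (Fin n) (Fin n) ℝ) (lam : ℝ) : ℝ :=
  lam⁻¹ *
    ((∫ x in halfSphere iN lam,
        (∑ i, ∑ j, x i * (pd j (fun y => g y i j) x - pd i (fun y => g y j j) x))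
        ∂(μH[(n : ℝ) - 1])) +
      ∫ x in {x : EuclideanSpace ℝ (Fin n) | ‖x‖ = lam ∧ x iN = 0},
        (∑ i ∈ Finset.univ.erase iN, x i * g x i iN) ∂(μH[(n : ℝ) - 2]))

/-- `m` is the half-space (ADM-type) mass of `g`. -/
def HasHalfSpaceMass {n : ℕ} (iN : Fin n)
    (g : EuclideanSpace ℝ (Fin n) → Matrix (Fin n) (Fin n) ℝ) (m : ℝ) : Prop :=
  Filter.Tendsto (fun lam => (2 * ((n : ℝ) - 1) * sphereArea n)⁻¹ * massExpr iN g lam)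
    Filter.atTop (nhds m)

/-- Membership in the weighted Hölder space `C^{2,α}_τ(ℝⁿ₊)`. -/
def MemC2AlphaTau {n : ℕ} (iN : Fin n) (α τ : ℝ)
    (u : EuclideanSpace ℝ (Fin n) → ℝ) : Prop :=
  ContDiffOn ℝ 2 u (halfSpace iN) ∧
  ∃ C₁ > 0,
    (∀ x ∈ halfSpace iN,
      |u x| ≤ C₁ * (1 + ‖x‖) ^ (-τ) ∧
      (∀ i, |pd i u x| ≤ C₁ * (1 + ‖x‖) ^ (-1 - τ)) ∧
      (∀ i j, |pd i (pd j u) x| ≤ C₁ * (1 + ‖x‖) ^ (-2 - τ))) ∧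
    ∀ x₁ ∈ halfSpace iN, ∀ x₂ ∈ halfSpace iN, 1 ≤ ‖x₁‖ → 2 * ‖x₁ - x₂‖ ≤ ‖x₁‖ →
      ∀ i j, |pd i (pd j u) x₁ - pd i (pd j u) x₂| ≤
        C₁ * ‖x₁ - x₂‖ ^ α * ‖x₁‖ ^ (-2 - τ - α)

/-- Balls have positive measure for a nonzero measure on a compact space whose balls have
measure depending only on the radius. -/
lemma measure_ball_pos_of_uniform {X : Type*} [MetricSpace X] [CompactSpace X]
    [MeasurableSpace X] [BorelSpace X] (μ : Measure X) (hμ0 : μ ≠ 0)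
    (hμ : ∀ x y r, μ (Metric.ball x r) = μ (Metric.ball y r)) (x : X) {r : ℝ} (hr : 0 < r) :
    0 < μ (Metric.ball x r) := by
  rw [pos_iff_ne_zero]
  intro h0
  apply hμ0
  obtain ⟨t, -, ht, hcov⟩ := finite_cover_balls_of_compact (isCompact_univ (X := X)) hr
  rw [← Measure.measure_univ_eq_zero]
  refine measure_mono_null hcov ?_
  rw [measure_biUnion_null_iff ht.countable]
  intro y _
  rw [hμ y x, h0]

/-- Two finite uniformly distributed measures on a compact metric space are proportional. -/
theorem eq_smul_of_uniform {X : Type*} [MetricSpace X] [CompactSpace X]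
    [MeasurableSpace X] [BorelSpace X] (μ ν : Measure X) [IsFiniteMeasure μ] [IsFiniteMeasure ν]
    (hμ0 : μ ≠ 0) (hν0 : ν ≠ 0)
    (hμ : ∀ x y r, μ (Metric.ball x r) = μ (Metric.ball y r))
    (hν : ∀ x y r, ν (Metric.ball x r) = ν (Metric.ball y r)) :
    ∃ c : ENNReal, c ≠ 0 ∧ c ≠ ⊤ ∧ ν = c • μ := by
  have hX : Nonempty X := by
    by_contra h
    rw [not_nonempty_iff] at h
    exact hμ0 (Measure.eq_zero_of_isEmpty μ)
  obtain ⟨x₀⟩ := hX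
  have key : ∀ f : X → ℝ, Continuous f → ∀ η ε : ℝ, (∀ x y, dist x y < ε → |f x - f y| ≤ η) →
      |ν.real (Metric.ball x₀ ε) * ∫ x, f x ∂μ - μ.real (Metric.ball x₀ ε) * ∫ x, f x ∂ν|
        ≤ μ.real (Metric.ball x₀ ε) * (η * ν.real Set.univ) := by
    intro f hf η ε hfe
    have hfi : ∀ (m : Measure X) [IsFiniteMeasure m], Integrable f m := fun m _ =>
      hf.integrable_of_hasCompactSupport (HasCompactSupport.of_compactSpace f)
    set K : Set (X × X) := {p | dist p.1 p.2 < ε} with hK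
    have hKm : MeasurableSet K := (isOpen_lt (by fun_prop) (by fun_prop)).measurableSet
    set F : X × X → ℝ := K.indicator (fun p => f p.1) with hF
    have hFi : Integrable F (μ.prod ν) := by
      refine Integrable.indicator ?_ hKm
      exact (hf.comp continuous_fst).integrable_of_hasCompactSupport
        (HasCompactSupport.of_compactSpace _)
    have h1 : ∫ p, F p ∂(μ.prod ν) = ν.real (Metric.ball x₀ ε) * ∫ x, f x ∂μ := by
      rw [integral_prod _ hFi, ← integral_const_mul]
      congr 1; ext x
      have : (fun y => F (x, y)) = (Metric.ball x ε).indicator (fun _ => f x) := by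
        ext y
        simp only [hF, hK, Set.indicator, Set.mem_ofPred_eq, Metric.mem_ball, dist_comm]
      rw [this, integral_indicator Metric.isOpen_ball.measurableSet, setIntegral_const,
        smul_eq_mul, measureReal_def, measureReal_def, hν x x₀]
    have h2 : ∫ p, F p ∂(μ.prod ν) = ∫ y, (∫ x in Metric.ball y ε, f x ∂μ) ∂ν := by
      rw [integral_prod_symm _ hFi]
      congr 1; ext y
      have : (fun x => F (x, y)) = (Metric.ball y ε).indicator f := by
        ext x
        simp only [hF, hK, Set.indicator, Set.mem_ofPred_eq, Metric.mem_ball]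
      rw [this, integral_indicator Metric.isOpen_ball.measurableSet]
    have h3i : Integrable (fun y => ∫ x in Metric.ball y ε, f x ∂μ) ν := by
      have := hFi.integral_prod_right
      refine this.congr (Eventually.of_forall fun y => ?_)
      have : (fun x => F (x, y)) = (Metric.ball y ε).indicator f := by
        ext x
        simp only [hF, hK, Set.indicator, Set.mem_ofPred_eq, Metric.mem_ball]
      simp only [this, integral_indicator Metric.isOpen_ball.measurableSet]
    rw [← h1, h2, ← integral_const_mul, ← integral_sub h3i ((hfi ν).const_mul _)]
    rw [← mul_assoc, ← Real.norm_eq_abs]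
    refine norm_integral_le_of_norm_le_const (Eventually.of_forall fun y => ?_)
    have e1 : μ.real (Metric.ball x₀ ε) * f y = ∫ x in Metric.ball y ε, f y ∂μ := by
      rw [setIntegral_const, smul_eq_mul, measureReal_def, measureReal_def, hμ y x₀]
    rw [e1, ← integral_sub (hfi μ).integrableOn (integrable_const _)]
    refine (norm_setIntegral_le_of_norm_le_const (C := η) (measure_lt_top _ _)
      fun x hx => ?_).trans ?_
    · exact hfe _ _ (Metric.mem_ball.1 hx)
    · rw [measureReal_def, measureReal_def, hμ y x₀, mul_comm]
  have hμr : 0 < μ.real Set.univ := by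
    rw [measureReal_def]
    exact ENNReal.toReal_pos (by simpa using hμ0) (measure_ne_top _ _)
  have hνr : 0 < ν.real Set.univ := by
    rw [measureReal_def]
    exact ENNReal.toReal_pos (by simpa using hν0) (measure_ne_top _ _)
  set q : ℝ := ν.real Set.univ / μ.real Set.univ with hq
  have hqpos : 0 < q := by positivity
  have main : ∀ f : X → ℝ, Continuous f → ∫ x, f x ∂ν = q * ∫ x, f x ∂μ := by
    intro f hf
    refine eq_of_abs_sub_le_all fun η hη => ?_
    have hη' : 0 < η / ν.real Set.univ := by positivity
    obtain ⟨ε, hε, hfe⟩ := Metric.uniformContinuous_iff.1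
      (CompactSpace.uniformContinuous_of_continuous hf) _ hη'
    have ha : 0 < μ.real (Metric.ball x₀ ε) :=
      ENNReal.toReal_pos (measure_ball_pos_of_uniform μ hμ0 hμ x₀ hε).ne' (measure_ne_top _ _)
    have h1 := key (fun _ => 1) continuous_const 0 ε (by simp)
    have h2 := key f hf _ ε fun x y hxy => (hfe hxy).le
    simp only [integral_const, smul_eq_mul, mul_one, zero_mul, mul_zero, abs_nonpos_iff] at h1
    have hb : ν.real (Metric.ball x₀ ε) = μ.real (Metric.ball x₀ ε) * q := by
      rw [hq]; field_simp; linarith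
    rw [hb, mul_assoc, ← mul_sub, abs_mul, abs_of_pos ha, div_mul_cancel₀ _ hνr.ne'] at h2
    rw [abs_sub_comm]
    exact le_of_mul_le_mul_left h2 ha
  refine ⟨ENNReal.ofReal q, by simpa using hqpos, ENNReal.ofReal_ne_top, ?_⟩
  have : IsFiniteMeasure (ENNReal.ofReal q • μ) := Measure.smul_finite _ ENNReal.ofReal_ne_top
  refine ext_of_forall_integral_eq_of_IsFiniteMeasure fun f => ?_
  rw [main f f.continuous, integral_smul_measure, ENNReal.toReal_ofReal hqpos.le, smul_eq_mul]

/-- The linear isometries act transitively on the unit sphere. -/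
lemma exists_linearIsometryEquiv_sphere {n : ℕ}
    (x y : Metric.sphere (0 : EuclideanSpace ℝ (Fin n)) 1) :
    ∃ e : EuclideanSpace ℝ (Fin n) ≃ₗᵢ[ℝ] EuclideanSpace ℝ (Fin n),
      e x = (y : EuclideanSpace ℝ (Fin n)) :=
  ⟨_, Submodule.reflection_sub (by simp)⟩

lemma toSphere_ball_eq {n : ℕ} (x y : Metric.sphere (0 : EuclideanSpace ℝ (Fin n)) 1) (r : ℝ) :
    (volume : Measure (EuclideanSpace ℝ (Fin n))).toSphere (Metric.ball x r) =
      (volume : Measure (EuclideanSpace ℝ (Fin n))).toSphere (Metric.ball y r) := by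
  obtain ⟨e, he⟩ := exists_linearIsometryEquiv_sphere y x
  rw [Measure.toSphere_apply' _ measurableSet_ball, Measure.toSphere_apply' _ measurableSet_ball]
  congr 1
  rw [← e.measurePreserving.measure_preimage_emb e.toHomeomorph.measurableEmbedding]
  congr 1
  ext z
  simp only [Set.mem_smul, Set.mem_preimage, Subtype.image_ball, he.symm]
  constructor
  · rintro ⟨a, ha, b, hb, hab⟩
    refine ⟨a, ha, e.symm b, ?_, ?_⟩
    · have : dist (e.symm b) y = dist b (e y) := by
        rw [← e.dist_map]; simp
      simpa [this] using hb
    · rw [← map_smul, hab, e.symm_apply_apply]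
  · rintro ⟨a, ha, b, hb, hab⟩
    refine ⟨a, ha, e b, ?_, by rw [← map_smul, hab]⟩
    simpa using hb

lemma hausdorffMeasure_sphere_ball_eq {n : ℕ}
    (x y : Metric.sphere (0 : EuclideanSpace ℝ (Fin n)) 1) (r : ℝ) {d : ℝ} (hd : 0 ≤ d) :
    μH[d] (Metric.ball x r) = μH[d] (Metric.ball y r) := by
  obtain ⟨e, he⟩ := exists_linearIsometryEquiv_sphere x y
  have hc : ∀ s : Set (Metric.sphere (0 : EuclideanSpace ℝ (Fin n)) 1),
      μH[d] s = μH[d] ((↑) '' s : Set (EuclideanSpace ℝ (Fin n))) := fun s =>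
    (isometry_subtype_coe.hausdorffMeasure_image (Or.inl hd) s).symm
  rw [hc, hc, ← e.isometry.hausdorffMeasure_image (Or.inl hd)]
  congr 1
  ext z
  simp only [Subtype.image_ball, Set.mem_image, ← he]
  constructor
  · rintro ⟨b, hb, rfl⟩
    simpa using hb
  · intro hb
    refine ⟨e.symm z, ?_, by simp⟩
    have : dist (e.symm z) x = dist z (e x) := by
      rw [← e.dist_map]; simp
    simpa [this] using hb

lemma card_subtype_ne {n : ℕ} (hn : 1 ≤ n) (i : Fin n) :
    ((Fintype.card {j : Fin n // j ≠ i} : ℕ) : ℝ) = (n : ℝ) - 1 := by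
  rw [Fintype.card_subtype_compl]
  simp [Nat.cast_sub hn]

lemma hausdorffMeasure_sphere_pos {n : ℕ} (hn : 2 ≤ n) :
    0 < μH[(n : ℝ) - 1] (Metric.sphere (0 : EuclideanSpace ℝ (Fin n)) 1) := by
  have hn0 : (0 : ℝ) < n := by positivity
  have hn2 : (2 : ℝ) ≤ n := by exact_mod_cast hn
  let i : Fin n := ⟨0, by omega⟩
  let P : EuclideanSpace ℝ (Fin n) → ({j : Fin n // j ≠ i} → ℝ) := fun x j => x j
  have hP : LipschitzWith 1 P := by
    refine LipschitzWith.of_dist_le_mul fun x y => ?_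
    rw [NNReal.coe_one, one_mul, dist_pi_le_iff dist_nonneg]
    intro j
    rw [dist_eq_norm, dist_eq_norm]
    exact PiLp.norm_apply_le (x - y) (j : Fin n)
  have h1 := hP.hausdorffMeasure_image_le (d := (n : ℝ) - 1) (by linarith)
    (Metric.sphere (0 : EuclideanSpace ℝ (Fin n)) 1)
  rw [ENNReal.coe_one, ENNReal.one_rpow, one_mul] at h1
  refine lt_of_lt_of_le ?_ h1
  rw [← card_subtype_ne (by omega) i, hausdorffMeasure_pi_real]
  have hsub : Set.Icc (fun _ : {j : Fin n // j ≠ i} => (0 : ℝ)) (fun _ => 1 / n) ⊆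
      P '' Metric.sphere (0 : EuclideanSpace ℝ (Fin n)) 1 := by
    intro y hy
    have hs : ∑ j, y j ^ 2 ≤ 1 := by
      calc ∑ j, y j ^ 2 ≤ ∑ _j : {j : Fin n // j ≠ i}, (1 / (n : ℝ)) ^ 2 := by
            refine Finset.sum_le_sum fun j _ => ?_
            exact pow_le_pow_left₀ (hy.1 j) (hy.2 j) 2
        _ = ((n : ℝ) - 1) * (1 / n) ^ 2 := by
            rw [Finset.sum_const, nsmul_eq_mul, Finset.card_univ, card_subtype_ne (by omega)]
        _ ≤ 1 := by
            rw [div_pow, one_pow, mul_one_div, div_le_one (by positivity)]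
            nlinarith
    refine ⟨WithLp.toLp 2 fun j => if h : j = i then √(1 - ∑ j, y j ^ 2) else y ⟨j, h⟩, ?_, ?_⟩
    · rw [mem_sphere_zero_iff_norm, EuclideanSpace.norm_eq, Real.sqrt_eq_one]
      rw [← Finset.add_sum_erase _ _ (Finset.mem_univ i)]
      have : ∑ j ∈ Finset.univ.erase i, ‖(WithLp.toLp 2 fun j => if h : j = i then
          √(1 - ∑ j, y j ^ 2) else y ⟨j, h⟩ : EuclideanSpace ℝ (Fin n)) j‖ ^ 2
          = ∑ j, y j ^ 2 := by
        rw [Finset.sum_subtype (p := fun j => j ≠ i) _ (by simp)]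
        refine Finset.sum_congr rfl fun j _ => ?_
        simp [j.2]
      rw [this]
      simp [Real.sq_sqrt (sub_nonneg.2 hs)]
    · ext j
      simp [P, j.2]
  refine lt_of_lt_of_le ?_ (measure_mono hsub)
  rw [Real.volume_Icc_pi]
  simp only [sub_zero, Finset.prod_const]
  exact ENNReal.pow_pos (ENNReal.ofReal_pos.2 (by positivity)) _

lemma hausdorffMeasure_sphere_lt_top {n : ℕ} (hn : 2 ≤ n) :
    μH[(n : ℝ) - 1] (Metric.sphere (0 : EuclideanSpace ℝ (Fin n)) 1) < ⊤ := by
  have hn2 : (2 : ℝ) ≤ n := by exact_mod_cast hn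
  let m : (i : Fin n) → ℝ → ({j : Fin n // j ≠ i} → ℝ) → EuclideanSpace ℝ (Fin n) :=
    fun i s y => WithLp.toLp 2 fun j => if h : j = i then s else y ⟨j, h⟩
  let N : (i : Fin n) → ℝ → ({j : Fin n // j ≠ i} → ℝ) → EuclideanSpace ℝ (Fin n) :=
    fun i s y => ‖m i s y‖⁻¹ • m i s y
  have hm0 : ∀ i s y, s ≠ 0 → m i s y ≠ 0 := by
    intro i s y hs h0
    apply hs
    have : m i s y i = 0 := by rw [h0]; rfl
    simpa [m] using this
  have hm : ∀ i s, ContDiff ℝ 1 (m i s) := by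
    intro i s
    refine (PiLp.contDiff_toLp).comp (contDiff_pi.2 fun j => ?_)
    by_cases h : j = i
    · simp only [h, dif_pos]; exact contDiff_const
    · simp only [h, dif_neg, not_false_eq_true]; exact contDiff_apply _ _ _
  have hN : ∀ i s, s ≠ 0 → ContDiff ℝ 1 (N i s) := fun i s hs =>
    (((hm i s).norm ℝ (fun y => hm0 i s y hs)).inv
      (fun y => norm_ne_zero_iff.2 (hm0 i s y hs))).smul (hm i s)
  have hfin : ∀ i s, s ≠ 0 → μH[(n : ℝ) - 1] (N i s '' Set.Icc (fun _ => -1) (fun _ => 1)) < ⊤ := by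
    intro i s hs
    obtain ⟨K, hK⟩ := (hN i s hs).contDiffOn.exists_lipschitzOnWith one_ne_zero
      (convex_Icc (fun _ => (-1 : ℝ)) (fun _ => 1)) isCompact_Icc
    refine (hK.hausdorffMeasure_image_le (d := (n : ℝ) - 1) (by linarith)).trans_lt ?_
    rw [← card_subtype_ne (by omega) i, hausdorffMeasure_pi_real]
    exact ENNReal.mul_lt_top (by simp) (isCompact_Icc.measure_lt_top)
  have hcov : Metric.sphere (0 : EuclideanSpace ℝ (Fin n)) 1 ⊆
      ⋃ i, (N i 1 '' Set.Icc (fun _ => -1) (fun _ => 1)) ∪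
        (N i (-1) '' Set.Icc (fun _ => -1) (fun _ => 1)) := by
    intro x hx
    rw [mem_sphere_zero_iff_norm] at hx
    have : Nonempty (Fin n) := ⟨⟨0, by omega⟩⟩
    obtain ⟨i, -, hi⟩ := Finset.exists_max_image Finset.univ (fun i => |x i|) Finset.univ_nonempty
    have hxi : 0 < |x i| := by
      by_contra h
      have h0 : x = 0 := by
        ext j
        have := hi j (Finset.mem_univ j)
        simp only [PiLp.zero_apply]
        exact abs_nonpos_iff.1 (by linarith)
      simp [h0] at hx
    have key : ∀ s : ℝ, x i = s * |x i| →
        N i s (fun j => |x i|⁻¹ * x j) = x := by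
      intro s hs
      have : m i s (fun j => |x i|⁻¹ * x j) = |x i|⁻¹ • x := by
        ext j
        by_cases h : j = i
        · subst h
          simp only [m, dif_pos, PiLp.smul_apply, smul_eq_mul]
          field_simp; linarith
        · simp [m, h]
      simp only [N, this, norm_smul, hx, mul_one, norm_inv, Real.norm_eq_abs, abs_abs, inv_inv]
      rw [smul_smul, mul_inv_cancel₀ hxi.ne', one_smul]
    have hmem : (fun j : {j : Fin n // j ≠ i} => |x i|⁻¹ * x j) ∈
        Set.Icc (fun _ => (-1 : ℝ)) (fun _ => 1) := by
      rw [← Set.pi_univ_Icc, Set.mem_univ_pi]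
      intro j
      rw [Set.mem_Icc, ← abs_le, abs_mul, abs_inv, abs_abs, inv_mul_le_iff₀ hxi, mul_one]
      exact hi j (Finset.mem_univ _)
    refine Set.mem_iUnion.2 ⟨i, ?_⟩
    rcases le_total 0 (x i) with h | h
    · exact Or.inl ⟨_, hmem, key 1 (by rw [abs_of_nonneg h, one_mul])⟩
    · exact Or.inr ⟨_, hmem, key (-1) (by rw [abs_of_nonpos h]; ring)⟩
  refine (measure_mono hcov).trans_lt ?_
  refine (measure_iUnion_fintype_le _ _).trans_lt ?_
  refine ENNReal.sum_lt_top.2 fun i _ => ?_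
  exact (measure_union_le _ _).trans_lt
    (ENNReal.add_lt_top.2 ⟨hfin i 1 one_ne_zero, hfin i (-1) (by norm_num)⟩)

/-- The open upper half of the unit sphere. -/
def upperSphere {n : ℕ} (iN : Fin n) : Set (Metric.sphere (0 : EuclideanSpace ℝ (Fin n)) 1) :=
  {ω | 0 < (ω : EuclideanSpace ℝ (Fin n)) iN}

lemma isOpen_upperSphere {n : ℕ} (iN : Fin n) : IsOpen (upperSphere iN) :=
  isOpen_lt continuous_const (by fun_prop)

lemma toSphere_equator {n : ℕ} (iN : Fin n) :
    (volume : Measure (EuclideanSpace ℝ (Fin n))).toSphere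
      {ω | (ω : EuclideanSpace ℝ (Fin n)) iN = 0} = 0 := by
  have hms : MeasurableSet {ω : Metric.sphere (0 : EuclideanSpace ℝ (Fin n)) 1 |
      (ω : EuclideanSpace ℝ (Fin n)) iN = 0} :=
    (isClosed_eq (by fun_prop) continuous_const).measurableSet
  rw [Measure.toSphere_apply' _ hms]
  let p : EuclideanSpace ℝ (Fin n) →ₗ[ℝ] ℝ := (EuclideanSpace.proj iN : _ →L[ℝ] ℝ).toLinearMap
  have hp : LinearMap.ker p ≠ ⊤ := by
    intro h
    have : p (EuclideanSpace.single iN 1) = 0 := by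
      rw [← LinearMap.mem_ker, h]; trivial
    simp [p] at this
  have h0 := Measure.addHaar_submodule (volume : Measure (EuclideanSpace ℝ (Fin n)))
    (LinearMap.ker p) hp
  rw [measure_mono_null _ h0, mul_zero]
  rintro _ ⟨r, -, _, ⟨ω, hω, rfl⟩, rfl⟩
  have : (ω : EuclideanSpace ℝ (Fin n)) iN = 0 := hω
  simp [p, this]

lemma toSphere_upperSphere_pos {n : ℕ} (iN : Fin n) :
    0 < (volume : Measure (EuclideanSpace ℝ (Fin n))).toSphere.real (upperSphere iN) := by
  rw [measureReal_def]
  refine ENNReal.toReal_pos ((isOpen_upperSphere iN).measure_ne_zero _ ?_) (measure_ne_top _ _)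
  exact ⟨⟨EuclideanSpace.single iN 1, by simp⟩, by simp [upperSphere]⟩

open scoped Pointwise in
lemma hausdorffMeasure_eq_smul_map {n : ℕ} {d : ℝ} (hd : 0 ≤ d) {r : ℝ} (hr : 0 < r) :
    (μH[d] : Measure (EuclideanSpace ℝ (Fin n))) =
      ENNReal.ofReal (r ^ d) • (μH[d]).map (fun x => r • x) := by
  ext A hA
  have hm : Measurable (fun x : EuclideanSpace ℝ (Fin n) => r • x) := measurable_const_smul r
  rw [Measure.smul_apply, Measure.map_apply hm hA]
  have h1 : A = r • ((fun x : EuclideanSpace ℝ (Fin n) => r • x) ⁻¹' A) := by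
    have : (fun x : EuclideanSpace ℝ (Fin n) => r • x) ⁻¹' A = r⁻¹ • A := by
      exact (Set.preimage_smul₀ hr.ne' A)
    rw [this, smul_inv_smul₀ hr.ne']
  conv_lhs => rw [h1]
  rw [Measure.hausdorffMeasure_smul₀ hd hr.ne', ENNReal.smul_def, smul_eq_mul, smul_eq_mul]
  congr 1
  rw [ENNReal.ofReal, ENNReal.coe_inj]
  ext
  simp [abs_of_pos hr, Real.rpow_nonneg hr.le]

/-- The surface integral over a half-sphere in terms of the unit half-sphere. -/
theorem exists_integral_halfSphere_eq {n : ℕ} (hn : 2 ≤ n) (iN : Fin n) :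
    ∃ c : ℝ, 0 < c ∧ ∀ r : ℝ, 0 < r → ∀ f : EuclideanSpace ℝ (Fin n) → ℝ,
      ∫ x in halfSphere iN r, f x ∂(μH[(n : ℝ) - 1]) =
        c * (r ^ ((n : ℝ) - 1) * ∫ ω in upperSphere iN, f (r • (ω : EuclideanSpace ℝ (Fin n)))
          ∂(volume : Measure (EuclideanSpace ℝ (Fin n))).toSphere) := by
  have hn2 : (2 : ℝ) ≤ n := by exact_mod_cast hn
  have hd : (0 : ℝ) ≤ (n : ℝ) - 1 := by linarith
  set d : ℝ := (n : ℝ) - 1 with hd_def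
  let S := Metric.sphere (0 : EuclideanSpace ℝ (Fin n)) 1
  have hmap : (μH[d] : Measure S).map (↑) =
      (μH[d] : Measure (EuclideanSpace ℝ (Fin n))).restrict S := by
    rw [isometry_subtype_coe.map_hausdorffMeasure (Or.inl hd), Subtype.range_coe]
  have huniv : (μH[d] : Measure S) Set.univ = μH[d] S := by
    rw [← Measure.restrict_apply_self (μH[d]) S, ← hmap, Measure.map_apply (by fun_prop)
      Metric.isClosed_sphere.measurableSet]
    simp [S]
  have : IsFiniteMeasure (μH[d] : Measure S) :=
    ⟨by rw [huniv]; exact hausdorffMeasure_sphere_lt_top hn⟩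
  have hne : (μH[d] : Measure S) ≠ 0 := by
    rw [← Measure.measure_univ_ne_zero, huniv]
    exact (hausdorffMeasure_sphere_pos hn).ne'
  have : Nontrivial (EuclideanSpace ℝ (Fin n)) :=
    ⟨⟨0, EuclideanSpace.single iN 1, by simp [eq_comm]⟩⟩
  obtain ⟨c, hc0, hct, hc⟩ := eq_smul_of_uniform
    ((volume : Measure (EuclideanSpace ℝ (Fin n))).toSphere) (μH[d] : Measure S)
    (Measure.toSphere_ne_zero _) hne toSphere_ball_eq
    (fun x y r => hausdorffMeasure_sphere_ball_eq x y r hd)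
  refine ⟨c.toReal, ENNReal.toReal_pos hc0 hct, fun r hr f => ?_⟩
  have he : MeasurableEmbedding (fun x : EuclideanSpace ℝ (Fin n) => r • x) :=
    (Homeomorph.smulOfNeZero r hr.ne').measurableEmbedding
  have hpre : (fun x : EuclideanSpace ℝ (Fin n) => r • x) ⁻¹' halfSphere iN r =
      S ∩ {x | 0 ≤ x iN} := by
    ext x
    simp [halfSphere, S, norm_smul, abs_of_pos hr, hr.ne', hr]
  rw [hausdorffMeasure_eq_smul_map hd hr, Measure.restrict_smul, integral_smul_measure,
    he.setIntegral_map, hpre, ENNReal.toReal_ofReal (by positivity), smul_eq_mul]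
  rw [Set.inter_comm, ← Measure.restrict_restrict (isClosed_le continuous_const
    (by fun_prop : Continuous fun x : EuclideanSpace ℝ (Fin n) => x iN)).measurableSet, ← hmap,
    (MeasurableEmbedding.subtype_coe Metric.isClosed_sphere.measurableSet).setIntegral_map,
    hc, Measure.restrict_smul, integral_smul_measure, smul_eq_mul]
  rw [mul_left_comm]
  congr 2
  refine setIntegral_congr_set ?_
  have h0 := toSphere_equator iN
  have : ∀ᵐ ω : Metric.sphere (0 : EuclideanSpace ℝ (Fin n)) 1
      ∂(volume : Measure (EuclideanSpace ℝ (Fin n))).toSphere,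
      ¬ (ω : EuclideanSpace ℝ (Fin n)) iN = 0 := by
    rw [ae_iff]; simpa using h0
  filter_upwards [this] with ω hω
  apply propext
  change 0 ≤ (ω : EuclideanSpace ℝ (Fin n)) iN ↔ 0 < (ω : EuclideanSpace ℝ (Fin n)) iN
  exact ⟨fun h => lt_of_le_of_ne h (Ne.symm hω), le_of_lt⟩

/-- Integration in polar coordinates. -/
theorem integral_eq_integral_polar {n : ℕ} (hn : 1 ≤ n) {F : EuclideanSpace ℝ (Fin n) → ℝ}
    (hF : Integrable F) :
    ∫ x, F x = ∫ r in Set.Ioi (0 : ℝ), r ^ (n - 1) *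
      ∫ ω, F (r • (ω : EuclideanSpace ℝ (Fin n)))
        ∂(volume : Measure (EuclideanSpace ℝ (Fin n))).toSphere := by
  have : Nontrivial (EuclideanSpace ℝ (Fin n)) :=
    ⟨⟨0, EuclideanSpace.single ⟨0, by omega⟩ 1, by simp [eq_comm]⟩⟩
  have hdim : Module.finrank ℝ (EuclideanSpace ℝ (Fin n)) = n := by simp
  have hmp := (volume : Measure (EuclideanSpace ℝ (Fin n))).measurePreserving_homeomorphUnitSphereProd
  rw [hdim] at hmp
  have hemb := (homeomorphUnitSphereProd (EuclideanSpace ℝ (Fin n))).measurableEmbedding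
  let Φ : Metric.sphere (0 : EuclideanSpace ℝ (Fin n)) 1 × Set.Ioi (0 : ℝ) → ℝ :=
    fun p => F ((p.2 : ℝ) • (p.1 : EuclideanSpace ℝ (Fin n)))
  have hΦ : ∀ x : ({0}ᶜ : Set (EuclideanSpace ℝ (Fin n))),
      Φ (homeomorphUnitSphereProd (EuclideanSpace ℝ (Fin n)) x) = F x := by
    intro x
    have hx : ‖(x : EuclideanSpace ℝ (Fin n))‖ ≠ 0 := norm_ne_zero_iff.2 x.2
    simp [Φ, smul_smul, hx]
  have hI : Integrable Φ ((volume : Measure (EuclideanSpace ℝ (Fin n))).toSphere.prod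
      (Measure.volumeIoiPow (n - 1))) := by
    rw [← hmp.integrable_comp_emb hemb]
    have : (Φ ∘ homeomorphUnitSphereProd (EuclideanSpace ℝ (Fin n))) = F ∘ (↑) := by
      ext x; exact hΦ x
    rw [this, ← integrableOn_iff_comap_subtypeVal (measurableSet_singleton _).compl]
    exact hF.integrableOn
  calc ∫ x, F x = ∫ x : ({0}ᶜ : Set (EuclideanSpace ℝ (Fin n))), F x ∂(volume.comap Subtype.val) := by
        rw [integral_subtype_comap (measurableSet_singleton _).compl F,
          restrict_compl_singleton]
    _ = ∫ p, Φ p ∂((volume : Measure (EuclideanSpace ℝ (Fin n))).toSphere.prod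
          (Measure.volumeIoiPow (n - 1))) := by
        rw [← hmp.integral_comp hemb]
        exact integral_congr_ae (.of_forall fun x => (hΦ x).symm)
    _ = ∫ r : Set.Ioi (0 : ℝ), ∫ ω, Φ (ω, r) ∂(volume : Measure (EuclideanSpace ℝ (Fin n))).toSphere
          ∂(Measure.volumeIoiPow (n - 1)) := integral_prod_symm _ hI
    _ = _ := by
        simp only [Measure.volumeIoiPow, ENNReal.ofReal]
        rw [integral_withDensity_eq_integral_smul
          (measurable_subtype_coe.pow_const _).real_toNNReal,
          integral_subtype_comap measurableSet_Ioi fun a : ℝ => Real.toNNReal (a ^ (n - 1)) •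
            ∫ ω, F (a • (ω : EuclideanSpace ℝ (Fin n)))
              ∂(volume : Measure (EuclideanSpace ℝ (Fin n))).toSphere]
        refine setIntegral_congr_fun measurableSet_Ioi fun x hx => ?_
        simp only [NNReal.smul_def, Real.coe_toNNReal _ (pow_nonneg (le_of_lt hx) _), smul_eq_mul]

/-- Integration in polar coordinates over the open half-space. -/
theorem setIntegral_halfSpace_eq_polar {n : ℕ} (hn : 1 ≤ n) (iN : Fin n)
    {F : EuclideanSpace ℝ (Fin n) → ℝ} (hF : IntegrableOn F {x | 0 < x iN}) :
    ∫ x in {x | 0 < x iN}, F x = ∫ r in Set.Ioi (0 : ℝ), r ^ (n - 1) *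
      ∫ ω in upperSphere iN, F (r • (ω : EuclideanSpace ℝ (Fin n)))
        ∂(volume : Measure (EuclideanSpace ℝ (Fin n))).toSphere := by
  have hm : MeasurableSet {x : EuclideanSpace ℝ (Fin n) | 0 < x iN} :=
    (isOpen_lt continuous_const (by fun_prop)).measurableSet
  rw [← integral_indicator hm, integral_eq_integral_polar hn (hF.integrable_indicator hm)]
  refine setIntegral_congr_fun measurableSet_Ioi fun r hr => ?_
  have hr : 0 < r := hr
  simp only
  rw [← integral_indicator (isOpen_upperSphere iN).measurableSet]
  congr 2
  ext ω
  by_cases h : 0 < (ω : EuclideanSpace ℝ (Fin n)) iN <;> simp [Set.indicator, upperSphere, hr, h]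

lemma abs_inv_apply_le_of_near_one {n : ℕ} {A : Matrix (Fin n) (Fin n) ℝ} (hA : A.PosDef)
    {e : ℝ} (he : ∀ i j, |A i j - (1 : Matrix (Fin n) (Fin n) ℝ) i j| ≤ e)
    (hne : n * e ≤ 1 / 2) (i j : Fin n) :
    |A⁻¹ i j| ≤ 2 ∧ |A⁻¹ i j - (1 : Matrix (Fin n) (Fin n) ℝ) i j| ≤ 2 * n * e := by
  have he0 : 0 ≤ e := (abs_nonneg _).trans (he i i)
  have hdet : IsUnit A.det := (Matrix.isUnit_iff_isUnit_det _).1 hA.isUnit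
  have hid : ∀ i j, A⁻¹ i j - (1 : Matrix (Fin n) (Fin n) ℝ) i j =
      -∑ k, A⁻¹ i k * (A k j - (1 : Matrix (Fin n) (Fin n) ℝ) k j) := by
    intro i j
    have h : A⁻¹ - 1 = -(A⁻¹ * (A - 1)) := by
      rw [mul_sub, Matrix.nonsing_inv_mul _ hdet, mul_one, neg_sub]
    have := congrFun (congrFun h i) j
    simpa [Matrix.mul_apply] using this
  have hne' : (univ : Finset (Fin n × Fin n)).Nonempty := ⟨(i, i), mem_univ _⟩
  obtain ⟨⟨p, q⟩, -, hmax⟩ := exists_max_image univ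
    (fun a : Fin n × Fin n => |A⁻¹ a.1 a.2|) hne'
  set M := |A⁻¹ p q| with hM
  have hM0 : 0 ≤ M := abs_nonneg _
  have hle : ∀ i j, |A⁻¹ i j| ≤ M := fun i j => hmax (i, j) (mem_univ _)
  have hdiff : ∀ i j, |A⁻¹ i j - (1 : Matrix (Fin n) (Fin n) ℝ) i j| ≤ n * (M * e) := by
    intro i j
    rw [hid, abs_neg]
    calc |∑ k, A⁻¹ i k * (A k j - (1 : Matrix (Fin n) (Fin n) ℝ) k j)|
        ≤ ∑ k, |A⁻¹ i k * (A k j - (1 : Matrix (Fin n) (Fin n) ℝ) k j)| := abs_sum_le_sum_abs _ _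
      _ ≤ ∑ _k : Fin n, M * e := by
          refine sum_le_sum fun k _ => ?_
          rw [abs_mul]
          exact mul_le_mul (hle _ _) (he _ _) (abs_nonneg _) hM0
      _ = n * (M * e) := by simp
  have hM2 : M ≤ 2 := by
    have h1 := hdiff p q
    have h2 : |(1 : Matrix (Fin n) (Fin n) ℝ) p q| ≤ 1 := by
      rw [Matrix.one_apply]; split_ifs <;> simp
    have h3 : M ≤ n * (M * e) + 1 := by
      have := abs_add_le (A⁻¹ p q - (1 : Matrix (Fin n) (Fin n) ℝ) p q)
        ((1 : Matrix (Fin n) (Fin n) ℝ) p q)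
      rw [sub_add_cancel] at this
      linarith
    nlinarith
  refine ⟨(hle i j).trans hM2, (hdiff i j).trans ?_⟩
  have hn0 : (0 : ℝ) ≤ n := by positivity
  nlinarith [mul_le_mul_of_nonneg_left hM2 (mul_nonneg hn0 he0)]

/-- Outside a compact set the inverse metric is close to the identity and the Laplace–Beltrami
operator is close to the Euclidean Laplacian. -/
theorem exists_laplaceBeltrami_sub_le {n : ℕ} (iN : Fin n) {τ : ℝ} (hτ : 0 < τ)
    {g : EuclideanSpace ℝ (Fin n) → Matrix (Fin n) (Fin n) ℝ}
    (hg : IsCmMetric 2 iN g) (hgAF : IsAsymptoticallyFlat iN τ g) :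
    ∃ C > 0, ∃ R ≥ 1, ∀ x ∈ halfSpace iN, R ≤ ‖x‖ →
      (∀ i j, |(g x)⁻¹ i j - (1 : Matrix (Fin n) (Fin n) ℝ) i j| ≤ C * ‖x‖ ^ (-τ)) ∧
      ∀ (f : EuclideanSpace ℝ (Fin n) → ℝ) (b₁ b₂ : ℝ), (∀ k, |pd k f x| ≤ b₁) →
        (∀ i j, |pd i (pd j f) x| ≤ b₂) →
        |laplaceBeltrami g f x - euclLap f x| ≤ C * (‖x‖ ^ (-τ) * b₂ + ‖x‖ ^ (-1 - τ) * b₁) := by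
  obtain ⟨C₀, hC₀, hAF⟩ := hgAF
  have hn : (1 : ℝ) ≤ n := by exact_mod_cast (Nat.one_le_iff_ne_zero.2 (by have := iN.2; omega))
  have hlim : Tendsto (fun r : ℝ => n * (C₀ * r ^ (-τ))) atTop (𝓝 0) := by
    have := ((tendsto_rpow_neg_atTop hτ).const_mul C₀).const_mul (n : ℝ)
    simpa using this
  obtain ⟨R, hR⟩ := ((hlim.eventually (ge_mem_nhds (show (0 : ℝ) < 1 / 2 by norm_num))).and
    (eventually_ge_atTop 1)).exists_forall_of_atTop
  refine ⟨6 * n ^ 4 * C₀, by positivity, max R 1, le_max_right _ _, fun x hx hxR => ?_⟩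
  have hx1 : 1 ≤ ‖x‖ := (le_max_right _ _).trans hxR
  have hsmall := (hR ‖x‖ ((le_max_left _ _).trans hxR)).1
  obtain ⟨h0, h1, -⟩ := hAF x hx hx1
  have hinv := abs_inv_apply_le_of_near_one (hg.2 x hx).2 h0 hsmall
  have hr1 : 0 ≤ ‖x‖ ^ (-τ) := by positivity
  have hr2 : 0 ≤ ‖x‖ ^ (-1 - τ) := by positivity
  have hpow : ∀ k : ℕ, (1 : ℝ) ≤ (n : ℝ) ^ k := fun k => one_le_pow₀ hn
  refine ⟨fun i j => (hinv i j).2.trans ?_, fun f b₁ b₂ hb₁ hb₂ => ?_⟩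
  · have h3 : (n : ℝ) ≤ n ^ 4 := by nlinarith [hpow 3]
    have : 0 ≤ C₀ * ‖x‖ ^ (-τ) := by positivity
    nlinarith
  have hb₁0 : 0 ≤ b₁ := (abs_nonneg _).trans (hb₁ iN)
  have hb₂0 : 0 ≤ b₂ := (abs_nonneg _).trans (hb₂ iN iN)
  have hΓ : ∀ k i j, |christoffel g k i j x| ≤ 3 * n * C₀ * ‖x‖ ^ (-1 - τ) := by
    intro k i j
    rw [christoffel, abs_mul, abs_of_pos (by norm_num : (0 : ℝ) < 1 / 2)]
    have : |∑ l, (g x)⁻¹ k l * (pd i (fun y => g y j l) x + pd j (fun y => g y i l) x -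
        pd l (fun y => g y i j) x)| ≤ ∑ _l : Fin n, 2 * (3 * (C₀ * ‖x‖ ^ (-1 - τ))) := by
      refine (abs_sum_le_sum_abs _ _).trans (sum_le_sum fun l _ => ?_)
      rw [abs_mul]
      refine mul_le_mul (hinv k l).1 ?_ (abs_nonneg _) (by norm_num)
      refine (abs_sub _ _).trans ?_
      have := abs_add_le (pd i (fun y => g y j l) x) (pd j (fun y => g y i l) x)
      linarith [h1 j l i, h1 i l j, h1 i j l]
    rw [sum_const, card_univ, Fintype.card_fin, nsmul_eq_mul] at this
    linarith
  have hexp : laplaceBeltrami g f x - euclLap f x =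
      ∑ i, ∑ j, (((g x)⁻¹ i j - (1 : Matrix (Fin n) (Fin n) ℝ) i j) * pd i (pd j f) x -
        (g x)⁻¹ i j * ∑ k, christoffel g k i j x * pd k f x) := by
    rw [laplaceBeltrami, euclLap, ← sum_sub_distrib]
    refine sum_congr rfl fun i _ => ?_
    have : pd i (pd i f) x = ∑ j, (1 : Matrix (Fin n) (Fin n) ℝ) i j * pd i (pd j f) x := by
      simp [Matrix.one_apply]
    rw [this, ← sum_sub_distrib]
    exact sum_congr rfl fun j _ => by ring
  rw [hexp]
  have hterm : ∀ i j, |((g x)⁻¹ i j - (1 : Matrix (Fin n) (Fin n) ℝ) i j) * pd i (pd j f) x -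
      (g x)⁻¹ i j * ∑ k, christoffel g k i j x * pd k f x| ≤
      2 * n * (C₀ * ‖x‖ ^ (-τ)) * b₂ + 2 * (n * (3 * n * C₀ * ‖x‖ ^ (-1 - τ) * b₁)) := by
    intro i j
    refine (abs_sub _ _).trans (add_le_add ?_ ?_)
    · rw [abs_mul]
      exact mul_le_mul (hinv i j).2 (hb₂ i j) (abs_nonneg _) (by positivity)
    · rw [abs_mul]
      refine mul_le_mul (hinv i j).1 ?_ (abs_nonneg _) (by norm_num)
      have : |∑ k, christoffel g k i j x * pd k f x| ≤
          ∑ _k : Fin n, 3 * n * C₀ * ‖x‖ ^ (-1 - τ) * b₁ := by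
        refine (abs_sum_le_sum_abs _ _).trans (sum_le_sum fun k _ => ?_)
        rw [abs_mul]
        exact mul_le_mul (hΓ k i j) (hb₁ k) (abs_nonneg _) (by positivity)
      simpa using this
  calc _ ≤ ∑ _i : Fin n, ∑ _j : Fin n,
        (2 * n * (C₀ * ‖x‖ ^ (-τ)) * b₂ + 2 * (n * (3 * n * C₀ * ‖x‖ ^ (-1 - τ) * b₁))) :=
        (abs_sum_le_sum_abs _ _).trans (sum_le_sum fun i _ =>
          (abs_sum_le_sum_abs _ _).trans (sum_le_sum fun j _ => hterm i j))
    _ = 2 * n ^ 3 * (C₀ * (‖x‖ ^ (-τ) * b₂)) + 6 * n ^ 4 * (C₀ * (‖x‖ ^ (-1 - τ) * b₁)) := by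
        simp only [sum_const, card_univ, Fintype.card_fin, nsmul_eq_mul]; ring
    _ ≤ _ := by
        have h3 : (n : ℝ) ^ 3 ≤ n ^ 4 := by nlinarith [hpow 3]
        have : 0 ≤ C₀ * (‖x‖ ^ (-τ) * b₂) := by positivity
        nlinarith [hpow 3, mul_nonneg (sub_nonneg.2 h3) this,
          mul_nonneg (by positivity : (0 : ℝ) ≤ n ^ 4) this]

lemma isOpen_openHalfSpace {n : ℕ} (iN : Fin n) :
    IsOpen {x : EuclideanSpace ℝ (Fin n) | 0 < x iN} :=
  isOpen_lt continuous_const (by fun_prop)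

lemma isClosed_halfSpace {n : ℕ} (iN : Fin n) : IsClosed (halfSpace iN) :=
  isClosed_le continuous_const (by fun_prop)

lemma halfSpace_mem_nhds {n : ℕ} {iN : Fin n} {x : EuclideanSpace ℝ (Fin n)} (hx : 0 < x iN) :
    halfSpace iN ∈ 𝓝 x :=
  mem_of_superset ((isOpen_openHalfSpace iN).mem_nhds hx) fun y (hy : 0 < y iN) => hy.le

lemma tendsto_add_smul_single {n : ℕ} (iN : Fin n) (x : EuclideanSpace ℝ (Fin n)) :
    Tendsto (fun t : ℝ => x + t • EuclideanSpace.single iN (1 : ℝ)) (𝓝[>] 0) (𝓝 x) := by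
  have : ContinuousAt (fun t : ℝ => x + t • EuclideanSpace.single iN (1 : ℝ)) 0 := by fun_prop
  simpa using this.tendsto.mono_left nhdsWithin_le_nhds

lemma add_smul_single_pos {n : ℕ} {iN : Fin n} {x : EuclideanSpace ℝ (Fin n)}
    (hx : x ∈ halfSpace iN) {t : ℝ} (ht : 0 < t) :
    0 < (x + t • EuclideanSpace.single iN (1 : ℝ)) iN := by
  have : 0 ≤ x iN := hx
  simp; linarith

lemma closure_openHalfSpace {n : ℕ} (iN : Fin n) :
    closure {x : EuclideanSpace ℝ (Fin n) | 0 < x iN} = halfSpace iN := by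
  refine subset_antisymm (closure_minimal (fun x (hx : 0 < x iN) => hx.le) (isClosed_halfSpace iN)) ?_
  intro x hx
  refine mem_closure_of_tendsto (tendsto_add_smul_single iN x) ?_
  filter_upwards [self_mem_nhdsWithin] with t ht using add_smul_single_pos hx ht

lemma tendsto_of_continuousWithinAt_halfSpace {n : ℕ} {iN : Fin n}
    {x : EuclideanSpace ℝ (Fin n)} (hx : x ∈ halfSpace iN) {f : EuclideanSpace ℝ (Fin n) → ℝ}
    (hf : ContinuousWithinAt f (halfSpace iN) x) :
    Tendsto (fun t : ℝ => f (x + t • EuclideanSpace.single iN (1 : ℝ))) (𝓝[>] 0) (𝓝 (f x)) := by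
  refine hf.tendsto.comp (tendsto_nhdsWithin_iff.2 ⟨tendsto_add_smul_single iN x, ?_⟩)
  filter_upwards [self_mem_nhdsWithin] with t ht using (add_smul_single_pos hx ht).le

lemma uniqueDiffOn_halfSpace {n : ℕ} (iN : Fin n) : UniqueDiffOn ℝ (halfSpace iN) := by
  refine uniqueDiffOn_convex ?_ ⟨EuclideanSpace.single iN 1, ?_⟩
  · intro x hx y hy a b ha hb _
    have hx : 0 ≤ x iN := hx
    have hy : 0 ≤ y iN := hy
    change 0 ≤ (a • x + b • y) iN
    simp only [PiLp.add_apply, PiLp.smul_apply, smul_eq_mul]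
    positivity
  · rw [mem_interior_iff_mem_nhds]
    exact halfSpace_mem_nhds (by simp)

/-- Partial derivative of `u` on the half-space, one-sided at the boundary. -/
def pdw {n : ℕ} (iN i : Fin n) (u : EuclideanSpace ℝ (Fin n) → ℝ)
    (x : EuclideanSpace ℝ (Fin n)) : ℝ :=
  fderivWithin ℝ u (halfSpace iN) x (EuclideanSpace.single i 1)

lemma pdw_eq_pd {n : ℕ} {iN : Fin n} (i : Fin n) (u : EuclideanSpace ℝ (Fin n) → ℝ)
    {x : EuclideanSpace ℝ (Fin n)} (hx : 0 < x iN) : pdw iN i u x = pd i u x := by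
  rw [pdw, pd, fderivWithin_of_mem_nhds (halfSpace_mem_nhds hx)]

lemma pdw_eventuallyEq_pd {n : ℕ} {iN : Fin n} (i : Fin n) (u : EuclideanSpace ℝ (Fin n) → ℝ)
    {x : EuclideanSpace ℝ (Fin n)} (hx : 0 < x iN) : pdw iN i u =ᶠ[𝓝 x] pd i u := by
  filter_upwards [(isOpen_openHalfSpace iN).mem_nhds hx] with y hy using pdw_eq_pd i u hy

lemma pd_congr {n : ℕ} (i : Fin n) {f g : EuclideanSpace ℝ (Fin n) → ℝ}
    {x : EuclideanSpace ℝ (Fin n)} (h : f =ᶠ[𝓝 x] g) : pd i f x = pd i g x := by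
  rw [pd, pd, h.fderiv_eq]

lemma pdw_pdw_eq {n : ℕ} {iN : Fin n} (i j : Fin n) (u : EuclideanSpace ℝ (Fin n) → ℝ)
    {x : EuclideanSpace ℝ (Fin n)} (hx : 0 < x iN) :
    pdw iN i (pdw iN j u) x = pd i (pd j u) x := by
  rw [pdw_eq_pd i _ hx, pd_congr i (pdw_eventuallyEq_pd j u hx)]

lemma contDiffOn_pdw {n : ℕ} {iN : Fin n} (i : Fin n) {u : EuclideanSpace ℝ (Fin n) → ℝ}
    {k l : ℕ} (hkl : l + 1 ≤ k) (hu : ContDiffOn ℝ k u (halfSpace iN)) :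
    ContDiffOn ℝ l (pdw iN i u) (halfSpace iN) := by
  have := hu.fderivWithin (uniqueDiffOn_halfSpace iN) (m := l) (by exact_mod_cast hkl)
  exact this.clm_apply contDiffOn_const

lemma abs_le_on_halfSpace {n : ℕ} {iN : Fin n} {f b : EuclideanSpace ℝ (Fin n) → ℝ}
    (hf : ContinuousOn f (halfSpace iN)) (hb : ContinuousOn b (halfSpace iN))
    (h : ∀ x, 0 < x iN → |f x| ≤ b x) : ∀ x ∈ halfSpace iN, |f x| ≤ b x := by
  intro x hx
  rw [← closure_openHalfSpace] at hf hb hx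
  exact le_on_closure (s := {x : EuclideanSpace ℝ (Fin n) | 0 < x iN}) (f := fun x => |f x|)
    (fun x hx => h x hx) hf.abs hb hx

lemma continuous_one_add_norm_rpow {n : ℕ} (C p : ℝ) :
    Continuous fun x : EuclideanSpace ℝ (Fin n) => C * (1 + ‖x‖) ^ p := by
  refine continuous_const.mul (Continuous.rpow_const (by fun_prop) fun x => Or.inl ?_)
  positivity

lemma eq_sum_smul_single {n : ℕ} (x : EuclideanSpace ℝ (Fin n)) :
    x = ∑ i, x i • EuclideanSpace.single i (1 : ℝ) := by
  ext j
  simp [Finset.sum_apply, Pi.single_apply]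

lemma clm_apply_eq_sum {n : ℕ} (L : EuclideanSpace ℝ (Fin n) →L[ℝ] ℝ)
    (x : EuclideanSpace ℝ (Fin n)) :
    L x = ∑ i, x i * L (EuclideanSpace.single i 1) := by
  conv_lhs => rw [eq_sum_smul_single x]
  simp

/-- The decay estimates hold up to the boundary for the one-sided derivatives. -/
theorem exists_pdw_bounds {n : ℕ} {iN : Fin n} {α τ : ℝ} {u : EuclideanSpace ℝ (Fin n) → ℝ}
    (hu : MemC2AlphaTau iN α τ u) :
    ∃ C > 0, ∀ x ∈ halfSpace iN, |u x| ≤ C * (1 + ‖x‖) ^ (-τ) ∧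
      (∀ i, |pdw iN i u x| ≤ C * (1 + ‖x‖) ^ (-1 - τ)) ∧
      (∀ i j, |pdw iN i (pdw iN j u) x| ≤ C * (1 + ‖x‖) ^ (-2 - τ)) := by
  obtain ⟨hC2, C, hC, hb, -⟩ := hu
  refine ⟨C, hC, fun x hx => ⟨(hb x hx).1, fun i => ?_, fun i j => ?_⟩⟩
  · refine abs_le_on_halfSpace (f := pdw iN i u) (contDiffOn_pdw (l := 1) i le_rfl hC2).continuousOn
      (continuous_one_add_norm_rpow _ _).continuousOn (fun x hx => ?_) x hx
    rw [pdw_eq_pd i u hx]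
    exact (hb x hx.le).2.1 i
  · refine abs_le_on_halfSpace (f := pdw iN i (pdw iN j u)) (contDiffOn_pdw (l := 0) i le_rfl
      (contDiffOn_pdw (l := 1) j le_rfl hC2)).continuousOn
      (continuous_one_add_norm_rpow _ _).continuousOn (fun x hx => ?_) x hx
    rw [pdw_pdw_eq i j u hx]
    exact (hb x hx.le).2.2 i j

lemma pdw_alternative {n : ℕ} {iN : Fin n} {α τ : ℝ} (hα : 0 < α)
    {u : EuclideanSpace ℝ (Fin n) → ℝ} (hu : MemC2AlphaTau iN α τ u)
    {y : EuclideanSpace ℝ (Fin n)} (hy : y ∈ halfSpace iN) (hy1 : 1 ≤ ‖y‖)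
    (hnd : ¬ DifferentiableAt ℝ u y) (j : Fin n) :
    pdw iN j u y = 0 ∨ ∀ i, pdw iN i (pdw iN j u) y = 0 := by
  obtain ⟨hC2, C, hC, -, hH⟩ := hu
  have h1 := contDiffOn_pdw (l := 1) j le_rfl hC2
  have hpd0 : pd j u y = 0 := by rw [pd, fderiv_zero_of_not_differentiableAt hnd]; simp
  by_cases hd : DifferentiableAt ℝ (pd j u) y
  · left
    have l1 := tendsto_of_continuousWithinAt_halfSpace hy (h1.continuousOn y hy)
    have l2 : Tendsto (fun t : ℝ => pdw iN j u (y + t • EuclideanSpace.single iN (1 : ℝ)))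
        (𝓝[>] 0) (𝓝 (pd j u y)) := by
      refine (hd.continuousAt.tendsto.comp (tendsto_add_smul_single iN y)).congr' ?_
      filter_upwards [self_mem_nhdsWithin] with t ht
      exact (pdw_eq_pd j u (add_smul_single_pos hy ht)).symm
    rw [tendsto_nhds_unique l1 l2, hpd0]
  · right
    intro i
    have h2 := contDiffOn_pdw (l := 0) i le_rfl h1
    have l1 := tendsto_of_continuousWithinAt_halfSpace hy (h2.continuousOn y hy)
    have hpd2 : pd i (pd j u) y = 0 := by
      rw [pd, fderiv_zero_of_not_differentiableAt hd]; simp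
    refine tendsto_nhds_unique l1 ?_
    rw [tendsto_zero_iff_abs_tendsto_zero]
    have l3 : Tendsto (fun t : ℝ => C * t ^ α * ‖y‖ ^ (-2 - τ - α)) (𝓝[>] 0) (𝓝 0) := by
      have : ContinuousAt (fun t : ℝ => C * t ^ α * ‖y‖ ^ (-2 - τ - α)) 0 := by
        refine (continuousAt_const.mul ?_).mul continuousAt_const
        exact Real.continuousAt_rpow_const _ _ (Or.inr hα.le)
      have := this.tendsto.mono_left (nhdsWithin_le_nhds (s := Set.Ioi 0))
      simpa [Real.zero_rpow hα.ne'] using this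
    refine squeeze_zero' (.of_forall fun t => abs_nonneg _) ?_ l3
    filter_upwards [Ioo_mem_nhdsGT (show (0 : ℝ) < 1 / 2 by norm_num)] with t ht
    have hp := add_smul_single_pos hy ht.1
    have hnorm : ‖y - (y + t • EuclideanSpace.single iN (1 : ℝ))‖ = t := by
      rw [sub_add_cancel_left, norm_neg, norm_smul, PiLp.norm_single]
      simp [abs_of_pos ht.1]
    have := hH y hy _ hp.le hy1 (by rw [hnorm]; linarith [ht.2]) i j
    rw [hpd2, zero_sub, abs_neg, hnorm, ← pdw_pdw_eq i j u hp] at this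
    exact this

lemma hasDerivAt_pdw_ray {n : ℕ} {iN : Fin n} {u : EuclideanSpace ℝ (Fin n) → ℝ}
    (hC2 : ContDiffOn ℝ 2 u (halfSpace iN)) {y : EuclideanSpace ℝ (Fin n)} (hy : y ∈ bdry iN)
    (j : Fin n) (t : ℝ) :
    HasDerivAt (fun t : ℝ => pdw iN j u (t • y))
      (∑ i, y i * pdw iN i (pdw iN j u) (t • y)) t := by
  have hmem : ∀ t : ℝ, t • y ∈ halfSpace iN := fun t => by
    have : y iN = 0 := hy
    simp [halfSpace, this]
  have h1 := ((contDiffOn_pdw (k := 2) (l := 1) j le_rfl hC2).differentiableOn (by norm_num)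
    _ (hmem t)).hasFDerivWithinAt
  have h2 : HasDerivAt (fun t : ℝ => t • y) y t := by
    simpa using (hasDerivAt_id t).smul_const y
  have := h1.comp_hasDerivAt t h2 (.of_forall hmem)
  rw [clm_apply_eq_sum] at this
  exact this

/-- On the boundary the one-sided normal derivative is controlled by the tangential ones. -/
theorem exists_abs_pdw_normal_le {n : ℕ} {iN : Fin n} {τ : ℝ} (hτ : 0 < τ)
    {g : EuclideanSpace ℝ (Fin n) → Matrix (Fin n) (Fin n) ℝ}
    (hg : IsCmMetric 2 iN g) (hgAF : IsAsymptoticallyFlat iN τ g)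
    {α : ℝ} (hα : 0 < α) {u : EuclideanSpace ℝ (Fin n) → ℝ} (hu : MemC2AlphaTau iN α τ u)
    {lam₀ : ℝ} (hbd : ∀ y ∈ bdry iN, lam₀ ≤ ‖y‖ → nuDeriv iN g u y = 0) :
    ∃ C > 0, ∃ R ≥ 1, ∀ y ∈ bdry iN, R ≤ ‖y‖ →
      |pdw iN iN u y| ≤ C * ‖y‖ ^ (-τ) * ∑ j ∈ univ.erase iN, |pdw iN j u y| := by
  obtain ⟨C, hC, R, hR1, hinv⟩ := exists_laplaceBeltrami_sub_le iN hτ hg hgAF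
  obtain ⟨D, hD, hdecay⟩ := exists_pdw_bounds hu
  have hlim : Tendsto (fun r : ℝ => C * r ^ (-τ)) atTop (𝓝 0) := by
    simpa using (tendsto_rpow_neg_atTop hτ).const_mul C
  obtain ⟨R', hR'⟩ := (hlim.eventually
    (ge_mem_nhds (show (0 : ℝ) < 1 / 2 by norm_num))).exists_forall_of_atTop
  have key : ∀ y ∈ bdry iN, R ≤ ‖y‖ → R' ≤ ‖y‖ →
      ∑ i, (g y)⁻¹ i iN * pdw iN i u y = 0 →
      |pdw iN iN u y| ≤ 2 * C * ‖y‖ ^ (-τ) * ∑ j ∈ univ.erase iN, |pdw iN j u y| := by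
    intro y hy hyR hyR' h0
    have hyH : y ∈ halfSpace iN := le_of_eq (Eq.symm hy)
    have hG := (hinv y hyH hyR).1
    rw [← add_sum_erase _ _ (mem_univ iN)] at h0
    have h1 : 1 / 2 ≤ (g y)⁻¹ iN iN := by
      have := hG iN iN
      rw [Matrix.one_apply_eq] at this
      linarith [(abs_le.1 this).1, hR' _ hyR']
    have h2 : |∑ i ∈ univ.erase iN, (g y)⁻¹ i iN * pdw iN i u y| ≤
        C * ‖y‖ ^ (-τ) * ∑ j ∈ univ.erase iN, |pdw iN j u y| := by
      rw [mul_sum]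
      refine (abs_sum_le_sum_abs _ _).trans (sum_le_sum fun i hi => ?_)
      rw [abs_mul]
      have := hG i iN
      rw [Matrix.one_apply_ne (ne_of_mem_erase hi), sub_zero] at this
      exact mul_le_mul_of_nonneg_right this (abs_nonneg _)
    have h3 : (g y)⁻¹ iN iN * |pdw iN iN u y| ≤
        C * ‖y‖ ^ (-τ) * ∑ j ∈ univ.erase iN, |pdw iN j u y| := by
      rw [← abs_of_pos (by linarith : 0 < (g y)⁻¹ iN iN), ← abs_mul, eq_neg_of_add_eq_zero_left h0,
        abs_neg]
      exact h2
    nlinarith [abs_nonneg (pdw iN iN u y)]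
  refine ⟨2 * C, by positivity, max (max R R') lam₀, hR1.trans ((le_max_left _ _).trans
    (le_max_left _ _)), fun y hy hyR => ?_⟩
  have hyl : lam₀ ≤ ‖y‖ := (le_max_right _ _).trans hyR
  have hyR1 : R ≤ ‖y‖ := ((le_max_left _ _).trans (le_max_left _ _)).trans hyR
  have hyR2 : R' ≤ ‖y‖ := ((le_max_right _ _).trans (le_max_left _ _)).trans hyR
  have hy0 : 0 < ‖y‖ := by linarith
  have hmem : ∀ t : ℝ, t • y ∈ bdry iN := fun t => by
    have : y iN = 0 := hy
    simp [bdry, this]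
  have hmemH : ∀ t : ℝ, t • y ∈ halfSpace iN := fun t => le_of_eq (Eq.symm (hmem t))
  have hnorm : ∀ t : ℝ, 1 ≤ t → ‖t • y‖ = t * ‖y‖ := fun t ht => by
    rw [norm_smul, Real.norm_of_nonneg (by linarith)]
  have hnorm' : ∀ t : ℝ, 1 ≤ t → ‖y‖ ≤ ‖t • y‖ := fun t ht => by
    rw [hnorm t ht]; nlinarith
  set Z : Set ℝ := {t | 1 ≤ t ∧ |pdw iN iN u (t • y)| ≤
    2 * C * ‖t • y‖ ^ (-τ) * ∑ j ∈ univ.erase iN, |pdw iN j u (t • y)|} with hZ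
  have hφ := hasDerivAt_pdw_ray hu.1 hy
  have hφc : ∀ j, Continuous fun t : ℝ => pdw iN j u (t • y) := fun j =>
    continuous_iff_continuousAt.2 fun t => (hφ j t).continuousAt
  have hdichot : ∀ t : ℝ, 1 ≤ t → t ∉ Z → ∀ j,
      pdw iN j u (t • y) = 0 ∨ ∀ i, pdw iN i (pdw iN j u) (t • y) = 0 := by
    intro t ht htZ j
    have htn := hnorm' t ht
    refine pdw_alternative hα hu (hmemH t) (by linarith) (fun hd => htZ ⟨ht, ?_⟩) j
    refine key _ (hmem t) (by linarith) (by linarith) ?_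
    have hpos : 0 < (g (t • y))⁻¹ iN iN := ((hg.2 _ (hmemH t)).2.inv).diag_pos
    have h0 := hbd _ (hmem t) (by linarith)
    have h1 : nuDeriv iN g u (t • y) =
        (∑ i, (g (t • y))⁻¹ i iN * pdw iN i u (t • y)) / √((g (t • y))⁻¹ iN iN) := by
      rw [nuDeriv, sum_div]
      refine sum_congr rfl fun i _ => ?_
      rw [pdw, hd.fderivWithin (uniqueDiffOn_halfSpace iN _ (hmemH t)), nuVec, pd]
      simp
      ring
    rw [h1, div_eq_zero_iff] at h0
    exact h0.resolve_right (Real.sqrt_pos.2 hpos).ne'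
  have hconst : ∀ b : ℝ, 1 ≤ b → (∀ t ∈ Set.Ico 1 b, t ∉ Z) → ∀ j,
      pdw iN j u (b • y) = pdw iN j u y := by
    intro b hb hbZ j
    have h3 : ∀ t : ℝ, HasDerivAt (fun t : ℝ => pdw iN j u (t • y) ^ 3)
        (3 * pdw iN j u (t • y) ^ 2 * ∑ i, y i * pdw iN i (pdw iN j u) (t • y)) t := fun t => by
      have := (hφ j t).fun_pow 3
      simpa using this
    have := constant_of_has_deriv_right_zero (a := 1) (b := b)
      (f := fun t : ℝ => pdw iN j u (t • y) ^ 3)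
      (fun t _ => (h3 t).continuousAt.continuousWithinAt) (fun t ht => by
        have hz : 3 * pdw iN j u (t • y) ^ 2 * ∑ i, y i * pdw iN i (pdw iN j u) (t • y) = 0 := by
          rcases hdichot t ht.1 (hbZ t ht) j with h | h
          · simp [h]
          · simp [h]
        rw [← hz]; exact (h3 t).hasDerivWithinAt) b ⟨hb, le_rfl⟩
    simp only [one_smul] at this
    exact (Odd.strictMono_pow (by decide : Odd 3)).injective this
  by_cases hne : Z.Nonempty
  · have hcl : IsClosed Z := by
      have hcpow : ContinuousOn (fun t : ℝ => ‖t • y‖ ^ (-τ)) (Set.Ici 1) := by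
        refine ContinuousOn.rpow_const (by fun_prop) fun t ht => Or.inl ?_
        have := hnorm' t ht
        exact (by linarith : (0 : ℝ) < _).ne'
      have : Z = Set.Ici 1 ∩ (fun t => |pdw iN iN u (t • y)| -
          2 * C * ‖t • y‖ ^ (-τ) * ∑ j ∈ univ.erase iN, |pdw iN j u (t • y)|) ⁻¹' Set.Iic 0 := by
        ext t; simp [hZ]
      rw [this]
      refine ContinuousOn.preimage_isClosed_of_isClosed ?_ isClosed_Ici isClosed_Iic
      refine (hφc iN).abs.continuousOn.sub ((continuousOn_const.mul hcpow).mul ?_)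
      exact (continuous_finsetSum _ fun j _ => (hφc j).abs).continuousOn
    have hbdd : BddBelow Z := ⟨1, fun t ht => ht.1⟩
    have hmemZ := hcl.csInf_mem hne hbdd
    have hc := hconst (sInf Z) hmemZ.1 (fun t ht htZ => not_le.2 ht.2 (csInf_le hbdd htZ))
    have := hmemZ.2
    simp only [hc] at this
    refine this.trans ?_
    have hle : ‖sInf Z • y‖ ^ (-τ) ≤ ‖y‖ ^ (-τ) :=
      Real.rpow_le_rpow_of_nonpos hy0 (hnorm' _ hmemZ.1) (by linarith)
    gcongr
  · have hP0 : pdw iN iN u y = 0 := by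
      have hc : ∀ b : ℝ, 1 ≤ b → |pdw iN iN u y| ≤ D * (1 + b * ‖y‖) ^ (-1 - τ) := fun b hb => by
        rw [← hconst b hb (fun t _ ht => hne ⟨t, ht⟩) iN, ← hnorm b hb]
        exact (hdecay _ (hmemH b)).2.1 iN
      have hl : Tendsto (fun b : ℝ => D * (1 + b * ‖y‖) ^ (-1 - τ)) atTop (𝓝 0) := by
        have h1 : Tendsto (fun b : ℝ => 1 + b * ‖y‖) atTop atTop :=
          tendsto_atTop_add_const_left _ _ (tendsto_id.atTop_mul_const hy0)
        have h2 := (tendsto_rpow_neg_atTop (show 0 < 1 + τ by linarith)).comp h1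
        have := h2.const_mul D
        rw [mul_zero] at this
        refine this.congr fun b => ?_
        simp only [Function.comp]
        rw [show -(1 + τ) = -1 - τ by ring]
      exact abs_nonpos_iff.1 (ge_of_tendsto hl ((eventually_ge_atTop 1).mono hc))
    rw [hP0, abs_zero]
    positivity

lemma HasFDerivAt.pd_eq {n : ℕ} {f : EuclideanSpace ℝ (Fin n) → ℝ}
    {L : EuclideanSpace ℝ (Fin n) →L[ℝ] ℝ} {x : EuclideanSpace ℝ (Fin n)}
    (h : HasFDerivAt f L x) (i : Fin n) : pd i f x = L (EuclideanSpace.single i 1) := by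
  rw [pd, h.fderiv]

lemma hasFDerivAt_norm_rpow_of_ne_zero {n : ℕ} (a : ℝ) {x : EuclideanSpace ℝ (Fin n)}
    (hx : x ≠ 0) :
    HasFDerivAt (fun x : EuclideanSpace ℝ (Fin n) => ‖x‖ ^ a)
      ((a * ‖x‖ ^ (a - 2)) • innerSL ℝ x) x := by
  have hx0 : 0 < ‖x‖ := norm_pos_iff.2 hx
  have h := ((hasStrictFDerivAt_norm_sq x).hasFDerivAt).rpow_const (p := a / 2)
    (Or.inl (by positivity))
  have he : ∀ y : EuclideanSpace ℝ (Fin n), ∀ b : ℝ, (‖y‖ ^ 2) ^ (b / 2) = ‖y‖ ^ b := fun y b => by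
    rw [← Real.rpow_natCast, ← Real.rpow_mul (norm_nonneg _)]
    congr 1
    push_cast; ring
  simp only [he] at h
  rw [show a / 2 - 1 = (a - 2) / 2 by ring, he] at h
  refine h.congr_fderiv ?_
  ext v
  simp
  ring

lemma pd_norm_rpow {n : ℕ} (a : ℝ) {x : EuclideanSpace ℝ (Fin n)} (hx : x ≠ 0) (i : Fin n) :
    pd i (fun x : EuclideanSpace ℝ (Fin n) => ‖x‖ ^ a) x = a * (x i * ‖x‖ ^ (a - 2)) := by
  rw [(hasFDerivAt_norm_rpow_of_ne_zero a hx).pd_eq]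
  simp [EuclideanSpace.inner_single_right]
  ring

lemma pd_coord {n : ℕ} (i k : Fin n) (x : EuclideanSpace ℝ (Fin n)) :
    pd i (fun x : EuclideanSpace ℝ (Fin n) => x k) x = if i = k then 1 else 0 := by
  have : HasFDerivAt (fun x : EuclideanSpace ℝ (Fin n) => x k)
      (EuclideanSpace.proj k : EuclideanSpace ℝ (Fin n) →L[ℝ] ℝ) x :=
    (EuclideanSpace.proj k : EuclideanSpace ℝ (Fin n) →L[ℝ] ℝ).hasFDerivAt
  rw [this.pd_eq]
  simp [eq_comm]

lemma pd_mul {n : ℕ} (i : Fin n) {f g : EuclideanSpace ℝ (Fin n) → ℝ}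
    {x : EuclideanSpace ℝ (Fin n)} (hf : DifferentiableAt ℝ f x) (hg : DifferentiableAt ℝ g x) :
    pd i (fun x => f x * g x) x = f x * pd i g x + pd i f x * g x := by
  rw [(hf.hasFDerivAt.fun_mul hg.hasFDerivAt).pd_eq]
  simp [pd]; ring

lemma pd_add {n : ℕ} (i : Fin n) {f g : EuclideanSpace ℝ (Fin n) → ℝ}
    {x : EuclideanSpace ℝ (Fin n)} (hf : DifferentiableAt ℝ f x) (hg : DifferentiableAt ℝ g x) :
    pd i (fun x => f x + g x) x = pd i f x + pd i g x := by
  rw [(hf.hasFDerivAt.fun_add hg.hasFDerivAt).pd_eq]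
  simp [pd]

lemma pd_const_mul {n : ℕ} (i : Fin n) (c : ℝ) {f : EuclideanSpace ℝ (Fin n) → ℝ}
    {x : EuclideanSpace ℝ (Fin n)} (hf : DifferentiableAt ℝ f x) :
    pd i (fun x => c * f x) x = c * pd i f x := by
  rw [(hf.hasFDerivAt.const_mul c).pd_eq]
  simp [pd]

lemma contDiffAt_norm_rpow {n : ℕ} (a : ℝ) {x : EuclideanSpace ℝ (Fin n)} (hx : x ≠ 0)
    {k : WithTop ℕ∞} : ContDiffAt ℝ k (fun x : EuclideanSpace ℝ (Fin n) => ‖x‖ ^ a) x :=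
  (contDiffAt_norm ℝ hx).rpow_const_of_ne (norm_ne_zero_iff.2 hx)

lemma contDiffAt_coord {n : ℕ} (j : Fin n) {x : EuclideanSpace ℝ (Fin n)}
    {k : WithTop ℕ∞} : ContDiffAt ℝ k (fun x : EuclideanSpace ℝ (Fin n) => x j) x :=
  (EuclideanSpace.proj j : EuclideanSpace ℝ (Fin n) →L[ℝ] ℝ).contDiff.contDiffAt

lemma pd_coord_mul_norm_rpow {n : ℕ} (a : ℝ) {x : EuclideanSpace ℝ (Fin n)} (hx : x ≠ 0)
    (i k : Fin n) :
    pd i (fun x : EuclideanSpace ℝ (Fin n) => x k * ‖x‖ ^ a) x =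
      (if i = k then 1 else 0) * ‖x‖ ^ a + a * (x k * x i * ‖x‖ ^ (a - 2)) := by
  rw [pd_mul i ((contDiffAt_coord k).differentiableAt one_ne_zero)
    ((contDiffAt_norm_rpow a hx).differentiableAt one_ne_zero), pd_norm_rpow a hx, pd_coord]
  ring

lemma pd_coord_mul_coord_mul_norm_rpow {n : ℕ} (a : ℝ) {x : EuclideanSpace ℝ (Fin n)} (hx : x ≠ 0)
    (i k l : Fin n) :
    pd i (fun x : EuclideanSpace ℝ (Fin n) => x k * x l * ‖x‖ ^ a) x =
      (if i = k then 1 else 0) * (x l * ‖x‖ ^ a) + (if i = l then 1 else 0) * (x k * ‖x‖ ^ a) +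
        a * (x k * x l * x i * ‖x‖ ^ (a - 2)) := by
  simp only [mul_assoc]
  rw [pd_mul i ((contDiffAt_coord k).differentiableAt one_ne_zero)
    (((contDiffAt_coord l).mul (contDiffAt_norm_rpow a hx)).differentiableAt one_ne_zero),
    pd_coord_mul_norm_rpow a hx, pd_coord]
  ring

lemma eventually_ne_zero {n : ℕ} {x : EuclideanSpace ℝ (Fin n)} (hx : x ≠ 0) :
    ∀ᶠ y in 𝓝 x, y ≠ 0 := isOpen_ne.mem_nhds hx

lemma pd_pd_norm_rpow {n : ℕ} (a : ℝ) {x : EuclideanSpace ℝ (Fin n)} (hx : x ≠ 0) (i j : Fin n) :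
    pd j (pd i (fun x : EuclideanSpace ℝ (Fin n) => ‖x‖ ^ a)) x =
      a * ((if j = i then 1 else 0) * ‖x‖ ^ (a - 2) + (a - 2) * (x i * x j * ‖x‖ ^ (a - 4))) := by
  rw [pd_congr j (g := fun y => a * (y i * ‖y‖ ^ (a - 2)))
    ((eventually_ne_zero hx).mono fun y hy => pd_norm_rpow a hy i),
    pd_const_mul j a (((contDiffAt_coord i).mul
      (contDiffAt_norm_rpow _ hx)).differentiableAt one_ne_zero),
    pd_coord_mul_norm_rpow _ hx, show a - 2 - 2 = a - 4 by ring]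

lemma pd_pd_coord_mul_norm_rpow {n : ℕ} (a : ℝ) {x : EuclideanSpace ℝ (Fin n)} (hx : x ≠ 0)
    (i j k : Fin n) :
    pd j (pd i (fun x : EuclideanSpace ℝ (Fin n) => x k * ‖x‖ ^ a)) x =
      a * ((if i = k then 1 else 0) * (x j * ‖x‖ ^ (a - 2)) +
        ((if j = k then 1 else 0) * (x i * ‖x‖ ^ (a - 2)) +
          (if j = i then 1 else 0) * (x k * ‖x‖ ^ (a - 2)) +
          (a - 2) * (x k * x i * x j * ‖x‖ ^ (a - 4)))) := by
  rw [pd_congr j (g := fun y => (if i = k then 1 else 0) * ‖y‖ ^ a + a * (y k * y i * ‖y‖ ^ (a - 2)))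
    ((eventually_ne_zero hx).mono fun y hy => pd_coord_mul_norm_rpow a hy i k),
    pd_add j, pd_const_mul j, pd_const_mul j, pd_norm_rpow a hx,
    pd_coord_mul_coord_mul_norm_rpow _ hx, show a - 2 - 2 = a - 4 by ring]
  · ring
  · exact (((contDiffAt_coord k).mul (contDiffAt_coord i)).mul
      (contDiffAt_norm_rpow _ hx)).differentiableAt one_ne_zero
  · exact (contDiffAt_norm_rpow _ hx).differentiableAt one_ne_zero
  · exact (contDiffAt_const.mul (contDiffAt_norm_rpow _ hx)).differentiableAt one_ne_zero
  · exact (contDiffAt_const.mul (((contDiffAt_coord k).mul (contDiffAt_coord i)).mul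
      (contDiffAt_norm_rpow _ hx))).differentiableAt one_ne_zero

lemma sum_coord_sq {n : ℕ} (x : EuclideanSpace ℝ (Fin n)) : ∑ i, x i * x i = ‖x‖ ^ 2 := by
  rw [EuclideanSpace.real_norm_sq_eq]
  exact sum_congr rfl fun i _ => (sq _).symm

lemma norm_sq_mul_rpow {n : ℕ} {x : EuclideanSpace ℝ (Fin n)} (hx : x ≠ 0) (a : ℝ) :
    ‖x‖ ^ 2 * ‖x‖ ^ (a - 4) = ‖x‖ ^ (a - 2) := by
  rw [← Real.rpow_natCast, ← Real.rpow_add (norm_pos_iff.2 hx)]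
  congr 1; push_cast; ring

lemma euclLap_norm_rpow {n : ℕ} (a : ℝ) {x : EuclideanSpace ℝ (Fin n)} (hx : x ≠ 0) :
    euclLap (fun x : EuclideanSpace ℝ (Fin n) => ‖x‖ ^ a) x = a * (n + a - 2) * ‖x‖ ^ (a - 2) := by
  have : ∀ i : Fin n, pd i (pd i (fun x : EuclideanSpace ℝ (Fin n) => ‖x‖ ^ a)) x =
      a * ‖x‖ ^ (a - 2) + x i * x i * (a * (a - 2) * ‖x‖ ^ (a - 4)) := fun i => by
    rw [pd_pd_norm_rpow a hx]; simp; ring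
  rw [euclLap, sum_congr rfl fun i _ => this i, sum_add_distrib,
    ← sum_mul univ fun i => x i * x i, sum_coord_sq,
    show ‖x‖ ^ 2 * (a * (a - 2) * ‖x‖ ^ (a - 4)) = a * (a - 2) * (‖x‖ ^ 2 * ‖x‖ ^ (a - 4)) by ring,
    norm_sq_mul_rpow hx]
  simp
  ring

lemma euclLap_coord_mul_norm_rpow {n : ℕ} (a : ℝ) {x : EuclideanSpace ℝ (Fin n)} (hx : x ≠ 0)
    (k : Fin n) :
    euclLap (fun x : EuclideanSpace ℝ (Fin n) => x k * ‖x‖ ^ a) x =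
      a * (n + a) * (x k * ‖x‖ ^ (a - 2)) := by
  have : ∀ i : Fin n, pd i (pd i (fun x : EuclideanSpace ℝ (Fin n) => x k * ‖x‖ ^ a)) x =
      (if i = k then 1 else 0) * (2 * a * (x i * ‖x‖ ^ (a - 2))) + a * (x k * ‖x‖ ^ (a - 2)) +
        x i * x i * (a * (a - 2) * (x k * ‖x‖ ^ (a - 4))) := fun i => by
    rw [pd_pd_coord_mul_norm_rpow a hx]; split_ifs <;> simp_all <;> ring
  rw [euclLap, sum_congr rfl fun i _ => this i, sum_add_distrib, sum_add_distrib,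
    ← sum_mul univ fun i => x i * x i,
    sum_coord_sq, show ‖x‖ ^ 2 * (a * (a - 2) * (x k * ‖x‖ ^ (a - 4))) =
      a * (a - 2) * (x k * (‖x‖ ^ 2 * ‖x‖ ^ (a - 4))) by ring, norm_sq_mul_rpow hx]
  simp
  ring

lemma abs_coord_le {n : ℕ} (x : EuclideanSpace ℝ (Fin n)) (i : Fin n) : |x i| ≤ ‖x‖ := by
  simpa using PiLp.norm_apply_le x i

lemma abs_coord_mul_le {n : ℕ} {x : EuclideanSpace ℝ (Fin n)} (hx : x ≠ 0) (i : Fin n) {c y : ℝ}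
    (hy : |y| ≤ ‖x‖ ^ c) : |x i * y| ≤ ‖x‖ ^ (c + 1) := by
  rw [abs_mul, Real.rpow_add_one (norm_ne_zero_iff.2 hx), mul_comm]
  exact mul_le_mul hy (abs_coord_le x i) (abs_nonneg _) (by positivity)

lemma abs_norm_rpow_le {n : ℕ} (x : EuclideanSpace ℝ (Fin n)) (c : ℝ) : |‖x‖ ^ c| ≤ ‖x‖ ^ c :=
  (abs_of_nonneg (by positivity)).le

lemma abs_ite_mul_le {P : Prop} [Decidable P] {y c : ℝ} (hy : |y| ≤ c) :
    |(if P then 1 else 0) * y| ≤ c := by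
  split_ifs
  · simpa using hy
  · simpa using (abs_nonneg y).trans hy

lemma abs_pd_norm_rpow_le {n : ℕ} (a : ℝ) {x : EuclideanSpace ℝ (Fin n)} (hx : x ≠ 0) (i : Fin n) :
    |pd i (fun x : EuclideanSpace ℝ (Fin n) => ‖x‖ ^ a) x| ≤ |a| * ‖x‖ ^ (a - 1) := by
  rw [pd_norm_rpow a hx, abs_mul, show a - 1 = a - 2 + 1 by ring]
  exact mul_le_mul_of_nonneg_left (abs_coord_mul_le hx i
    (abs_norm_rpow_le x _)) (abs_nonneg _)

lemma abs_pd_pd_norm_rpow_le {n : ℕ} (a : ℝ) {x : EuclideanSpace ℝ (Fin n)} (hx : x ≠ 0)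
    (i j : Fin n) :
    |pd j (pd i (fun x : EuclideanSpace ℝ (Fin n) => ‖x‖ ^ a)) x| ≤
      |a| * (1 + |a - 2|) * ‖x‖ ^ (a - 2) := by
  rw [pd_pd_norm_rpow a hx, abs_mul, mul_assoc |a|]
  refine mul_le_mul_of_nonneg_left ?_ (abs_nonneg _)
  have h1 : |(if j = i then 1 else 0) * ‖x‖ ^ (a - 2)| ≤ ‖x‖ ^ (a - 2) :=
    abs_ite_mul_le (abs_norm_rpow_le x _)
  have h2 : |x i * (x j * ‖x‖ ^ (a - 4))| ≤ ‖x‖ ^ (a - 4 + 1 + 1) :=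
    abs_coord_mul_le hx i (abs_coord_mul_le hx j (abs_norm_rpow_le x _))
  rw [show a - 4 + 1 + 1 = a - 2 by ring, ← mul_assoc] at h2
  refine (abs_add_le _ _).trans ?_
  calc _ ≤ ‖x‖ ^ (a - 2) + |a - 2| * ‖x‖ ^ (a - 2) := by
        rw [abs_mul (a - 2)]
        gcongr
    _ = _ := by ring

lemma abs_pd_coord_mul_norm_rpow_le {n : ℕ} (a : ℝ) {x : EuclideanSpace ℝ (Fin n)} (hx : x ≠ 0)
    (i k : Fin n) :
    |pd i (fun x : EuclideanSpace ℝ (Fin n) => x k * ‖x‖ ^ a) x| ≤ (1 + |a|) * ‖x‖ ^ a := by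
  rw [pd_coord_mul_norm_rpow a hx]
  have h1 : |(if i = k then 1 else 0) * ‖x‖ ^ a| ≤ ‖x‖ ^ a :=
    abs_ite_mul_le (abs_norm_rpow_le x _)
  have h2 : |x k * (x i * ‖x‖ ^ (a - 2))| ≤ ‖x‖ ^ (a - 2 + 1 + 1) :=
    abs_coord_mul_le hx k (abs_coord_mul_le hx i (abs_norm_rpow_le x _))
  rw [show a - 2 + 1 + 1 = a by ring, ← mul_assoc] at h2
  refine (abs_add_le _ _).trans ?_
  calc _ ≤ ‖x‖ ^ a + |a| * ‖x‖ ^ a := by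
        rw [abs_mul a]
        gcongr
    _ = _ := by ring

lemma abs_pd_pd_coord_mul_norm_rpow_le {n : ℕ} (a : ℝ) {x : EuclideanSpace ℝ (Fin n)} (hx : x ≠ 0)
    (i j k : Fin n) :
    |pd j (pd i (fun x : EuclideanSpace ℝ (Fin n) => x k * ‖x‖ ^ a)) x| ≤
      |a| * (3 + |a - 2|) * ‖x‖ ^ (a - 1) := by
  rw [pd_pd_coord_mul_norm_rpow a hx, abs_mul, mul_assoc |a|]
  refine mul_le_mul_of_nonneg_left ?_ (abs_nonneg _)
  have h1 : ∀ l, |x l * ‖x‖ ^ (a - 2)| ≤ ‖x‖ ^ (a - 1) := fun l => by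
    rw [show a - 1 = a - 2 + 1 by ring]
    exact abs_coord_mul_le hx l (abs_norm_rpow_le x _)
  have h2 : |x k * (x i * (x j * ‖x‖ ^ (a - 4)))| ≤ ‖x‖ ^ (a - 4 + 1 + 1 + 1) :=
    abs_coord_mul_le hx k (abs_coord_mul_le hx i
      (abs_coord_mul_le hx j (abs_norm_rpow_le x _)))
  rw [show a - 4 + 1 + 1 + 1 = a - 1 by ring, ← mul_assoc, ← mul_assoc] at h2
  refine (abs_add_le _ _).trans ?_
  calc _ ≤ ‖x‖ ^ (a - 1) + (‖x‖ ^ (a - 1) + ‖x‖ ^ (a - 1) + |a - 2| * ‖x‖ ^ (a - 1)) := by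
        refine add_le_add (abs_ite_mul_le (h1 j)) ((abs_add_le _ _).trans (add_le_add
          ((abs_add_le _ _).trans (add_le_add (abs_ite_mul_le (h1 i)) (abs_ite_mul_le (h1 k)))) ?_))
        rw [abs_mul (a - 2)]
        gcongr
    _ = _ := by ring

lemma hasDerivAt_line {n : ℕ} {f : EuclideanSpace ℝ (Fin n) → ℝ} {x v : EuclideanSpace ℝ (Fin n)}
    {t : ℝ} (hf : DifferentiableAt ℝ f (x + t • v)) :
    HasDerivAt (fun t : ℝ => f (x + t • v)) (∑ i, v i * pd i f (x + t • v)) t := by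
  have h2 : HasDerivAt (fun t : ℝ => x + t • v) v t := by
    simpa using ((hasDerivAt_id t).smul_const v).const_add x
  have := hf.hasFDerivAt.comp_hasDerivAt t h2
  rw [clm_apply_eq_sum] at this
  exact this

lemma differentiableAt_pd {n : ℕ} {m : EuclideanSpace ℝ (Fin n) → ℝ}
    {x : EuclideanSpace ℝ (Fin n)} (hm : ContDiffAt ℝ 2 m x) (j : Fin n) :
    DifferentiableAt ℝ (pd j m) x :=
  ((hm.fderiv_right (m := 1) (by norm_num)).clm_apply contDiffAt_const).differentiableAt one_ne_zero

lemma sum_hessian_nonpos_of_isLocalMax {n : ℕ} {m : EuclideanSpace ℝ (Fin n) → ℝ}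
    {x : EuclideanSpace ℝ (Fin n)} (hm : ContDiffAt ℝ 2 m x) (hmax : IsLocalMax m x)
    (v : EuclideanSpace ℝ (Fin n)) :
    ∑ i, ∑ j, v i * v j * pd i (pd j m) x ≤ 0 := by
  by_contra! hpos
  let φ : ℝ → ℝ := fun t => m (x + t • v)
  have hline : Tendsto (fun t : ℝ => x + t • v) (𝓝 0) (𝓝 x) := by
    have : ContinuousAt (fun t : ℝ => x + t • v) 0 := by fun_prop
    simpa using this.tendsto
  have hev : ∀ᶠ y in 𝓝 x, DifferentiableAt ℝ m y :=
    (hm.eventually (by simp)).mono fun y hy => hy.differentiableAt (by norm_num)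
  have hd : deriv φ =ᶠ[𝓝 0] fun t => ∑ j, v j * pd j m (x + t • v) :=
    (hline.eventually hev).mono fun t ht => (hasDerivAt_line ht).deriv
  have h1 : HasDerivAt (fun t : ℝ => ∑ j, v j * pd j m (x + t • v))
      (∑ j, v j * ∑ i, v i * pd i (pd j m) x) 0 := by
    refine HasDerivAt.fun_sum fun j _ => HasDerivAt.const_mul _ ?_
    have := hasDerivAt_line (f := pd j m) (x := x) (v := v) (t := 0)
      (by simpa using differentiableAt_pd hm j)
    simpa using this
  have h2 : deriv (deriv φ) 0 = ∑ i, ∑ j, v i * v j * pd i (pd j m) x := by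
    rw [hd.deriv_eq, h1.deriv]
    simp only [mul_sum]
    rw [sum_comm]
    exact sum_congr rfl fun i _ => sum_congr rfl fun j _ => by ring
  have hφmax : IsLocalMax φ 0 := by
    have : ∀ᶠ y in 𝓝 x, m y ≤ m x := hmax
    refine (hline.eventually this).mono fun t ht => ?_
    simpa [φ] using ht
  have hφc : ContinuousAt φ 0 := by
    have : ContinuousAt m (x + (0 : ℝ) • v) := by simpa using hm.continuousAt
    exact ContinuousAt.comp this (by fun_prop)
  have hφmin : IsLocalMin φ 0 :=
    isLocalMin_of_deriv_deriv_pos (h2 ▸ hpos) hφmax.deriv_eq_zero hφc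
  have hconst : φ =ᶠ[𝓝 0] fun _ => φ 0 := by
    filter_upwards [hφmax, hφmin] with t h1 h2 using le_antisymm h1 h2
  have h3 : deriv (deriv φ) 0 = 0 := by
    rw [hconst.deriv.deriv_eq]; simp
  rw [h2] at h3
  linarith

lemma sum_mul_hessian_nonpos_of_isLocalMax {n : ℕ} {m : EuclideanSpace ℝ (Fin n) → ℝ}
    {x : EuclideanSpace ℝ (Fin n)} (hm : ContDiffAt ℝ 2 m x) (hmax : IsLocalMax m x)
    {G : Matrix (Fin n) (Fin n) ℝ} (hG : G.PosSemidef) :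
    ∑ i, ∑ j, G i j * pd i (pd j m) x ≤ 0 := by
  obtain ⟨k, w, rfl⟩ := Matrix.posSemidef_iff_eq_sum_vecMulVec.1 hG
  have : ∀ i j, (∑ l, Matrix.vecMulVec (w l) (star (w l))) i j = ∑ l, w l i * w l j := fun i j => by
    simp [Matrix.sum_apply, Matrix.vecMulVec_apply]
  simp only [this, sum_mul]
  rw [sum_congr rfl fun i _ => sum_comm, sum_comm]
  exact sum_nonpos fun l _ => sum_hessian_nonpos_of_isLocalMax hm hmax (WithLp.toLp 2 (w l))

lemma laplaceBeltrami_nonpos_of_isLocalMax {n : ℕ}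
    {g : EuclideanSpace ℝ (Fin n) → Matrix (Fin n) (Fin n) ℝ}
    {m : EuclideanSpace ℝ (Fin n) → ℝ}
    {x : EuclideanSpace ℝ (Fin n)} (hm : ContDiffAt ℝ 2 m x) (hmax : IsLocalMax m x)
    (hG : (g x).PosDef) : laplaceBeltrami g m x ≤ 0 := by
  have h0 : ∀ k, pd k m x = 0 := fun k => by rw [pd, hmax.fderiv_eq_zero]; simp
  simp only [laplaceBeltrami, h0, mul_zero, sum_const_zero, sub_zero]
  exact sum_mul_hessian_nonpos_of_isLocalMax hm hmax hG.inv.posSemidef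

lemma pd_pd_add_const_mul {n : ℕ} {u b : EuclideanSpace ℝ (Fin n) → ℝ}
    {x : EuclideanSpace ℝ (Fin n)} (hu : ContDiffAt ℝ 2 u x) (hb : ContDiffAt ℝ 2 b x) (e : ℝ)
    (i j : Fin n) :
    pd i (pd j fun x => u x + e * b x) x = pd i (pd j u) x + e * pd i (pd j b) x := by
  have hev : ∀ f : EuclideanSpace ℝ (Fin n) → ℝ, ContDiffAt ℝ 2 f x →
      ∀ᶠ y in 𝓝 x, DifferentiableAt ℝ f y := fun f hf =>
    (hf.eventually (by simp)).mono fun y hy => hy.differentiableAt (by norm_num)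
  have h : pd j (fun x => u x + e * b x) =ᶠ[𝓝 x] fun y => pd j u y + e * pd j b y := by
    filter_upwards [hev u hu, hev b hb] with y h1 h2
    rw [pd_add j h1 (h2.const_mul e), pd_const_mul j e h2]
  rw [pd_congr i h, pd_add i (differentiableAt_pd hu j) ((differentiableAt_pd hb j).const_mul e),
    pd_const_mul i e (differentiableAt_pd hb j)]

lemma laplaceBeltrami_add_const_mul {n : ℕ}
    (g : EuclideanSpace ℝ (Fin n) → Matrix (Fin n) (Fin n) ℝ)
    {u b : EuclideanSpace ℝ (Fin n) → ℝ} {x : EuclideanSpace ℝ (Fin n)}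
    (hu : ContDiffAt ℝ 2 u x) (hb : ContDiffAt ℝ 2 b x) (e : ℝ) :
    laplaceBeltrami g (fun x => u x + e * b x) x =
      laplaceBeltrami g u x + e * laplaceBeltrami g b x := by
  have hpd : ∀ k, pd k (fun x => u x + e * b x) x = pd k u x + e * pd k b x := fun k => by
    have h1 := hu.differentiableAt (by norm_num)
    have h2 := hb.differentiableAt (by norm_num)
    rw [pd_add k h1 (h2.const_mul e), pd_const_mul k e h2]
  simp only [laplaceBeltrami, pd_pd_add_const_mul hu hb, hpd]
  rw [mul_sum, ← sum_add_distrib]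
  refine sum_congr rfl fun i _ => ?_
  rw [mul_sum, ← sum_add_distrib]
  refine sum_congr rfl fun j _ => ?_
  simp only [mul_add, sum_add_distrib, mul_sub]
  have : ∑ k, christoffel g k i j x * (e * pd k b x) = e * ∑ k, christoffel g k i j x * pd k b x := by
    rw [mul_sum]; exact sum_congr rfl fun k _ => by ring
  rw [this]
  ring

/-- A subharmonic comparison function decaying like `‖x‖ ^ (-p)`. -/
def lowerBarrier {n : ℕ} (iN : Fin n) (p q : ℝ) (x : EuclideanSpace ℝ (Fin n)) : ℝ :=
  ‖x‖ ^ (-p) + 1 * (x iN * ‖x‖ ^ (-q))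

lemma contDiffAt_coord_mul_norm_rpow {n : ℕ} (iN : Fin n) (a : ℝ)
    {x : EuclideanSpace ℝ (Fin n)} (hx : x ≠ 0) {k : WithTop ℕ∞} :
    ContDiffAt ℝ k (fun x : EuclideanSpace ℝ (Fin n) => x iN * ‖x‖ ^ a) x :=
  (contDiffAt_coord iN).mul (contDiffAt_norm_rpow a hx)

lemma contDiffAt_lowerBarrier {n : ℕ} (iN : Fin n) (p q : ℝ)
    {x : EuclideanSpace ℝ (Fin n)} (hx : x ≠ 0) {k : WithTop ℕ∞} :
    ContDiffAt ℝ k (lowerBarrier iN p q) x :=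
  (contDiffAt_norm_rpow _ hx).add (contDiffAt_const.mul (contDiffAt_coord_mul_norm_rpow iN _ hx))

lemma pd_lowerBarrier {n : ℕ} (iN : Fin n) (p q : ℝ)
    {x : EuclideanSpace ℝ (Fin n)} (hx : x ≠ 0) (i : Fin n) :
    pd i (lowerBarrier iN p q) x = -p * (x i * ‖x‖ ^ (-p - 2)) +
      ((if i = iN then 1 else 0) * ‖x‖ ^ (-q) + -q * (x iN * x i * ‖x‖ ^ (-q - 2))) := by
  have hb := (contDiffAt_coord_mul_norm_rpow iN (-q) hx).differentiableAt one_ne_zero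
  have ha := (contDiffAt_norm_rpow (-p) hx).differentiableAt one_ne_zero
  have := pd_add i ha (hb.const_mul 1)
  rw [pd_const_mul i 1 hb, pd_norm_rpow _ hx, pd_coord_mul_norm_rpow _ hx, one_mul] at this
  exact this

lemma euclLap_lowerBarrier {n : ℕ} (iN : Fin n) (p q : ℝ)
    {x : EuclideanSpace ℝ (Fin n)} (hx : x ≠ 0) :
    euclLap (lowerBarrier iN p q) x = p * (p + 2 - n) * ‖x‖ ^ (-p - 2) +
      q * (q - n) * (x iN * ‖x‖ ^ (-q - 2)) := by
  have : euclLap (lowerBarrier iN p q) x =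
      euclLap (fun x : EuclideanSpace ℝ (Fin n) => ‖x‖ ^ (-p)) x +
      euclLap (fun x : EuclideanSpace ℝ (Fin n) => x iN * ‖x‖ ^ (-q)) x := by
    rw [euclLap, euclLap, euclLap, ← sum_add_distrib]
    refine sum_congr rfl fun i _ => ?_
    have := pd_pd_add_const_mul (contDiffAt_norm_rpow (-p) hx)
      (contDiffAt_coord_mul_norm_rpow iN (-q) hx) 1 i i
    rwa [one_mul] at this
  rw [this, euclLap_norm_rpow _ hx, euclLap_coord_mul_norm_rpow _ hx]
  ring

lemma exists_rpow_neg_lt {s : ℝ} (hs : 0 < s) (A : ℝ) {B : ℝ} (hB : 0 < B) :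
    ∃ R ≥ 1, ∀ r : ℝ, R ≤ r → A * r ^ (-s) < B := by
  have h : Tendsto (fun r : ℝ => A * r ^ (-s)) atTop (𝓝 (A * 0)) :=
    (tendsto_rpow_neg_atTop hs).const_mul A
  rw [mul_zero] at h
  obtain ⟨R, hR⟩ := eventually_atTop.1 (h.eventually (gt_mem_nhds hB))
  exact ⟨max R 1, le_max_right _ _, fun r hr => hR r ((le_max_left _ _).trans hr)⟩

lemma exists_laplaceBeltrami_lowerBarrier_pos {n : ℕ} (iN : Fin n) {τ : ℝ} (hτ : 0 < τ)
    {g : EuclideanSpace ℝ (Fin n) → Matrix (Fin n) (Fin n) ℝ}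
    (hg : IsCmMetric 2 iN g) (hgAF : IsAsymptoticallyFlat iN τ g)
    {p s : ℝ} (hp : 0 < p) (hpn : (n : ℝ) - 2 < p) (hs : 0 < s) (hsτ : s ≤ τ) :
    ∃ R ≥ 1, ∀ x ∈ halfSpace iN, R ≤ ‖x‖ →
      0 < laplaceBeltrami g (lowerBarrier iN p (p + 1 + s)) x := by
  obtain ⟨C, hC, R₁, hR₁, hcmp⟩ := exists_laplaceBeltrami_sub_le iN hτ hg hgAF
  set q := p + 1 + s with hq
  set c₁ := |-p| + (1 + |-q|) with hc₁
  set c₂ := |-p| * (1 + |-p - 2|) + |-q| * (3 + |-q - 2|) with hc₂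
  have hc₁0 : 0 ≤ c₁ := by positivity
  have hc₂0 : 0 ≤ c₂ := by positivity
  obtain ⟨R₂, hR₂, hlt⟩ := exists_rpow_neg_lt hs (|q * (q - n)| + C * (c₂ + c₁))
    (show 0 < p * (p + 2 - n) by have : 0 < p + 2 - n := by linarith
                                 positivity)
  refine ⟨max R₁ R₂, le_max_of_le_left hR₁, fun x hxH hx => ?_⟩
  have hx1 : R₁ ≤ ‖x‖ := (le_max_left _ _).trans hx
  have hr1 : 1 ≤ ‖x‖ := hR₁.trans hx1
  have hr0 : 0 < ‖x‖ := by linarith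
  have hx0 : x ≠ 0 := norm_pos_iff.1 hr0
  have hmono : ∀ {a b : ℝ}, a ≤ b → ‖x‖ ^ a ≤ ‖x‖ ^ b := fun h => rpow_le_rpow_of_exponent_le hr1 h
  have hb := (contDiffAt_coord_mul_norm_rpow iN (-q) hx0 (k := 2))
  have ha := (contDiffAt_norm_rpow (-p) hx0 (k := 2))
  have h1 : ∀ k, |pd k (lowerBarrier iN p q) x| ≤ c₁ * ‖x‖ ^ (-p - 1) := fun k => by
    have e := pd_add k (ha.differentiableAt two_ne_zero)
      ((hb.differentiableAt two_ne_zero).const_mul 1)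
    rw [pd_const_mul k 1 (hb.differentiableAt two_ne_zero), one_mul] at e
    rw [show pd k (lowerBarrier iN p q) x = _ from e]
    refine (abs_add_le _ _).trans ((add_le_add (abs_pd_norm_rpow_le (-p) hx0 k)
      (abs_pd_coord_mul_norm_rpow_le (-q) hx0 k iN)).trans ?_)
    rw [hc₁, add_mul |(-p)|]
    have hle : -q ≤ -p - 1 := by rw [hq]; linarith
    exact add_le_add le_rfl (mul_le_mul_of_nonneg_left (hmono hle) (by positivity))
  have h2 : ∀ i j, |pd i (pd j (lowerBarrier iN p q)) x| ≤ c₂ * ‖x‖ ^ (-p - 2) := fun i j => by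
    have e := pd_pd_add_const_mul ha hb 1 i j
    rw [one_mul] at e
    rw [show pd i (pd j (lowerBarrier iN p q)) x = _ from e]
    refine (abs_add_le _ _).trans ((add_le_add (abs_pd_pd_norm_rpow_le (-p) hx0 j i)
      (abs_pd_pd_coord_mul_norm_rpow_le (-q) hx0 j i iN)).trans ?_)
    rw [hc₂, add_mul]
    have hle : -q - 1 ≤ -p - 2 := by rw [hq]; linarith
    exact add_le_add le_rfl (mul_le_mul_of_nonneg_left (hmono hle) (by positivity))
  have h3 := (abs_le.1 ((hcmp x hxH hx1).2 _ _ _ h1 h2)).1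
  rw [euclLap_lowerBarrier iN p q hx0] at h3
  have h4 : |q * (q - n) * (x iN * ‖x‖ ^ (-q - 2))| ≤
      |q * (q - n)| * (‖x‖ ^ (-s) * ‖x‖ ^ (-p - 2)) := by
    rw [abs_mul]
    gcongr
    refine (abs_coord_mul_le hx0 iN (abs_norm_rpow_le x _)).trans (le_of_eq ?_)
    rw [← rpow_add hr0]
    congr 1
    rw [hq]; ring
  have h5 : ‖x‖ ^ (-τ) * (c₂ * ‖x‖ ^ (-p - 2)) ≤ c₂ * (‖x‖ ^ (-s) * ‖x‖ ^ (-p - 2)) := by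
    rw [mul_left_comm]
    gcongr
  have h6 : ‖x‖ ^ (-1 - τ) * (c₁ * ‖x‖ ^ (-p - 1)) ≤ c₁ * (‖x‖ ^ (-s) * ‖x‖ ^ (-p - 2)) := by
    rw [mul_left_comm, ← rpow_add hr0, ← rpow_add hr0]
    gcongr ?_ * ?_
    exact hmono (by linarith)
  have h7 := hlt ‖x‖ ((le_max_right _ _).trans hx)
  have h8 : 0 < ‖x‖ ^ (-p - 2) := by positivity
  have h9 := mul_lt_mul_of_pos_right h7 h8
  have h10 := mul_le_mul_of_nonneg_left (add_le_add h5 h6) hC.le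
  have h11 := (abs_le.1 h4).1
  nlinarith [h3, h9, h10, h11]

/-- A one-sided version of the first derivative test on the half-space. -/
lemma pdw_of_isLocalMaxOn {n : ℕ} {iN : Fin n} {u b : EuclideanSpace ℝ (Fin n) → ℝ}
    {y : EuclideanSpace ℝ (Fin n)} (hy : y ∈ halfSpace iN)
    (hu : DifferentiableWithinAt ℝ u (halfSpace iN) y) (hb : DifferentiableAt ℝ b y) {e : ℝ}
    (hmax : IsLocalMaxOn (fun x => u x + e * b x) (halfSpace iN) y) :
    pdw iN iN u y + e * pd iN b y ≤ 0 ∧ ∀ j ≠ iN, pdw iN j u y = -(e * pd j b y) := by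
  have hd : HasFDerivWithinAt (fun x => u x + e * b x)
      (fderivWithin ℝ u (halfSpace iN) y + e • fderiv ℝ b y) (halfSpace iN) y :=
    hu.hasFDerivWithinAt.add (hb.hasFDerivAt.hasFDerivWithinAt.const_mul e)
  have key : ∀ v : EuclideanSpace ℝ (Fin n), 0 ≤ v iN →
      fderivWithin ℝ u (halfSpace iN) y v + e * fderiv ℝ b y v ≤ 0 := fun v hv => by
    have := hmax.hasFDerivWithinAt_nonpos hd (y := v) (mem_posTangentConeAt_of_segment_subset ?_)
    · simpa using this
    · rintro _ ⟨a, c, ha, hc, hac, rfl⟩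
      have hy0 : 0 ≤ y iN := hy
      change 0 ≤ (a • y + c • (y + v)) iN
      simp only [PiLp.add_apply, PiLp.smul_apply, smul_eq_mul]
      positivity
  refine ⟨key _ (by simp), fun j hj => ?_⟩
  have h1 := key (EuclideanSpace.single j 1) (by simp [Ne.symm hj])
  have h2 := key (-EuclideanSpace.single j 1) (by simp [Ne.symm hj])
  rw [map_neg, map_neg] at h2
  rw [pdw, pd]
  linarith

theorem exists_le_neg_norm_rpow {n : ℕ} {iN : Fin n} {τ : ℝ} (hτ : 0 < τ)
    {g : EuclideanSpace ℝ (Fin n) → Matrix (Fin n) (Fin n) ℝ}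
    (hg : IsCmMetric 2 iN g) (hgAF : IsAsymptoticallyFlat iN τ g)
    {α : ℝ} (hα : 0 < α) {u : EuclideanSpace ℝ (Fin n) → ℝ} (hu : MemC2AlphaTau iN α τ u)
    (huneg : ∀ x ∈ halfSpace iN, u x < 0) {lam₀ : ℝ}
    (hsub : ∀ x ∈ halfSpace iN, lam₀ ≤ ‖x‖ → 0 ≤ laplaceBeltrami g u x)
    (hbd : ∀ y ∈ bdry iN, lam₀ ≤ ‖y‖ → nuDeriv iN g u y = 0)
    {p : ℝ} (hp : 0 < p) (hpn : (n : ℝ) - 2 < p) :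
    ∃ ε > 0, ∃ R ≥ 1, ∀ x ∈ halfSpace iN, R ≤ ‖x‖ → u x ≤ -ε * ‖x‖ ^ (-p) := by
  obtain ⟨R₁, hR₁, hpos⟩ := exists_laplaceBeltrami_lowerBarrier_pos iN hτ hg hgAF hp hpn
    (s := τ / 2) (by positivity) (by linarith)
  obtain ⟨C, hC, R₂, hR₂, hnorm⟩ := exists_abs_pdw_normal_le hτ hg hgAF hα hu hbd
  obtain ⟨R₃, hR₃, hsmall⟩ := exists_rpow_neg_lt (s := τ / 2) (by positivity) (C * (n * p))
    one_pos
  set q := p + 1 + τ / 2 with hq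
  obtain ⟨D, hD, hbound⟩ := exists_pdw_bounds hu
  set R := max (max R₁ R₂) (max R₃ lam₀) with hR
  have hRR₁ : R₁ ≤ R := (le_max_left _ _).trans (le_max_left _ _)
  have hRR₂ : R₂ ≤ R := (le_max_right _ _).trans (le_max_left _ _)
  have hRR₃ : R₃ ≤ R := (le_max_left _ _).trans (le_max_right _ _)
  have hRR₀ : lam₀ ≤ R := (le_max_right _ _).trans (le_max_right _ _)
  have hR1 : 1 ≤ R := hR₁.trans hRR₁
  set b := lowerBarrier iN p q with hb
  have hne : ∀ x : EuclideanSpace ℝ (Fin n), R ≤ ‖x‖ → x ≠ 0 := fun x hx =>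
    norm_pos_iff.1 (by linarith)
  set K : Set (EuclideanSpace ℝ (Fin n)) := {x | x ∈ halfSpace iN ∧ R ≤ ‖x‖} with hK
  have hKcl : IsClosed K := (isClosed_halfSpace iN).inter (isClosed_le continuous_const continuous_norm)
  have hucont : ContinuousOn u (halfSpace iN) := hu.1.continuousOn
  have hbcont : ContinuousOn b K := fun x hx =>
    (contDiffAt_lowerBarrier iN p q (hne x hx.2) (k := 0)).continuousAt.continuousWithinAt
  have hb_le : ∀ x ∈ K, b x ≤ 2 * ‖x‖ ^ (-p) := fun x hx => by
    have hr1 : 1 ≤ ‖x‖ := hR1.trans hx.2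
    have h1 : x iN * ‖x‖ ^ (-q) ≤ ‖x‖ ^ (-p) :=
      (le_abs_self _).trans ((abs_coord_mul_le (hne x hx.2) iN (abs_norm_rpow_le x _)).trans
        (rpow_le_rpow_of_exponent_le hr1 (by rw [hq]; linarith)))
    rw [hb, lowerBarrier]; linarith
  have hb_ge : ∀ x ∈ K, ‖x‖ ^ (-p) ≤ b x := fun x hx => by
    have : 0 ≤ x iN := hx.1
    rw [hb, lowerBarrier]
    have : 0 ≤ x iN * ‖x‖ ^ (-q) := by positivity
    linarith
  -- choose the coefficient so that the comparison holds on the inner sphere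
  obtain ⟨ε, hε, hinner⟩ : ∃ ε > 0, ∀ x ∈ K, ‖x‖ = R → u x + ε * b x < 0 := by
    set S := {x ∈ halfSpace iN | ‖x‖ = R} with hS
    have hScomp : IsCompact S := by
      refine (isCompact_sphere (0 : EuclideanSpace ℝ (Fin n)) R).of_isClosed_subset
        ((isClosed_halfSpace iN).inter (isClosed_eq continuous_norm continuous_const)) ?_
      rintro x ⟨-, hx⟩; simpa using hx
    rcases S.eq_empty_or_nonempty with h0 | hne'
    · refine ⟨1, one_pos, fun x hx hxR => ?_⟩
      have : x ∈ S := ⟨hx.1, hxR⟩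
      simp [h0] at this
    · obtain ⟨x₀, hx₀, hmax⟩ := hScomp.exists_isMaxOn hne' (hucont.mono fun x hx => hx.1)
      have hu0 := huneg x₀ hx₀.1
      refine ⟨-u x₀ / 4, by linarith, fun x hx hxR => ?_⟩
      have h1 : u x ≤ u x₀ := hmax ⟨hx.1, hxR⟩
      have h2 : b x ≤ 2 := (hb_le x hx).trans (by
        have := rpow_le_one_of_one_le_of_nonpos (hR1.trans hx.2) (show -p ≤ 0 by linarith)
        linarith)
      nlinarith
  refine ⟨ε, hε, R, hR1, fun x hxH hxR => ?_⟩
  suffices h : u x + ε * b x ≤ 0 by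
    have := hb_ge x ⟨hxH, hxR⟩
    nlinarith
  by_contra! hcon
  set m := fun x => u x + ε * b x with hm
  -- outside a large ball `m` is smaller than `m x`
  obtain ⟨ρ, hρ1, hρ⟩ := exists_rpow_neg_lt (s := min p τ) (lt_min hp hτ) (D + ε * 2) hcon
  have hfar : ∀ y ∈ K, ρ ≤ ‖y‖ → m y < m x := fun y hy hyρ => by
    have hr1 : 1 ≤ ‖y‖ := hR1.trans hy.2
    have hr0 : 0 < ‖y‖ := by linarith
    have h1 : u y ≤ D * ‖y‖ ^ (-min p τ) := by
      refine (le_abs_self _).trans ((hbound y hy.1).1.trans ?_)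
      gcongr
      calc (1 + ‖y‖) ^ (-τ) ≤ ‖y‖ ^ (-τ) := rpow_le_rpow_of_nonpos hr0 (by linarith) (by linarith)
        _ ≤ _ := rpow_le_rpow_of_exponent_le hr1 (by simp)
    have h2 : b y ≤ 2 * ‖y‖ ^ (-min p τ) := (hb_le y hy).trans (by
      gcongr
      exact min_le_left _ _)
    have h3 := hρ ‖y‖ hyρ
    have h4 := mul_le_mul_of_nonneg_left h2 hε.le
    calc m y = u y + ε * b y := rfl
      _ ≤ (D + ε * 2) * ‖y‖ ^ (-min p τ) := by linarith
      _ < m x := h3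
  set B := K ∩ Metric.closedBall 0 (max ρ ‖x‖) with hB
  have hBcomp : IsCompact B := (isCompact_closedBall _ _).inter_left hKcl
  have hxB : x ∈ B := ⟨⟨hxH, hxR⟩, by simp⟩
  obtain ⟨y, hyB, hymax⟩ := hBcomp.exists_isMaxOn ⟨x, hxB⟩
    (f := m) (((hucont.mono fun x hx => hx.1).add (hbcont.const_smul ε)).mono Set.inter_subset_left)
  have hxy : m x ≤ m y := hymax hxB
  have hyK : y ∈ K := hyB.1
  have hymaxK : ∀ z ∈ K, m z ≤ m y := fun z hz => by
    by_cases hzρ : ‖z‖ ≤ max ρ ‖x‖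
    · exact hymax ⟨hz, by simpa using hzρ⟩
    · exact (hfar z hz ((le_max_left _ _).trans (not_le.1 hzρ).le)).le.trans hxy
  have hyR : R < ‖y‖ := lt_of_le_of_ne hyK.2 fun h => by
    have := hinner y hyK h.symm
    have h2 : 0 < m y := lt_of_lt_of_le hcon hxy
    exact lt_irrefl _ (h2.trans this)
  have hy0 : y ≠ 0 := hne y hyK.2
  have hr0 : 0 < ‖y‖ := norm_pos_iff.2 hy0
  have hr1 : 1 ≤ ‖y‖ := hR1.trans hyK.2
  have hopen : ∀ᶠ z in 𝓝 y, R < ‖z‖ := continuous_norm.continuousAt.eventually (lt_mem_nhds hyR)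
  rcases (show 0 ≤ y iN from hyK.1).lt_or_eq with hpos' | hzero
  · have hlm : IsLocalMax m y := by
      filter_upwards [hopen, halfSpace_mem_nhds hpos'] with z hz1 hz2
      exact hymaxK z ⟨hz2, hz1.le⟩
    have hu2 : ContDiffAt ℝ 2 u y := hu.1.contDiffAt (halfSpace_mem_nhds hpos')
    have hb2 : ContDiffAt ℝ 2 b y := contDiffAt_lowerBarrier iN p q hy0
    have h1 := laplaceBeltrami_nonpos_of_isLocalMax (hu2.add (contDiffAt_const.mul hb2)) hlm
      (hg.2 y hyK.1).2
    rw [laplaceBeltrami_add_const_mul g hu2 hb2] at h1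
    have h2 := hsub y hyK.1 (hRR₀.trans hyK.2)
    have h3 := mul_pos hε (hpos y hyK.1 (hRR₁.trans hyK.2))
    linarith
  · have hlm : IsLocalMaxOn m (halfSpace iN) y := by
      filter_upwards [nhdsWithin_le_nhds hopen, self_mem_nhdsWithin] with z hz1 hz2
      exact hymaxK z ⟨hz2, hz1.le⟩
    obtain ⟨h1, h2⟩ := pdw_of_isLocalMaxOn hyK.1 (hu.1.differentiableOn (by norm_num) y hyK.1)
      ((contDiffAt_lowerBarrier iN p q hy0 (k := 1)).differentiableAt one_ne_zero) hlm
    have h3 := hnorm y hzero.symm (hRR₂.trans hyK.2)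
    rw [pd_lowerBarrier iN p q hy0, ← hzero] at h1
    simp only [zero_mul, mul_zero, if_true, one_mul, add_zero, zero_add] at h1
    have h4 : ∀ j ∈ univ.erase iN, |pdw iN j u y| ≤ ε * (p * ‖y‖ ^ (-p - 1)) := fun j hj => by
      have hj := (mem_erase.1 hj).1
      rw [h2 j hj, pd_lowerBarrier iN p q hy0, ← hzero, if_neg hj, abs_neg, abs_mul, abs_of_pos hε]
      gcongr
      simp only [zero_mul, mul_zero, add_zero, abs_mul, abs_neg, abs_of_pos hp]
      gcongr
      rw [← abs_mul, show -p - 1 = -p - 2 + 1 by ring]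
      exact abs_coord_mul_le hy0 j (abs_norm_rpow_le y _)
    have h5 : ∑ j ∈ univ.erase iN, |pdw iN j u y| ≤ n * (ε * (p * ‖y‖ ^ (-p - 1))) := by
      refine (sum_le_card_nsmul _ _ _ h4).trans ?_
      rw [nsmul_eq_mul]
      gcongr
      exact (card_erase_le).trans (by simp)
    have h6 : ε * ‖y‖ ^ (-q) ≤ C * ‖y‖ ^ (-τ) * (n * (ε * (p * ‖y‖ ^ (-p - 1)))) := by
      have h7 := (neg_abs_le (pdw iN iN u y))
      have h8 := h3.trans (mul_le_mul_of_nonneg_left h5 (by positivity))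
      linarith
    have h9 : C * ‖y‖ ^ (-τ) * (n * (ε * (p * ‖y‖ ^ (-p - 1)))) =
        (C * (n * p) * ‖y‖ ^ (-(τ / 2))) * (ε * ‖y‖ ^ (-q)) := by
      have : ‖y‖ ^ (-τ) * ‖y‖ ^ (-p - 1) = ‖y‖ ^ (-(τ / 2)) * ‖y‖ ^ (-q) := by
        rw [← rpow_add hr0, ← rpow_add hr0]; congr 1; rw [hq]; ring
      linear_combination (C * n * p * ε) * this
    have h10 := hsmall ‖y‖ (hRR₃.trans hyK.2)
    have h11 : 0 < ε * ‖y‖ ^ (-q) := by positivity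
    nlinarith

lemma integrable_pd_and_integral_eq_zero {n : ℕ} {F : EuclideanSpace ℝ (Fin n) → ℝ}
    (hF : ContDiff ℝ 1 F) (hc : HasCompactSupport F) (i : Fin n) :
    Integrable (pd i F) ∧ ∫ x, pd i F x = 0 := by
  have hi : Integrable (pd i F) :=
    ((hF.continuous_fderiv one_ne_zero).clm_apply continuous_const).integrable_of_hasCompactSupport
      (hc.fderiv_apply ℝ _)
  refine ⟨hi, ?_⟩
  have h := integral_mul_fderiv_eq_neg_fderiv_mul_of_integrable (μ := volume)
    (f := fun _ : EuclideanSpace ℝ (Fin n) => (1 : ℝ)) (g := F) (v := EuclideanSpace.single i 1)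
    (by simp) (by simpa using! hi)
    (by simpa using hF.continuous.integrable_of_hasCompactSupport hc)
    (fun x _ => differentiableAt_const _) (fun x _ => hF.differentiable one_ne_zero x)
  simpa using! h

lemma pd_comp_norm {n : ℕ} {ψ : ℝ → ℝ} (hψ : ContDiff ℝ 1 ψ) {x : EuclideanSpace ℝ (Fin n)}
    (hx : x ≠ 0) (i : Fin n) :
    pd i (fun x => ψ ‖x‖) x = deriv ψ ‖x‖ * (x i / ‖x‖) := by
  have h1 := hasFDerivAt_norm_rpow_of_ne_zero 1 hx
  simp only [rpow_one] at h1
  have h2 := ((hψ.differentiable one_ne_zero ‖x‖).hasDerivAt.comp_hasFDerivAt x h1).pd_eq i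
  rw [show (fun x => ψ ‖x‖) = ψ ∘ fun x : EuclideanSpace ℝ (Fin n) => ‖x‖ from rfl, h2]
  have : ‖x‖ ^ ((1 : ℝ) - 2) = ‖x‖⁻¹ := by rw [← rpow_neg_one]; norm_num
  simp [this, div_eq_mul_inv, mul_comm, EuclideanSpace.inner_single_right]

lemma pd_comp_coord {n : ℕ} {χ : ℝ → ℝ} (hχ : ContDiff ℝ 1 χ) (x : EuclideanSpace ℝ (Fin n))
    (i k : Fin n) :
    pd i (fun x => χ (x k)) x = if i = k then deriv χ (x k) else 0 := by
  have h1 : HasFDerivAt (fun x : EuclideanSpace ℝ (Fin n) => x k)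
      (EuclideanSpace.proj k : EuclideanSpace ℝ (Fin n) →L[ℝ] ℝ) x :=
    (EuclideanSpace.proj k : EuclideanSpace ℝ (Fin n) →L[ℝ] ℝ).hasFDerivAt
  have h2 := ((hχ.differentiable one_ne_zero (x k)).hasDerivAt.comp_hasFDerivAt x h1).pd_eq i
  rw [show (fun x : EuclideanSpace ℝ (Fin n) => χ (x k)) =
    χ ∘ fun x : EuclideanSpace ℝ (Fin n) => x k from rfl, h2]
  simp [eq_comm]

lemma deriv_eq_zero_of_notMem_Icc {ψ : ℝ → ℝ} {A B : ℝ} (hψ : ∀ r, r ∉ Set.Icc A B → ψ r = 0)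
    {r : ℝ} (hr : r ∉ Set.Icc A B) : deriv ψ r = 0 := by
  have : ψ =ᶠ[𝓝 r] fun _ => 0 := by
    filter_upwards [isClosed_Icc.isOpen_compl.mem_nhds hr] with s hs using hψ s hs
  rw [this.deriv_eq]; simp

/-- A cut-off function vanishing for `t ≤ 1 / k` and equal to one for `t ≥ 2 / k`. -/
def boundaryCutoff (k : ℕ) (t : ℝ) : ℝ := Real.smoothTransition (k * t - 1)

lemma contDiff_boundaryCutoff (k : ℕ) : ContDiff ℝ 1 (boundaryCutoff k) :=
  (Real.smoothTransition.contDiff (n := 1)).comp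
    ((contDiff_const.mul contDiff_id).sub contDiff_const)

lemma monotone_boundaryCutoff (k : ℕ) : Monotone (boundaryCutoff k) := fun s t h =>
  Real.smoothTransition.monotone (by gcongr)

lemma boundaryCutoff_eq_zero {k : ℕ} {t : ℝ} (h : k * t ≤ 1) : boundaryCutoff k t = 0 :=
  Real.smoothTransition.zero_of_nonpos (by linarith)

lemma boundaryCutoff_eq_one {k : ℕ} {t : ℝ} (h : 2 ≤ k * t) : boundaryCutoff k t = 1 :=
  Real.smoothTransition.one_of_one_le (by linarith)

lemma deriv_boundaryCutoff_eq_zero {k : ℕ} {t : ℝ} (h : 2 < k * t) :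
    deriv (boundaryCutoff k) t = 0 := by
  have : boundaryCutoff k =ᶠ[𝓝 t] fun _ => 1 := by
    have hc : Continuous fun s : ℝ => (k : ℝ) * s := by fun_prop
    filter_upwards [hc.continuousAt.eventually (lt_mem_nhds h)] with s hs
      using boundaryCutoff_eq_one (le_of_lt hs)
  rw [this.deriv_eq]; simp

section Divergence

variable {n : ℕ} {iN : Fin n} {Y : Fin n → EuclideanSpace ℝ (Fin n) → ℝ} {A B R : ℝ} {ψ : ℝ → ℝ}

/-- The integrand in the divergence theorem for the radial cut-off `ψ` of the field `Y`. -/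
def cutoffDivergence (Y : Fin n → EuclideanSpace ℝ (Fin n) → ℝ) (ψ : ℝ → ℝ)
    (x : EuclideanSpace ℝ (Fin n)) : ℝ :=
  deriv ψ ‖x‖ * (∑ i, x i / ‖x‖ * Y i x) + ψ ‖x‖ * ∑ i, pd i (Y i) x

lemma contDiff_cutoff_mul (hR : 0 < R) (hRA : R < A)
    (hY : ∀ i, ContDiffOn ℝ 1 (Y i) {x | 0 < x iN ∧ R < ‖x‖})
    (hψ : ContDiff ℝ 1 ψ) (hsupp : ∀ r, r ∉ Set.Icc A B → ψ r = 0) {k : ℕ} (hk : 0 < k)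
    (i : Fin n) :
    ContDiff ℝ 1 (fun x => boundaryCutoff k (x iN) * ψ ‖x‖ * Y i x) ∧
      HasCompactSupport (fun x => boundaryCutoff k (x iN) * ψ ‖x‖ * Y i x) ∧
      ∀ x : EuclideanSpace ℝ (Fin n),
        x ∉ {x : EuclideanSpace ℝ (Fin n) | 1 ≤ k * x iN ∧ ‖x‖ ∈ Set.Icc A B} →
        pd i (fun x => boundaryCutoff k (x iN) * ψ ‖x‖ * Y i x) x = 0 := by
  have hk' : (0 : ℝ) < k := by exact_mod_cast hk
  set Z : Set (EuclideanSpace ℝ (Fin n)) := {x | 1 ≤ k * x iN ∧ ‖x‖ ∈ Set.Icc A B} with hZ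
  have hZc : IsClosed Z := by
    have hc : Continuous fun x : EuclideanSpace ℝ (Fin n) => (k : ℝ) * x iN := by fun_prop
    exact (isClosed_le continuous_const hc).inter (isClosed_Icc.preimage continuous_norm)
  have hU : IsOpen {x : EuclideanSpace ℝ (Fin n) | 0 < x iN ∧ R < ‖x‖} :=
    (isOpen_openHalfSpace iN).inter (isOpen_lt continuous_const continuous_norm)
  have hzero : ∀ x, x ∉ Z → boundaryCutoff k (x iN) * ψ ‖x‖ * Y i x = 0 := fun x hx => by
    by_cases h1 : 1 ≤ k * x iN
    · rw [hsupp ‖x‖ fun h => hx ⟨h1, h⟩]; simp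
    · rw [boundaryCutoff_eq_zero (not_le.1 h1).le]; simp
  have hev : ∀ x, x ∉ Z → (fun x => boundaryCutoff k (x iN) * ψ ‖x‖ * Y i x) =ᶠ[𝓝 x]
      fun _ => 0 := fun x hx => by
    filter_upwards [hZc.isOpen_compl.mem_nhds hx] with y hy using hzero y hy
  refine ⟨contDiff_iff_contDiffAt.2 fun x => ?_, ?_, fun x hx => ?_⟩
  · by_cases hx : x ∈ Z
    · have hxR : R < ‖x‖ := hRA.trans_le hx.2.1
      have hx0 : x ≠ 0 := norm_pos_iff.1 (hR.trans hxR)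
      have hxN : 0 < x iN := by
        have := hx.1
        by_contra! h
        nlinarith
      have h1 : ContDiffAt ℝ 1 (fun x : EuclideanSpace ℝ (Fin n) => boundaryCutoff k (x iN)) x :=
        (contDiff_boundaryCutoff k).contDiffAt.comp x (contDiffAt_coord iN)
      have h2 : ContDiffAt ℝ 1 (fun x : EuclideanSpace ℝ (Fin n) => ψ ‖x‖) x :=
        hψ.contDiffAt.comp x (contDiffAt_norm ℝ hx0)
      exact (h1.mul h2).mul ((hY i).contDiffAt (hU.mem_nhds ⟨hxN, hxR⟩))
    · exact contDiffAt_const.congr_of_eventuallyEq (hev x hx)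
  · refine HasCompactSupport.intro ((isCompact_closedBall (0 : EuclideanSpace ℝ (Fin n)) B))
      fun x hx => hzero x fun h => hx ?_
    simpa using h.2.2
  · rw [pd_congr i (hev x hx), pd]; simp

lemma integrableOn_cutoffDivergence (hR : 0 < R) (hRA : R < A)
    (hY : ∀ i, ContDiffOn ℝ 1 (Y i) {x | 0 < x iN ∧ R < ‖x‖}) {M : ℝ}
    (hM : ∀ i x, 0 < x iN → R < ‖x‖ → |Y i x| ≤ M ∧ |pd i (Y i) x| ≤ M)
    (hψ : ContDiff ℝ 1 ψ) (hsupp : ∀ r, r ∉ Set.Icc A B → ψ r = 0) :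
    IntegrableOn (fun x => deriv ψ ‖x‖ * (∑ i, x i / ‖x‖ * Y i x)) {x | 0 < x iN} ∧
      IntegrableOn (fun x => ψ ‖x‖ * ∑ i, pd i (Y i) x) {x | 0 < x iN} := by
  set U : Set (EuclideanSpace ℝ (Fin n)) := {x | 0 < x iN ∧ R < ‖x‖} with hUdef
  have hU : IsOpen U := (isOpen_openHalfSpace iN).inter (isOpen_lt continuous_const continuous_norm)
  set T : Set (EuclideanSpace ℝ (Fin n)) := {x | 0 < x iN} ∩ {x | ‖x‖ ∈ Set.Icc A B} with hT
  have hTm : MeasurableSet T := (isOpen_openHalfSpace iN).measurableSet.inter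
    (isClosed_Icc.preimage continuous_norm).measurableSet
  have hTU : T ⊆ U := fun x hx => ⟨hx.1, hRA.trans_le hx.2.1⟩
  have hTfin : volume T < ⊤ := (measure_mono (show T ⊆ Metric.closedBall 0 B from fun x hx => by
    simpa using hx.2.2)).trans_lt measure_closedBall_lt_top
  have hn0 : ∀ x ∈ U, ‖x‖ ≠ 0 := fun x hx => (hR.trans hx.2).ne'
  have hψ' := hψ.continuous_deriv le_rfl
  have key : ∀ φ w : EuclideanSpace ℝ (Fin n) → ℝ, ContinuousOn w U → Continuous φ →
      (∃ W, ∀ x ∈ U, |w x| ≤ W) → (∀ x, ‖x‖ ∉ Set.Icc A B → φ x = 0) →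
      IntegrableOn (fun x => φ x * w x) {x | 0 < x iN} := by
    rintro φ w hw hφ ⟨W, hW⟩ hφ0
    obtain ⟨P, hP⟩ := (isCompact_closedBall (0 : EuclideanSpace ℝ (Fin n)) B).exists_bound_of_continuousOn
      hφ.continuousOn
    refine IntegrableOn.of_forall_sdiff_eq_zero (s := T) ?_ (isOpen_openHalfSpace iN).measurableSet ?_
    · refine ⟨((hφ.continuousOn.mul hw).mono hTU).aestronglyMeasurable hTm,
        .restrict_of_bounded (P * W) hTfin ?_⟩
      refine (ae_restrict_iff' hTm).2 (Eventually.of_forall fun x hx => ?_)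
      have h1 := hP x (by simpa using hx.2.2)
      rw [norm_mul]
      exact mul_le_mul h1 (hW x (hTU hx)) (norm_nonneg _) ((norm_nonneg _).trans h1)
    · rintro x ⟨hx, hx'⟩
      rw [hφ0 x fun h => hx' ⟨hx, h⟩, zero_mul]
  refine ⟨key _ _ ?_ (hψ'.comp continuous_norm) ⟨∑ _i : Fin n, M, fun x hx => ?_⟩
      fun x hx => deriv_eq_zero_of_notMem_Icc hsupp hx,
    key _ _ ?_ (hψ.continuous.comp continuous_norm) ⟨∑ _i : Fin n, M, fun x hx => ?_⟩
      fun x hx => hsupp _ hx⟩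
  · refine continuousOn_finsetSum _ fun i _ => ContinuousOn.mul ?_ (hY i).continuousOn
    exact (Continuous.continuousOn (by fun_prop)).div continuous_norm.continuousOn hn0
  · refine (abs_sum_le_sum_abs _ _).trans (sum_le_sum fun i _ => ?_)
    rw [abs_mul, abs_div, abs_norm]
    have h1 : |x i| / ‖x‖ ≤ 1 := div_le_one_of_le₀ (abs_coord_le x i) (norm_nonneg _)
    have h2 := (hM i x hx.1 hx.2).1
    have h3 : 0 ≤ |x i| / ‖x‖ := by positivity
    nlinarith [abs_nonneg (Y i x)]
  · exact continuousOn_finsetSum _ fun i _ =>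
      ((hY i).continuousOn_fderiv_of_isOpen hU le_rfl).clm_apply continuousOn_const
  · exact (abs_sum_le_sum_abs _ _).trans (sum_le_sum fun i _ => (hM i x hx.1 hx.2).2)

theorem setIntegral_cutoffDivergence_nonpos (hR : 0 < R) (hRA : R < A)
    (hY : ∀ i, ContDiffOn ℝ 1 (Y i) {x | 0 < x iN ∧ R < ‖x‖}) {M : ℝ}
    (hM : ∀ i x, 0 < x iN → R < ‖x‖ → |Y i x| ≤ M ∧ |pd i (Y i) x| ≤ M)
    (hpos : ∃ ε > 0, ∀ x : EuclideanSpace ℝ (Fin n), 0 < x iN → x iN < ε →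
      ‖x‖ ∈ Set.Icc A B → 0 ≤ Y iN x)
    (hψ : ContDiff ℝ 1 ψ) (hψ0 : ∀ r, 0 ≤ ψ r) (hsupp : ∀ r, r ∉ Set.Icc A B → ψ r = 0) :
    ∫ x in {x | 0 < x iN}, cutoffDivergence Y ψ x ≤ 0 := by
  obtain ⟨ε, hε, hYpos⟩ := hpos
  have hH := (isOpen_openHalfSpace iN).measurableSet
  obtain ⟨hi1, hi2⟩ := integrableOn_cutoffDivergence hR hRA hY hM hψ hsupp
  have hint : IntegrableOn (cutoffDivergence Y ψ) {x | 0 < x iN} := hi1.add hi2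
  have hU : IsOpen {x : EuclideanSpace ℝ (Fin n) | 0 < x iN ∧ R < ‖x‖} :=
    (isOpen_openHalfSpace iN).inter (isOpen_lt continuous_const continuous_norm)
  have hcut : ∀ k : ℕ, Continuous fun x : EuclideanSpace ℝ (Fin n) => boundaryCutoff k (x iN) :=
    fun k => (contDiff_boundaryCutoff k).continuous.comp (by fun_prop)
  have hle1 : ∀ (k : ℕ) (t : ℝ), ‖boundaryCutoff k t‖ ≤ 1 := fun k t => by
    rw [Real.norm_eq_abs, boundaryCutoff, abs_of_nonneg (Real.smoothTransition.nonneg _)]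
    exact Real.smoothTransition.le_one _
  have hlim : Tendsto (fun k : ℕ => ∫ x in {x | 0 < x iN},
      boundaryCutoff k (x iN) * cutoffDivergence Y ψ x) atTop
      (𝓝 (∫ x in {x | 0 < x iN}, cutoffDivergence Y ψ x)) := by
    refine tendsto_integral_of_dominated_convergence (fun x => ‖cutoffDivergence Y ψ x‖)
      (fun k => (hcut k).aestronglyMeasurable.mul hint.aestronglyMeasurable) hint.norm
      (fun k => Eventually.of_forall fun x => ?_)
      ((ae_restrict_iff' hH).2 (Eventually.of_forall fun x hx => ?_))
    · rw [norm_mul]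
      exact mul_le_of_le_one_left (norm_nonneg _) (hle1 k _)
    · refine tendsto_const_nhds.congr' ?_
      have hx : 0 < x iN := hx
      have : Tendsto (fun k : ℕ => (k : ℝ) * x iN) atTop atTop :=
        tendsto_natCast_atTop_atTop.atTop_mul_const hx
      filter_upwards [this.eventually_ge_atTop 2] with k hk
      rw [boundaryCutoff_eq_one hk, one_mul]
  refine le_of_tendsto hlim ?_
  have hlarge : ∀ᶠ k : ℕ in atTop, 2 < (k : ℝ) * ε :=
    (tendsto_natCast_atTop_atTop.atTop_mul_const hε).eventually_gt_atTop 2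
  filter_upwards [hlarge, eventually_gt_atTop 0] with k hkε hk
  have hk' : (0 : ℝ) < k := by exact_mod_cast hk
  have hF := fun i => contDiff_cutoff_mul (i := i) hR hRA hY hψ hsupp hk
  set F : Fin n → EuclideanSpace ℝ (Fin n) → ℝ :=
    fun i x => boundaryCutoff k (x iN) * ψ ‖x‖ * Y i x with hFdef
  have hFi := fun i => integrable_pd_and_integral_eq_zero (hF i).1 (hF i).2.1 i
  have hsum : ∫ x in {x | 0 < x iN}, ∑ i, pd i (F i) x = 0 := by
    rw [setIntegral_eq_integral_of_forall_compl_eq_zero, integral_finsetSum _ fun i _ => (hFi i).1]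
    · exact sum_eq_zero fun i _ => (hFi i).2
    · intro x hx
      refine sum_eq_zero fun i _ => (hF i).2.2 x fun h => hx ?_
      have h1 := h.1
      change 0 < x iN
      by_contra! h2
      nlinarith
  refine le_of_le_of_eq ?_ hsum
  refine setIntegral_mono_on (Integrable.bdd_mul (c := 1) hint (hcut k).aestronglyMeasurable
    (Eventually.of_forall fun x => hle1 k _))
    (integrable_finsetSum _ fun i _ => (hFi i).1).integrableOn hH fun x hx => ?_
  have hx : 0 < x iN := hx
  by_cases hxAB : ‖x‖ ∈ Set.Icc A B
  · have hxR : R < ‖x‖ := hRA.trans_le hxAB.1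
    have hx0 : x ≠ 0 := norm_pos_iff.1 (hR.trans hxR)
    have h1 : DifferentiableAt ℝ (fun x : EuclideanSpace ℝ (Fin n) => boundaryCutoff k (x iN)) x :=
      ((contDiff_boundaryCutoff k).contDiffAt.comp x (contDiffAt_coord iN)).differentiableAt one_ne_zero
    have h2 : DifferentiableAt ℝ (fun x : EuclideanSpace ℝ (Fin n) => ψ ‖x‖) x :=
      (hψ.contDiffAt.comp x (contDiffAt_norm ℝ hx0)).differentiableAt one_ne_zero
    have h3 : ∀ i, DifferentiableAt ℝ (Y i) x := fun i =>
      ((hY i).contDiffAt (hU.mem_nhds ⟨hx, hxR⟩)).differentiableAt one_ne_zero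
    have h4 : ∀ i, pd i (F i) x = boundaryCutoff k (x iN) *
        (deriv ψ ‖x‖ * (x i / ‖x‖ * Y i x) + ψ ‖x‖ * pd i (Y i) x) +
        (if i = iN then deriv (boundaryCutoff k) (x iN) * ψ ‖x‖ * Y iN x else 0) := fun i => by
      have e1 : pd i (fun x : EuclideanSpace ℝ (Fin n) => boundaryCutoff k (x iN) * ψ ‖x‖) x = _ :=
        pd_mul i h1 h2
      have e2 : pd i (F i) x = _ := pd_mul i (h1.fun_mul h2) (h3 i)
      rw [e2, e1, pd_comp_norm hψ hx0, pd_comp_coord (contDiff_boundaryCutoff k)]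
      split_ifs with h
      · subst h; ring
      · ring
    have h5 : 0 ≤ deriv (boundaryCutoff k) (x iN) * ψ ‖x‖ * Y iN x := by
      by_cases hxε : x iN < ε
      · exact mul_nonneg (mul_nonneg (monotone_boundaryCutoff k).deriv_nonneg (hψ0 _))
          (hYpos x hx hxε hxAB)
      · rw [deriv_boundaryCutoff_eq_zero (hkε.trans_le (by gcongr; exact not_lt.1 hxε))]
        simp
    rw [sum_congr rfl fun i _ => h4 i, sum_add_distrib, sum_ite_eq' univ iN, ← mul_sum,
      sum_add_distrib, ← mul_sum, ← mul_sum, if_pos (mem_univ _)]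
    exact le_add_of_nonneg_right h5
  · rw [sum_eq_zero fun i _ => (hF i).2.2 x fun h => hxAB h.2, cutoffDivergence, hsupp _ hxAB,
      deriv_eq_zero_of_notMem_Icc hsupp hxAB]
    simp

end Divergence

/-- A smooth transition from `0` at `c` to `1` at `c + h`. -/
def smoothStep (c h r : ℝ) : ℝ := Real.smoothTransition ((r - c) / h)

lemma contDiff_smoothStep (c h : ℝ) : ContDiff ℝ 1 (smoothStep c h) :=
  (Real.smoothTransition.contDiff (n := 1)).comp ((contDiff_id.sub contDiff_const).div_const _)

lemma smoothStep_eq_zero {c h r : ℝ} (hh : 0 < h) (hr : r ≤ c) : smoothStep c h r = 0 :=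
  Real.smoothTransition.zero_of_nonpos (div_nonpos_of_nonpos_of_nonneg (by linarith) hh.le)

lemma smoothStep_eq_one {c h r : ℝ} (hh : 0 < h) (hr : c + h ≤ r) : smoothStep c h r = 1 :=
  Real.smoothTransition.one_of_one_le ((one_le_div hh).2 (by linarith))

lemma monotone_smoothStep {c h : ℝ} (hh : 0 < h) : Monotone (smoothStep c h) := fun s t hst =>
  Real.smoothTransition.monotone (by gcongr)

lemma deriv_smoothStep_eq_zero {c h r : ℝ} (hh : 0 < h) (hr : r ∉ Set.Icc c (c + h)) :
    deriv (smoothStep c h) r = 0 := by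
  rw [Set.mem_Icc, not_and_or, not_le, not_le] at hr
  rcases hr with hr | hr
  · have : smoothStep c h =ᶠ[𝓝 r] fun _ => 0 := by
      filter_upwards [gt_mem_nhds hr] with s hs using smoothStep_eq_zero hh (le_of_lt hs)
    rw [this.deriv_eq]; simp
  · have : smoothStep c h =ᶠ[𝓝 r] fun _ => 1 := by
      filter_upwards [lt_mem_nhds hr] with s hs using smoothStep_eq_one hh (le_of_lt hs)
    rw [this.deriv_eq]; simp

lemma integrableOn_deriv_smoothStep_mul {c h : ℝ} (hc : 0 < c) (hh : 0 < h) {M : ℝ → ℝ}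
    (hM : ContinuousOn M (Set.Icc c (c + h))) :
    IntegrableOn (fun r => deriv (smoothStep c h) r * M r) (Set.Ioi 0) ∧
      ∫ r in Set.Ioi 0, deriv (smoothStep c h) r * M r =
        ∫ r in Set.Icc c (c + h), deriv (smoothStep c h) r * M r := by
  have h1 : IntegrableOn (fun r => deriv (smoothStep c h) r * M r) (Set.Icc c (c + h)) :=
    ((((contDiff_smoothStep c h).continuous_deriv le_rfl).continuousOn).mul hM).integrableOn_compact
      isCompact_Icc
  have h0 : ∀ r ∈ Set.Ioi 0 \ Set.Icc c (c + h), deriv (smoothStep c h) r * M r = 0 := fun r hr => by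
    rw [deriv_smoothStep_eq_zero hh hr.2, zero_mul]
  refine ⟨h1.of_forall_sdiff_eq_zero measurableSet_Ioi h0, ?_⟩
  exact setIntegral_eq_of_subset_of_forall_sdiff_eq_zero measurableSet_Ioi
    (fun r hr => hc.trans_le hr.1) h0

lemma le_setIntegral_deriv_smoothStep_mul {c h m : ℝ} (hc : 0 < c) (hh : 0 < h) {M : ℝ → ℝ}
    (hM : ContinuousOn M (Set.Icc c (c + h))) (hm : ∀ r ∈ Set.Icc c (c + h), m ≤ M r) :
    m ≤ ∫ r in Set.Ioi 0, deriv (smoothStep c h) r * M r := by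
  have hcont := (contDiff_smoothStep c h).continuous_deriv le_rfl
  have h1 : ∫ r in Set.Icc c (c + h), deriv (smoothStep c h) r * m = m := by
    rw [integral_mul_const, integral_Icc_eq_integral_Ioc,
      ← intervalIntegral.integral_of_le (by linarith),
      intervalIntegral.integral_deriv_eq_sub
        (fun x _ => (contDiff_smoothStep c h).differentiable one_ne_zero x)
        (hcont.intervalIntegrable _ _),
      smoothStep_eq_one hh le_rfl, smoothStep_eq_zero hh le_rfl]
    ring
  rw [(integrableOn_deriv_smoothStep_mul hc hh hM).2]
  refine h1.symm.le.trans (setIntegral_mono_on ?_ ?_ measurableSet_Icc fun r hr => ?_)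
  · exact (hcont.mul continuous_const).continuousOn.integrableOn_compact isCompact_Icc
  · exact (hcont.continuousOn.mul hM).integrableOn_compact isCompact_Icc
  · exact mul_le_mul_of_nonneg_left (hm r hr) (monotone_smoothStep hh).deriv_nonneg

/-- A continuous function whose distributional derivative is bounded below in the
mean satisfies the corresponding pointwise inequality. -/
theorem le_add_of_forall_setIntegral_deriv_mul_le {M : ℝ → ℝ} {R I : ℝ} (hR : 0 < R)
    (hM : ContinuousOn M (Set.Ioi R))
    (H : ∀ ψ : ℝ → ℝ, ∀ A B : ℝ, R < A → ContDiff ℝ 1 ψ → (∀ r, 0 ≤ ψ r) → (∀ r, ψ r ≤ 1) →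
      (∀ r, r ∉ Set.Icc A B → ψ r = 0) → ∫ r in Set.Ioi 0, deriv ψ r * M r ≤ I)
    {a b : ℝ} (ha : R < a) (hab : a < b) : M a ≤ M b + I := by
  by_contra! hcon
  obtain ⟨d, hd, hd3⟩ : ∃ d > 0, M a = M b + I + 3 * d :=
    ⟨(M a - M b - I) / 3, by linarith, by ring⟩
  have hnear : ∀ c, R < c → ∃ δ > 0, ∀ r ∈ Set.Icc c (c + δ), |M r - M c| ≤ d := fun c hc => by
    obtain ⟨δ, hδ, h⟩ := Metric.continuousAt_iff.1 ((hM c hc).continuousAt (Ioi_mem_nhds hc)) d hd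
    refine ⟨δ / 2, by positivity, fun r hr => ?_⟩
    have := h (x := r) (by rw [Real.dist_eq, abs_lt]; constructor <;> linarith [hr.1, hr.2])
    rw [Real.dist_eq] at this
    exact this.le
  obtain ⟨δ₁, hδ₁, h₁⟩ := hnear a ha
  obtain ⟨δ₂, hδ₂, h₂⟩ := hnear b (ha.trans hab)
  set h := min δ₁ δ₂ with hh
  have hh0 : 0 < h := lt_min hδ₁ hδ₂
  have ha0 : 0 < a := hR.trans ha
  have hb0 : 0 < b := ha0.trans hab
  have hMa : ContinuousOn M (Set.Icc a (a + h)) := hM.mono fun r hr => ha.trans_le hr.1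
  have hMb : ContinuousOn M (Set.Icc b (b + h)) := hM.mono fun r hr => (ha.trans hab).trans_le hr.1
  have la := le_setIntegral_deriv_smoothStep_mul (m := M a - d) ha0 hh0 hMa fun r hr => by
    have := (abs_le.1 (h₁ r ⟨hr.1, hr.2.trans (by gcongr; exact min_le_left _ _)⟩)).1
    linarith
  have lb := le_setIntegral_deriv_smoothStep_mul (m := -(M b + d)) hb0 hh0 hMb.neg fun r hr => by
    have := (abs_le.1 (h₂ r ⟨hr.1, hr.2.trans (by gcongr; exact min_le_right _ _)⟩)).2
    simp only [Pi.neg_apply]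
    linarith
  simp only [Pi.neg_apply, mul_neg, integral_neg] at lb
  have hle : ∀ r, smoothStep b h r ≤ smoothStep a h r := fun r =>
    Real.smoothTransition.monotone (by gcongr)
  have key := H (fun r => smoothStep a h r - smoothStep b h r) a (b + h) ha
    ((contDiff_smoothStep a h).sub (contDiff_smoothStep b h)) (fun r => sub_nonneg.2 (hle r))
    (fun r => by
      have h1 : smoothStep a h r ≤ 1 := Real.smoothTransition.le_one _
      have h2 : 0 ≤ smoothStep b h r := Real.smoothTransition.nonneg _
      linarith)
    (fun r hr => by
      rw [Set.mem_Icc, not_and_or, not_le, not_le] at hr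
      rcases hr with hr | hr
      · rw [smoothStep_eq_zero hh0 hr.le, smoothStep_eq_zero hh0 (hr.le.trans hab.le), sub_zero]
      · rw [smoothStep_eq_one hh0 hr.le, smoothStep_eq_one hh0 (by linarith), sub_self])
  have hderiv : ∀ r, deriv (fun r => smoothStep a h r - smoothStep b h r) r * M r =
      deriv (smoothStep a h) r * M r - deriv (smoothStep b h) r * M r := fun r => by
    rw [deriv_fun_sub ((contDiff_smoothStep a h).differentiable one_ne_zero r)
      ((contDiff_smoothStep b h).differentiable one_ne_zero r), sub_mul]
  simp only [hderiv] at key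
  rw [integral_sub (integrableOn_deriv_smoothStep_mul ha0 hh0 hMa).1
    (integrableOn_deriv_smoothStep_mul hb0 hh0 hMb).1] at key
  linarith

section RadialFlux

variable {n : ℕ} {iN : Fin n} {Y : Fin n → EuclideanSpace ℝ (Fin n) → ℝ} {R M : ℝ}

/-- The flux of the vector field `Y` through the open upper half-sphere of radius `r`. -/
def radialFlux (iN : Fin n) (Y : Fin n → EuclideanSpace ℝ (Fin n) → ℝ) (r : ℝ) : ℝ :=
  r ^ (n - 1) * ∫ ω in upperSphere iN,
    ∑ i, (ω : EuclideanSpace ℝ (Fin n)) i * Y i (r • (ω : EuclideanSpace ℝ (Fin n)))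
    ∂(volume : Measure (EuclideanSpace ℝ (Fin n))).toSphere

lemma norm_smul_sphere {r : ℝ} (hr : 0 < r) (ω : Metric.sphere (0 : EuclideanSpace ℝ (Fin n)) 1) :
    ‖r • (ω : EuclideanSpace ℝ (Fin n))‖ = r := by
  rw [norm_smul, norm_eq_of_mem_sphere ω, mul_one, Real.norm_of_nonneg hr.le]

lemma smul_upperSphere_pos {r : ℝ} (hr : 0 < r)
    {ω : Metric.sphere (0 : EuclideanSpace ℝ (Fin n)) 1} (hω : ω ∈ upperSphere iN) :
    0 < (r • (ω : EuclideanSpace ℝ (Fin n))) iN := by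
  have : 0 < (ω : EuclideanSpace ℝ (Fin n)) iN := hω
  rw [PiLp.smul_apply, smul_eq_mul]
  positivity

lemma continuousOn_setIntegral_sphere (hR : 0 < R) {w : EuclideanSpace ℝ (Fin n) → ℝ}
    (hw : ContinuousOn w {x | 0 < x iN ∧ R < ‖x‖}) (hM : ∀ x, 0 < x iN → R < ‖x‖ → |w x| ≤ M) :
    ContinuousOn (fun r : ℝ => ∫ ω in upperSphere iN, w (r • (ω : EuclideanSpace ℝ (Fin n)))
      ∂(volume : Measure (EuclideanSpace ℝ (Fin n))).toSphere) (Set.Ioi R) := by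
  have hmem : ∀ r ∈ Set.Ioi R, ∀ ω ∈ upperSphere iN,
      r • (ω : EuclideanSpace ℝ (Fin n)) ∈ {x : EuclideanSpace ℝ (Fin n) | 0 < x iN ∧ R < ‖x‖} :=
    fun r hr ω hω => ⟨smul_upperSphere_pos (hR.trans hr) hω, by
      rw [norm_smul_sphere (hR.trans hr)]; exact hr⟩
  have hms := (isOpen_upperSphere iN).measurableSet
  refine continuousOn_of_dominated (bound := fun _ => M) (fun r hr => ?_) (fun r hr => ?_)
    (integrable_const _) ?_
  · refine ContinuousOn.aestronglyMeasurable (hw.comp (Continuous.continuousOn (by fun_prop)) ?_) hms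
    exact fun ω hω => hmem r hr ω hω
  · exact (ae_restrict_iff' hms).2 (Eventually.of_forall fun ω hω =>
      hM _ (hmem r hr ω hω).1 (hmem r hr ω hω).2)
  · exact (ae_restrict_iff' hms).2 (Eventually.of_forall fun ω hω =>
      hw.comp (Continuous.continuousOn (by fun_prop)) fun r hr => hmem r hr ω hω)

lemma sum_smul_sphere_div {r : ℝ} (hr : 0 < r)
    (ω : Metric.sphere (0 : EuclideanSpace ℝ (Fin n)) 1) (Z : Fin n → ℝ) :
    ∑ i, (r • (ω : EuclideanSpace ℝ (Fin n))) i / ‖r • (ω : EuclideanSpace ℝ (Fin n))‖ * Z i =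
      ∑ i, (ω : EuclideanSpace ℝ (Fin n)) i * Z i := by
  rw [norm_smul_sphere hr]
  refine sum_congr rfl fun i _ => ?_
  rw [PiLp.smul_apply, smul_eq_mul, mul_div_cancel_left₀ _ hr.ne']

lemma abs_sum_div_norm_mul_le (x : EuclideanSpace ℝ (Fin n)) {Z : Fin n → ℝ}
    (hZ : ∀ i, |Z i| ≤ M) : |∑ i, x i / ‖x‖ * Z i| ≤ n * M := by
  refine (abs_sum_le_sum_abs _ _).trans ((sum_le_sum (g := fun _ => M) fun i _ => ?_).trans_eq
    (by simp))
  rw [abs_mul, abs_div, abs_norm]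
  have h1 : |x i| / ‖x‖ ≤ 1 := div_le_one_of_le₀ (abs_coord_le x i) (norm_nonneg _)
  have h3 : 0 ≤ |x i| / ‖x‖ := by positivity
  nlinarith [abs_nonneg (Z i), hZ i]

lemma continuousOn_radialFlux (hR : 0 < R)
    (hY : ∀ i, ContinuousOn (Y i) {x | 0 < x iN ∧ R < ‖x‖})
    (hM : ∀ i x, 0 < x iN → R < ‖x‖ → |Y i x| ≤ M) :
    ContinuousOn (radialFlux iN Y) (Set.Ioi R) := by
  have h : ContinuousOn (fun x : EuclideanSpace ℝ (Fin n) => ∑ i, x i / ‖x‖ * Y i x)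
      {x | 0 < x iN ∧ R < ‖x‖} := by
    refine continuousOn_finsetSum _ fun i _ => ContinuousOn.mul ?_ (hY i)
    exact (Continuous.continuousOn (by fun_prop)).div continuous_norm.continuousOn
      fun x hx => (hR.trans hx.2).ne'
  have h2 := continuousOn_setIntegral_sphere hR h
    fun x h1 h2 => abs_sum_div_norm_mul_le x fun i => hM i x h1 h2
  refine ((continuous_id.pow (n - 1)).continuousOn.mul h2).congr fun r hr => ?_
  simp only [radialFlux, sum_smul_sphere_div (hR.trans hr), id, Pi.mul_apply, Pi.pow_apply]

lemma setIntegral_radial_eq (hn : 1 ≤ n) {φ : ℝ → ℝ}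
    (h : IntegrableOn (fun x => φ ‖x‖ * (∑ i, x i / ‖x‖ * Y i x)) {x | 0 < x iN}) :
    ∫ x in {x | 0 < x iN}, φ ‖x‖ * (∑ i, x i / ‖x‖ * Y i x) =
      ∫ r in Set.Ioi 0, φ r * radialFlux iN Y r := by
  rw [setIntegral_halfSpace_eq_polar hn iN h]
  refine setIntegral_congr_fun measurableSet_Ioi fun r hr => ?_
  simp only [sum_smul_sphere_div hr]
  simp only [norm_smul_sphere hr, integral_const_mul, radialFlux]
  ring

/-- Monotonicity of the flux of a field with almost nonnegative divergence which points
into the half-space near the boundary hyperplane. -/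
theorem radialFlux_le_add (hn : 1 ≤ n) (hR : 0 < R)
    (hY : ∀ i, ContDiffOn ℝ 1 (Y i) {x | 0 < x iN ∧ R < ‖x‖})
    (hM : ∀ i x, 0 < x iN → R < ‖x‖ → |Y i x| ≤ M ∧ |pd i (Y i) x| ≤ M)
    (hpos : ∀ A B, R < A → ∃ ε > 0, ∀ x : EuclideanSpace ℝ (Fin n), 0 < x iN → x iN < ε →
      ‖x‖ ∈ Set.Icc A B → 0 ≤ Y iN x)
    {f : EuclideanSpace ℝ (Fin n) → ℝ} (hf : IntegrableOn f {x | 0 < x iN ∧ R < ‖x‖})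
    (hf0 : ∀ x, 0 < x iN → R < ‖x‖ → 0 ≤ f x)
    (hdiv : ∀ x, 0 < x iN → R < ‖x‖ → -f x ≤ ∑ i, pd i (Y i) x)
    {a b : ℝ} (ha : R < a) (hab : a < b) :
    radialFlux iN Y a ≤ radialFlux iN Y b + ∫ x in {x | 0 < x iN ∧ R < ‖x‖}, f x := by
  refine le_add_of_forall_setIntegral_deriv_mul_le hR (continuousOn_radialFlux hR
    (fun i => (hY i).continuousOn) fun i x h1 h2 => (hM i x h1 h2).1) ?_ ha hab
  intro ψ A B hRA hψ hψ0 hψ1 hsupp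
  obtain ⟨hi1, hi2⟩ := integrableOn_cutoffDivergence hR hRA hY hM hψ hsupp
  have h := setIntegral_cutoffDivergence_nonpos hR hRA hY hM (hpos A B hRA) hψ hψ0 hsupp
  simp only [cutoffDivergence] at h
  rw [integral_add hi1 hi2, setIntegral_radial_eq hn hi1] at h
  set U : Set (EuclideanSpace ℝ (Fin n)) := {x | 0 < x iN ∧ R < ‖x‖} with hUdef
  have hU : IsOpen U := (isOpen_openHalfSpace iN).inter (isOpen_lt continuous_const continuous_norm)
  have h2 : ∫ x in {x | 0 < x iN}, ψ ‖x‖ * ∑ i, pd i (Y i) x = ∫ x in U, ψ ‖x‖ * ∑ i, pd i (Y i) x := by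
    refine setIntegral_eq_of_subset_of_forall_sdiff_eq_zero (isOpen_openHalfSpace iN).measurableSet
      (fun x hx => hx.1) fun x hx => ?_
    rw [hsupp ‖x‖ fun h => hx.2 ⟨hx.1, hRA.trans_le h.1⟩, zero_mul]
  have h3 : ∫ x in U, -f x ≤ ∫ x in U, ψ ‖x‖ * ∑ i, pd i (Y i) x := by
    refine setIntegral_mono_on hf.neg (hi2.mono_set fun x hx => hx.1) hU.measurableSet fun x hx => ?_
    have e1 := hdiv x hx.1 hx.2
    have e2 := hf0 x hx.1 hx.2
    nlinarith [hψ0 ‖x‖, hψ1 ‖x‖]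
  rw [integral_neg] at h3
  linarith

end RadialFlux

theorem exists_abs_laplaceBeltrami_sub_euclLap_le {n : ℕ} {iN : Fin n} {τ : ℝ} (hτ : 0 < τ)
    {g : EuclideanSpace ℝ (Fin n) → Matrix (Fin n) (Fin n) ℝ}
    (hg : IsCmMetric 2 iN g) (hgAF : IsAsymptoticallyFlat iN τ g)
    {α : ℝ} {u : EuclideanSpace ℝ (Fin n) → ℝ} (hu : MemC2AlphaTau iN α τ u) :
    ∃ C > 0, ∃ R ≥ 1, ∀ x ∈ halfSpace iN, R ≤ ‖x‖ →
      |laplaceBeltrami g u x - euclLap u x| ≤ C * ‖x‖ ^ (-2 * τ - 2) := by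
  obtain ⟨C, hC, R, hR, h⟩ := exists_laplaceBeltrami_sub_le iN hτ hg hgAF
  obtain ⟨-, D, hD, hb, -⟩ := hu
  refine ⟨2 * C * D, by positivity, R, hR, fun x hx hxR => ?_⟩
  have hx0 : 0 < ‖x‖ := by linarith
  have hle : ∀ s : ℝ, s ≤ 0 → D * (1 + ‖x‖) ^ s ≤ D * ‖x‖ ^ s := fun s hs =>
    mul_le_mul_of_nonneg_left (rpow_le_rpow_of_nonpos hx0 (by linarith) hs) hD.le
  refine ((h x hx hxR).2 u (D * ‖x‖ ^ (-1 - τ)) (D * ‖x‖ ^ (-2 - τ))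
    (fun k => ((hb x hx).2.1 k).trans (hle _ (by linarith)))
    (fun i j => ((hb x hx).2.2 i j).trans (hle _ (by linarith)))).trans_eq ?_
  have e1 : ‖x‖ ^ (-τ) * ‖x‖ ^ (-2 - τ) = ‖x‖ ^ (-2 * τ - 2) := by
    rw [← rpow_add hx0]; ring_nf
  have e2 : ‖x‖ ^ (-1 - τ) * ‖x‖ ^ (-1 - τ) = ‖x‖ ^ (-2 * τ - 2) := by
    rw [← rpow_add hx0]; ring_nf
  linear_combination C * D * e1 + C * D * e2

theorem exists_abs_pdw_normal_le_rpow {n : ℕ} {iN : Fin n} {τ : ℝ} (hτ : 0 < τ)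
    {g : EuclideanSpace ℝ (Fin n) → Matrix (Fin n) (Fin n) ℝ}
    (hg : IsCmMetric 2 iN g) (hgAF : IsAsymptoticallyFlat iN τ g)
    {α : ℝ} (hα : 0 < α) {u : EuclideanSpace ℝ (Fin n) → ℝ} (hu : MemC2AlphaTau iN α τ u)
    {lam₀ : ℝ} (hbd : ∀ y ∈ bdry iN, lam₀ ≤ ‖y‖ → nuDeriv iN g u y = 0) :
    ∃ C > 0, ∃ R ≥ 1, ∀ y ∈ bdry iN, R ≤ ‖y‖ →
      |pdw iN iN u y| ≤ C * ‖y‖ ^ (-2 * τ - 1) := by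
  obtain ⟨C, hC, R, hR, h⟩ := exists_abs_pdw_normal_le hτ hg hgAF hα hu hbd
  obtain ⟨D, hD, hb⟩ := exists_pdw_bounds hu
  have hn : 0 < n := iN.pos
  refine ⟨C * (n * D), by positivity, R, hR, fun y hy hyR => ?_⟩
  have hy0 : 0 < ‖y‖ := by linarith
  have hyH : y ∈ halfSpace iN := (show y iN = 0 from hy).ge
  have h1 : ∑ j ∈ univ.erase iN, |pdw iN j u y| ≤ n * (D * ‖y‖ ^ (-1 - τ)) := by
    refine (sum_le_sum_of_subset_of_nonneg (erase_subset _ _) fun _ _ _ => abs_nonneg _).trans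
      ((sum_le_sum (g := fun _ => D * ‖y‖ ^ (-1 - τ)) fun j _ =>
        ((hb y hyH).2.1 j).trans ?_).trans_eq (by simp))
    exact mul_le_mul_of_nonneg_left (rpow_le_rpow_of_nonpos hy0 (by linarith) (by linarith)) hD.le
  refine (h y hy hyR).trans ((mul_le_mul_of_nonneg_left h1 (by positivity)).trans_eq ?_)
  have e1 : ‖y‖ ^ (-τ) * ‖y‖ ^ (-1 - τ) = ‖y‖ ^ (-2 * τ - 1) := by
    rw [← rpow_add hy0]; ring_nf
  linear_combination C * n * D * e1

section PerturbedGradient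

variable {n : ℕ} {iN : Fin n} {u : EuclideanSpace ℝ (Fin n) → ℝ} {s a K₁ K₂ : ℝ}

/-- The field `s ∇u` corrected by a field of size `‖x‖ ^ (a - 1)`. -/
def perturbedGradient (iN : Fin n) (u : EuclideanSpace ℝ (Fin n) → ℝ) (s a K₁ K₂ : ℝ) (i : Fin n)
    (x : EuclideanSpace ℝ (Fin n)) : ℝ :=
  s * pd i u x + (K₁ * ((if i = iN then 1 else 0) * ‖x‖ ^ (a - 1)) +
    -K₂ * (x i * ‖x‖ ^ (a - 2)))

lemma pd_perturbedGradient (i : Fin n) {x : EuclideanSpace ℝ (Fin n)} (hu : ContDiffAt ℝ 2 u x)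
    (hx : x ≠ 0) :
    pd i (perturbedGradient iN u s a K₁ K₂ i) x = s * pd i (pd i u) x +
      (K₁ * ((if i = iN then 1 else 0) * pd i (fun x => ‖x‖ ^ (a - 1)) x) +
        -K₂ * pd i (fun x => x i * ‖x‖ ^ (a - 2)) x) := by
  have d1 : DifferentiableAt ℝ (fun x : EuclideanSpace ℝ (Fin n) => ‖x‖ ^ (a - 1)) x :=
    (contDiffAt_norm_rpow _ hx).differentiableAt one_ne_zero
  have d2 : DifferentiableAt ℝ (fun x : EuclideanSpace ℝ (Fin n) => x i * ‖x‖ ^ (a - 2)) x :=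
    (contDiffAt_coord_mul_norm_rpow i _ hx).differentiableAt one_ne_zero
  have d3 := differentiableAt_pd hu i
  unfold perturbedGradient
  rw [pd_add i (d3.const_mul s) (((d1.const_mul _).const_mul _).fun_add (d2.const_mul _)),
    pd_add i ((d1.const_mul _).const_mul _) (d2.const_mul _), pd_const_mul i s d3,
    pd_const_mul i _ (d1.const_mul _), pd_const_mul i _ d1, pd_const_mul i _ d2]

lemma sum_pd_perturbedGradient {x : EuclideanSpace ℝ (Fin n)} (hu : ContDiffAt ℝ 2 u x)
    (hx : x ≠ 0) :
    ∑ i, pd i (perturbedGradient iN u s a K₁ K₂ i) x = s * euclLap u x +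
      (K₁ * ((a - 1) * (x iN * ‖x‖ ^ (a - 3))) - K₂ * ((n + a - 2) * ‖x‖ ^ (a - 2))) := by
  have h1 : ∑ i, (if i = iN then (1 : ℝ) else 0) * pd i (fun x => ‖x‖ ^ (a - 1)) x =
      (a - 1) * (x iN * ‖x‖ ^ (a - 3)) := by
    simp only [ite_mul, one_mul, zero_mul, sum_ite_eq', mem_univ, if_true]
    rw [pd_norm_rpow _ hx, show a - 1 - 2 = a - 3 by ring]
  have h2 : ∑ i, pd i (fun x => x i * ‖x‖ ^ (a - 2)) x = (n + a - 2) * ‖x‖ ^ (a - 2) := by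
    have : ∀ i, pd i (fun x => x i * ‖x‖ ^ (a - 2)) x =
        ‖x‖ ^ (a - 2) + (x i * x i) * ((a - 2) * ‖x‖ ^ (a - 4)) := fun i => by
      rw [pd_coord_mul_norm_rpow _ hx, if_pos rfl, show a - 2 - 2 = a - 4 by ring]
      ring
    rw [sum_congr rfl fun i _ => this i, sum_add_distrib, ← sum_mul, sum_coord_sq,
      sum_const, card_univ, Fintype.card_fin, nsmul_eq_mul]
    linear_combination (a - 2) * norm_sq_mul_rpow hx a
  rw [sum_congr rfl fun i _ => pd_perturbedGradient i hu hx, sum_add_distrib, sum_add_distrib,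
    ← mul_sum, ← mul_sum, ← mul_sum, h1, h2, euclLap]
  ring

lemma le_sum_pd_perturbedGradient {x : EuclideanSpace ℝ (Fin n)} (hu : ContDiffAt ℝ 2 u x)
    (hx : 0 < x iN) (ha : a ≤ 1) (hK₁ : 0 ≤ K₁) (hs : |s| = 1) {C L : ℝ}
    (hC : |L - euclLap u x| ≤ C * ‖x‖ ^ (a - 2)) (hK : C + K₁ * (1 - a) ≤ K₂ * (2 - n - a)) :
    s * L ≤ ∑ i, pd i (perturbedGradient iN u s a K₁ K₂ i) x := by
  have hx0 : x ≠ 0 := by rintro rfl; simp at hx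
  have hx1 : 0 < ‖x‖ := norm_pos_iff.2 hx0
  rw [sum_pd_perturbedGradient hu hx0]
  have h1 : x iN * ‖x‖ ^ (a - 3) ≤ ‖x‖ ^ (a - 2) := by
    have := (le_abs_self _).trans (abs_coord_mul_le hx0 iN (abs_norm_rpow_le x (a - 3)))
    rwa [show a - 3 + 1 = a - 2 by ring] at this
  have h2 : s * (L - euclLap u x) ≤ C * ‖x‖ ^ (a - 2) :=
    (le_abs_self _).trans (by rwa [abs_mul, hs, one_mul])
  have h3 := mul_le_mul_of_nonneg_left h1 (mul_nonneg hK₁ (sub_nonneg.2 ha))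
  have h4 := mul_le_mul_of_nonneg_right hK (show 0 ≤ ‖x‖ ^ (a - 2) by positivity)
  linarith

lemma abs_perturbedGradient_le {D : ℝ} {x : EuclideanSpace ℝ (Fin n)} (hu : ContDiffAt ℝ 2 u x)
    (hx : 1 ≤ ‖x‖) (ha : a ≤ 1) (hs : |s| = 1) (i : Fin n) (h1 : |pd i u x| ≤ D)
    (h2 : |pd i (pd i u) x| ≤ D) :
    |perturbedGradient iN u s a K₁ K₂ i x| ≤ D + |K₁| * (1 + |a|) + |K₂| * (3 + |a|) ∧
      |pd i (perturbedGradient iN u s a K₁ K₂ i) x| ≤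
        D + |K₁| * (1 + |a|) + |K₂| * (3 + |a|) := by
  have hx0 : x ≠ 0 := norm_pos_iff.1 (by linarith)
  have hle : ∀ c : ℝ, c ≤ 0 → ‖x‖ ^ c ≤ 1 := fun c hc => rpow_le_one_of_one_le_of_nonpos hx hc
  have ha0 := abs_nonneg a
  have hb1 : |a - 1| ≤ 1 + |a| := (abs_sub _ _).trans (by simp [add_comm])
  have hb2 : 1 + |a - 2| ≤ 3 + |a| := by
    have := abs_sub a 2
    rw [abs_two] at this
    linarith
  have htri : ∀ p q r : ℝ, |s * p + (K₁ * q + -K₂ * r)| ≤ |p| + |K₁| * |q| + |K₂| * |r| := by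
    intro p q r
    rw [← add_assoc]
    refine (abs_add_three _ _ _).trans_eq ?_
    rw [abs_mul, abs_mul, abs_mul, hs, abs_neg, one_mul]
  constructor
  · refine (htri _ _ _).trans (add_le_add (add_le_add h1 (mul_le_mul_of_nonneg_left ?_
      (abs_nonneg _))) (mul_le_mul_of_nonneg_left ?_ (abs_nonneg _)))
    · refine (abs_ite_mul_le (abs_norm_rpow_le x _)).trans ((hle _ (by linarith)).trans ?_)
      linarith
    · refine (abs_coord_mul_le hx0 i (abs_norm_rpow_le x _)).trans ((hle _ (by linarith)).trans ?_)
      linarith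
  · rw [pd_perturbedGradient i hu hx0]
    refine (htri _ _ _).trans (add_le_add (add_le_add h2 (mul_le_mul_of_nonneg_left ?_
      (abs_nonneg _))) (mul_le_mul_of_nonneg_left ?_ (abs_nonneg _)))
    · refine (abs_ite_mul_le (abs_pd_norm_rpow_le _ hx0 i)).trans ?_
      nlinarith [hle (a - 1 - 1) (by linarith), abs_nonneg (a - 1)]
    · refine (abs_pd_coord_mul_norm_rpow_le _ hx0 _ _).trans ?_
      nlinarith [hle (a - 2) (by linarith), abs_nonneg (a - 2)]

lemma contDiffAt_of_pos {k : ℕ} (hu : ContDiffOn ℝ k u (halfSpace iN))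
    {x : EuclideanSpace ℝ (Fin n)} (hx : 0 < x iN) : ContDiffAt ℝ k u x :=
  hu.contDiffAt (halfSpace_mem_nhds hx)

lemma contDiffOn_perturbedGradient (hu : ContDiffOn ℝ 2 u (halfSpace iN)) (i : Fin n) (R : ℝ) :
    ContDiffOn ℝ 1 (perturbedGradient iN u s a K₁ K₂ i) {x | 0 < x iN ∧ R < ‖x‖} := by
  intro x hx
  have hx0 : x ≠ 0 := by rintro rfl; simpa using hx.1
  have hu2 : ContDiffAt ℝ 2 u x := contDiffAt_of_pos hu hx.1
  have h : ContDiffAt ℝ 1 (pd i u) x :=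
    (hu2.fderiv_right (m := 1) (by norm_num)).clm_apply contDiffAt_const
  exact ((contDiffAt_const.mul h).add ((contDiffAt_const.mul (contDiffAt_const.mul
    (contDiffAt_norm_rpow _ hx0))).add (contDiffAt_const.mul
      (contDiffAt_coord_mul_norm_rpow i _ hx0)))).contDiffWithinAt

lemma exists_perturbedGradient_nonneg (hu : ContDiffOn ℝ 2 u (halfSpace iN)) {C A B : ℝ}
    (hA : 0 < A) (hs : |s| = 1) (hCK : C < K₁)
    (hC : ∀ y ∈ bdry iN, A ≤ ‖y‖ → |pdw iN iN u y| ≤ C * ‖y‖ ^ (a - 1)) :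
    ∃ ε > 0, ∀ x : EuclideanSpace ℝ (Fin n), 0 < x iN → x iN < ε → ‖x‖ ∈ Set.Icc A B →
      0 ≤ perturbedGradient iN u s a K₁ K₂ iN x := by
  set Z : EuclideanSpace ℝ (Fin n) → ℝ := fun x => s * pdw iN iN u x +
    (K₁ * ‖x‖ ^ (a - 1) + -K₂ * (x iN * ‖x‖ ^ (a - 2))) with hZ
  set S : Set (EuclideanSpace ℝ (Fin n)) := {x | 0 ≤ x iN ∧ ‖x‖ ∈ Set.Icc A B} with hS
  have hSc : IsCompact S := by
    refine (isCompact_closedBall (0 : EuclideanSpace ℝ (Fin n)) B).of_isClosed_subset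
      ((isClosed_halfSpace iN).inter (isClosed_Icc.preimage continuous_norm)) fun x hx => ?_
    simpa using hx.2.2
  have hZc : ContinuousOn Z S := by
    intro x hx
    have hx0 : x ≠ 0 := norm_pos_iff.1 (hA.trans_le hx.2.1)
    have h1 : ContinuousWithinAt (pdw iN iN u) S x :=
      ((contDiffOn_pdw (l := 1) iN le_rfl hu).continuousOn x hx.1).mono fun x hx => hx.1
    exact (h1.const_mul s).add ((((contDiffAt_norm_rpow (k := 1) _ hx0).continuousAt.const_mul
      K₁).add ((contDiffAt_coord_mul_norm_rpow (k := 1) iN _ hx0).continuousAt.const_mul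
        (-K₂))).continuousWithinAt)
  have hTc : IsCompact {x ∈ S | Z x ≤ 0} := by
    refine hSc.of_isClosed_subset ?_ fun x hx => hx.1
    exact hZc.preimage_isClosed_of_isClosed hSc.isClosed isClosed_Iic
  have hTpos : ∀ x ∈ {x ∈ S | Z x ≤ 0}, 0 < x iN := by
    rintro x ⟨hxS, hxZ⟩
    refine lt_of_le_of_ne hxS.1 fun h => ?_
    have hxn : 0 < ‖x‖ := hA.trans_le hxS.2.1
    have h1 : |s * pdw iN iN u x| ≤ C * ‖x‖ ^ (a - 1) := by
      rw [abs_mul, hs, one_mul]; exact hC x h.symm hxS.2.1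
    have h2 := mul_pos (sub_pos.2 hCK) (rpow_pos_of_pos hxn (a - 1))
    simp only [hZ, ← h] at hxZ
    linarith [(abs_le.1 h1).1]
  have hmain : ∃ ε > 0, ∀ x ∈ {x ∈ S | Z x ≤ 0}, ε ≤ x iN := by
    rcases Set.eq_empty_or_nonempty {x ∈ S | Z x ≤ 0} with h | h
    · exact ⟨1, one_pos, by simp [h]⟩
    · obtain ⟨x₀, hx₀, hmin⟩ := hTc.exists_isMinOn h
        (f := fun x : EuclideanSpace ℝ (Fin n) => x iN) (Continuous.continuousOn (by fun_prop))
      exact ⟨x₀ iN, hTpos x₀ hx₀, fun x hx => hmin hx⟩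
  obtain ⟨ε, hε, hmain⟩ := hmain
  refine ⟨ε, hε, fun x hx hxε hxn => ?_⟩
  have h : 0 < Z x := by
    by_contra! h
    exact absurd (hmain x ⟨⟨hx.le, hxn⟩, h⟩) (not_le.2 hxε)
  simpa [perturbedGradient, hZ, pdw_eq_pd iN u hx] using h.le

lemma integrableOn_sum_coord_mul_pd {D R r : ℝ} (hR : 0 < R) (hr : R < r)
    (hu : ContDiffOn ℝ 2 u (halfSpace iN))
    (hD : ∀ i x, 0 < x iN → R < ‖x‖ → |pd i u x| ≤ D) :
    IntegrableOn (fun ω : Metric.sphere (0 : EuclideanSpace ℝ (Fin n)) 1 =>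
      ∑ i, (ω : EuclideanSpace ℝ (Fin n)) i * pd i u (r • (ω : EuclideanSpace ℝ (Fin n))))
      (upperSphere iN) (volume : Measure (EuclideanSpace ℝ (Fin n))).toSphere := by
  have hr0 := hR.trans hr
  have hms := (isOpen_upperSphere iN).measurableSet
  refine integrable_finsetSum _ fun i _ => ?_
  refine Integrable.of_bound (C := 1 * D) ?_ ?_
  · refine ContinuousOn.aestronglyMeasurable (ContinuousOn.mul
      (Continuous.continuousOn (by fun_prop)) ?_) hms
    have hc : ContinuousOn (pd i u) {x | 0 < x iN} := fun x hx =>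
      (differentiableAt_pd (contDiffAt_of_pos hu hx) i).continuousAt.continuousWithinAt
    exact hc.comp (Continuous.continuousOn (by fun_prop)) fun ω hω => smul_upperSphere_pos hr0 hω
  · refine (ae_restrict_iff' hms).2 (Eventually.of_forall fun ω hω => ?_)
    rw [norm_mul]
    refine mul_le_mul ?_ (hD i _ (smul_upperSphere_pos hr0 hω) (by
      rwa [norm_smul_sphere hr0])) (norm_nonneg _) zero_le_one
    exact (abs_coord_le _ i).trans_eq (norm_eq_of_mem_sphere ω)

lemma radialFlux_perturbedGradient (hn : 1 ≤ n) {D R r : ℝ} (hR : 0 < R) (hr : R < r)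
    (hu : ContDiffOn ℝ 2 u (halfSpace iN))
    (hD : ∀ i x, 0 < x iN → R < ‖x‖ → |pd i u x| ≤ D) :
    radialFlux iN (perturbedGradient iN u s a K₁ K₂) r =
      s * radialFlux iN (fun i => pd i u) r +
        (K₁ * ∫ ω in upperSphere iN, (ω : EuclideanSpace ℝ (Fin n)) iN
            ∂(volume : Measure (EuclideanSpace ℝ (Fin n))).toSphere
          - K₂ * (volume : Measure (EuclideanSpace ℝ (Fin n))).toSphere.real (upperSphere iN)) *
          r ^ (n + a - 2) := by
  have hr0 := hR.trans hr
  have hi1 := integrableOn_sum_coord_mul_pd hR hr hu hD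
  have hi2 : IntegrableOn (fun ω : Metric.sphere (0 : EuclideanSpace ℝ (Fin n)) 1 =>
      (ω : EuclideanSpace ℝ (Fin n)) iN)
      (upperSphere iN) (volume : Measure (EuclideanSpace ℝ (Fin n))).toSphere := by
    refine Integrable.of_bound (C := 1) (Continuous.aestronglyMeasurable (by fun_prop))
      (Eventually.of_forall fun ω => ?_)
    exact (abs_coord_le _ iN).trans_eq (norm_eq_of_mem_sphere ω)
  have hpt : ∀ ω : Metric.sphere (0 : EuclideanSpace ℝ (Fin n)) 1,
      ∑ i, (ω : EuclideanSpace ℝ (Fin n)) i *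
        perturbedGradient iN u s a K₁ K₂ i (r • (ω : EuclideanSpace ℝ (Fin n))) =
      s * (∑ i, (ω : EuclideanSpace ℝ (Fin n)) i * pd i u (r • (ω : EuclideanSpace ℝ (Fin n)))) +
        (K₁ * r ^ (a - 1) * (ω : EuclideanSpace ℝ (Fin n)) iN + -K₂ * r ^ (a - 1)) := by
    intro ω
    have h1 : ∑ i, (ω : EuclideanSpace ℝ (Fin n)) i * (ω : EuclideanSpace ℝ (Fin n)) i = 1 := by
      rw [sum_coord_sq, norm_eq_of_mem_sphere ω, one_pow]
    have h2 : ∑ i, (ω : EuclideanSpace ℝ (Fin n)) i * (if i = iN then 1 else 0) =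
        (ω : EuclideanSpace ℝ (Fin n)) iN := by simp
    have h3 : r * r ^ (a - 2) = r ^ (a - 1) := by
      rw [mul_comm, ← rpow_add_one hr0.ne']; ring_nf
    calc _ = ∑ i, (s * ((ω : EuclideanSpace ℝ (Fin n)) i *
            pd i u (r • (ω : EuclideanSpace ℝ (Fin n)))) +
          (K₁ * r ^ (a - 1) * ((ω : EuclideanSpace ℝ (Fin n)) i * (if i = iN then 1 else 0)) +
            -K₂ * r ^ (a - 1) *
              ((ω : EuclideanSpace ℝ (Fin n)) i * (ω : EuclideanSpace ℝ (Fin n)) i))) := by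
          refine sum_congr rfl fun i _ => ?_
          rw [perturbedGradient, norm_smul_sphere hr0, PiLp.smul_apply, smul_eq_mul]
          linear_combination -K₂ * (ω : EuclideanSpace ℝ (Fin n)) i *
            (ω : EuclideanSpace ℝ (Fin n)) i * h3
      _ = _ := by
          rw [sum_add_distrib, sum_add_distrib, ← mul_sum, ← mul_sum, ← mul_sum, h1, h2, mul_one]
  have hpow : r ^ (n - 1) * r ^ (a - 1) = r ^ (n + a - 2) := by
    rw [← rpow_natCast, ← rpow_add hr0, Nat.cast_sub hn]
    congr 1
    push_cast
    ring
  simp only [radialFlux, hpt]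
  have hi3 : IntegrableOn (fun ω : Metric.sphere (0 : EuclideanSpace ℝ (Fin n)) 1 =>
      K₁ * r ^ (a - 1) * (ω : EuclideanSpace ℝ (Fin n)) iN + -K₂ * r ^ (a - 1))
      (upperSphere iN) (volume : Measure (EuclideanSpace ℝ (Fin n))).toSphere :=
    (hi2.const_mul _).add (integrable_const _)
  rw [integral_add (hi1.const_mul s) hi3, integral_add (hi2.const_mul _) (integrable_const _),
    integral_const_mul, integral_const_mul,
    setIntegral_const, smul_eq_mul, ← hpow]
  ring

end PerturbedGradient

theorem exists_tendsto_radialFlux {n : ℕ} {iN : Fin n} {τ : ℝ} (hτ : 0 < τ)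
    (hτn : ((n : ℝ) - 2) / 2 < τ)
    {g : EuclideanSpace ℝ (Fin n) → Matrix (Fin n) (Fin n) ℝ}
    (hg : IsCmMetric 2 iN g) (hgAF : IsAsymptoticallyFlat iN τ g)
    {α : ℝ} (hα : 0 < α) {u : EuclideanSpace ℝ (Fin n) → ℝ} (hu : MemC2AlphaTau iN α τ u)
    {lam₀ : ℝ} (hsub : ∀ x ∈ halfSpace iN, lam₀ ≤ ‖x‖ → 0 ≤ laplaceBeltrami g u x)
    (hint : IntegrableOn (laplaceBeltrami g u) (halfSpace iN) volume)
    (hbd : ∀ y ∈ bdry iN, lam₀ ≤ ‖y‖ → nuDeriv iN g u y = 0) :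
    ∃ z, Tendsto (radialFlux iN fun i => pd i u) atTop (𝓝 z) ∧
      ∃ K > 0, ∃ R ≥ 1, ∀ r, R < r →
        radialFlux iN (fun i => pd i u) r ≤ z + K * r ^ ((n : ℝ) - 2 - 2 * τ) := by
  obtain ⟨C₁, hC₁, R₁, hR₁, hlap⟩ := exists_abs_laplaceBeltrami_sub_euclLap_le hτ hg hgAF hu
  obtain ⟨C₂, hC₂, R₂, hR₂, hnorm⟩ := exists_abs_pdw_normal_le_rpow hτ hg hgAF hα hu hbd
  obtain ⟨D, hD, hb⟩ := exists_pdw_bounds hu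
  have hC2 := hu.1
  have hn : 1 ≤ n := iN.pos
  have hle : ∀ x : EuclideanSpace ℝ (Fin n), ∀ c : ℝ, c ≤ 0 → D * (1 + ‖x‖) ^ c ≤ D := fun x c hc =>
    mul_le_of_le_one_right hD.le (rpow_le_one_of_one_le_of_nonpos (by simp) hc)
  have hb1 : ∀ i x, 0 < x iN → |pd i u x| ≤ D := fun i x hx => by
    rw [← pdw_eq_pd i u hx]
    exact ((hb x hx.le).2.1 i).trans (hle x _ (by linarith))
  have hb2 : ∀ i x, 0 < x iN → |pd i (pd i u) x| ≤ D := fun i x hx => by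
    rw [← pdw_pdw_eq i i u hx]
    exact ((hb x hx.le).2.2 i i).trans (hle x _ (by linarith))
  set R := max (max R₁ R₂) lam₀ with hR
  have hRR₁ : R₁ ≤ R := (le_max_left _ _).trans (le_max_left _ _)
  have hRR₂ : R₂ ≤ R := (le_max_right _ _).trans (le_max_left _ _)
  have hRl : lam₀ ≤ R := le_max_right _ _
  have hR1 : 1 ≤ R := hR₁.le.trans hRR₁
  have hR0 : 0 < R := by linarith
  have hδ : 0 < 2 - n - -2 * τ := by linarith
  set K₁ := C₂ + 1 with hK₁
  set K₂ := (C₁ + K₁ * (1 - -2 * τ)) / (2 - n - -2 * τ) with hK₂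
  have hK : C₁ + K₁ * (1 - -2 * τ) ≤ K₂ * (2 - n - -2 * τ) := (div_mul_cancel₀ _ hδ.ne').ge
  have hf0 : ∀ x : EuclideanSpace ℝ (Fin n), 0 < x iN → R < ‖x‖ → 0 ≤ laplaceBeltrami g u x :=
    fun x hx hxR => hsub x hx.le (hRl.trans hxR.le)
  set G := radialFlux iN fun i => pd i u with hG
  set K := K₁ * ∫ ω in upperSphere iN, (ω : EuclideanSpace ℝ (Fin n)) iN
            ∂(volume : Measure (EuclideanSpace ℝ (Fin n))).toSphere
          - K₂ * (volume : Measure (EuclideanSpace ℝ (Fin n))).toSphere.real (upperSphere iN)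
  have key : ∀ s f, |s| = 1 → IntegrableOn f {x : EuclideanSpace ℝ (Fin n) | 0 < x iN ∧ R < ‖x‖} →
      (∀ x, 0 < x iN → R < ‖x‖ → 0 ≤ f x) →
      (∀ x, 0 < x iN → R < ‖x‖ → -f x ≤ s * laplaceBeltrami g u x) →
      ∀ a b, R < a → a < b → s * G a + K * a ^ (n + -2 * τ - 2) ≤
        s * G b + K * b ^ (n + -2 * τ - 2) +
          ∫ x in {x : EuclideanSpace ℝ (Fin n) | 0 < x iN ∧ R < ‖x‖}, f x := by
    intro s f hs hfi hf hfs a b ha hab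
    have h := radialFlux_le_add (iN := iN) (f := f)
      (Y := perturbedGradient iN u s (-2 * τ) K₁ K₂) hn hR0
      (fun i => contDiffOn_perturbedGradient hC2 i R)
      (fun i x hx hxR => abs_perturbedGradient_le (contDiffAt_of_pos hC2 hx) (hR1.trans hxR.le)
        (by linarith) hs i (hb1 i x hx) (hb2 i x hx))
      (fun A B hA => exists_perturbedGradient_nonneg hC2 (hR0.trans hA) hs (lt_add_one C₂)
        fun y hy hyA => hnorm y hy (hRR₂.trans (hA.le.trans hyA)))
      hfi hf (fun x hx hxR => (hfs x hx hxR).trans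
        (le_sum_pd_perturbedGradient (contDiffAt_of_pos hC2 hx) hx (by linarith) (by positivity) hs
          (hlap x hx.le (hRR₁.trans hxR.le)) hK)) ha hab
    rwa [radialFlux_perturbedGradient hn hR0 ha hC2 fun i x hx _ => hb1 i x hx,
      radialFlux_perturbedGradient hn hR0 (ha.trans hab) hC2 fun i x hx _ => hb1 i x hx] at h
  have hmono : ∀ a b, R < a → a < b →
      G a + K * a ^ (n + -2 * τ - 2) ≤ G b + K * b ^ (n + -2 * τ - 2) := by
    intro a b ha hab
    simpa using key 1 (fun _ => 0) (by simp) (integrable_zero _ _ _) (by simp)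
      (by simpa using hf0) a b ha hab
  have hbdd := key (-1) (laplaceBeltrami g u) (by simp)
    (hint.mono_set fun x hx => hx.1.le) hf0 (by simp) (R + 1)
  set I := ∫ x in {x : EuclideanSpace ℝ (Fin n) | 0 < x iN ∧ R < ‖x‖}, laplaceBeltrami g u x
  have hpow : ∀ r, R < r → r ^ (n + -2 * τ - 2) ≤ 1 := fun r hr =>
    rpow_le_one_of_one_le_of_nonpos (by linarith) (by linarith)
  have hpow0 : ∀ r, R < r → 0 ≤ r ^ (n + -2 * τ - 2) := fun r hr =>
    rpow_nonneg (by linarith) _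
  have hKle : ∀ r, R < r → |K * r ^ (n + -2 * τ - 2)| ≤ |K| := fun r hr => by
    rw [abs_mul, abs_of_nonneg (hpow0 r hr)]
    exact mul_le_of_le_one_right (abs_nonneg _) (hpow r hr)
  set M : ℝ → ℝ := fun r => G (max r (R + 1)) + K * (max r (R + 1)) ^ (n + -2 * τ - 2) with hM
  have hMm : Monotone M := by
    intro a b hab
    rcases (max_le_max_right (R + 1) hab).eq_or_lt with h | h
    · simp [hM, h]
    · exact hmono _ _ ((lt_add_one R).trans_le (le_max_right _ _)) h
  have hMb : BddAbove (Set.range M) := by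
    refine ⟨G (R + 1) + 4 * |K| + |I|, ?_⟩
    rintro _ ⟨r, rfl⟩
    have hI := le_abs_self I
    have hIn := abs_nonneg I
    have hKn := abs_nonneg K
    have h1 := abs_le.1 (hKle (R + 1) (by linarith))
    rcases (le_max_right r (R + 1)).eq_or_lt with h | h
    · simp only [hM, ← h]
      linarith
    · have h2 := abs_le.1 (hKle (max r (R + 1)) (by linarith))
      have h3 := hbdd _ (by linarith) h
      simp only [hM]
      linarith
  have hMt := tendsto_atTop_ciSup hMm hMb
  set z := ⨆ r, M r
  have hMeq : ∀ r, R + 1 ≤ r → M r = G r + K * r ^ (n + -2 * τ - 2) := fun r hr => by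
    simp [hM, hr]
  have h0 : Tendsto (fun r : ℝ => K * r ^ (n + -2 * τ - 2)) atTop (𝓝 0) := by
    have := (tendsto_rpow_neg_atTop hδ).const_mul K
    rw [mul_zero] at this
    exact this.congr fun r => by ring_nf
  refine ⟨z, ?_, |K| + 1, by positivity, R + 1, by linarith, fun r hr => ?_⟩
  · have := hMt.sub h0
    rw [sub_zero] at this
    refine this.congr' ?_
    filter_upwards [eventually_ge_atTop (R + 1)] with r hr
    rw [hMeq r hr]
    ring
  · have h1 : M r ≤ z := le_ciSup hMb r
    rw [hMeq r hr.le] at h1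
    rw [show (n : ℝ) - 2 - 2 * τ = n + -2 * τ - 2 by ring]
    nlinarith [neg_abs_le K, hpow0 r (by linarith)]

section SphereIntegral

variable {n : ℕ} {iN : Fin n} {u : EuclideanSpace ℝ (Fin n) → ℝ}

lemma integrableOn_comp_smul_sphere {D r : ℝ} (hr : 0 < r)
    (hu : ContDiffOn ℝ 2 u (halfSpace iN)) (hD : ∀ x ∈ halfSpace iN, |u x| ≤ D) :
    IntegrableOn (fun ω : Metric.sphere (0 : EuclideanSpace ℝ (Fin n)) 1 =>
      u (r • (ω : EuclideanSpace ℝ (Fin n))))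
      (upperSphere iN) (volume : Measure (EuclideanSpace ℝ (Fin n))).toSphere := by
  have hms := (isOpen_upperSphere iN).measurableSet
  refine Integrable.of_bound (C := D) ?_ ?_
  · refine ContinuousOn.aestronglyMeasurable (hu.continuousOn.comp
      (Continuous.continuousOn (by fun_prop)) fun ω hω => ?_) hms
    exact (smul_upperSphere_pos hr hω).le
  · exact (ae_restrict_iff' hms).2 (Eventually.of_forall fun ω hω =>
      hD _ (smul_upperSphere_pos hr hω).le)

lemma hasDerivAt_setIntegral_sphere {D D' r : ℝ} (hr : 0 < r)
    (hu : ContDiffOn ℝ 2 u (halfSpace iN)) (hD : ∀ x ∈ halfSpace iN, |u x| ≤ D)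
    (hD' : ∀ i x, 0 < x iN → |pd i u x| ≤ D') :
    HasDerivAt (fun r : ℝ => ∫ ω in upperSphere iN, u (r • (ω : EuclideanSpace ℝ (Fin n)))
        ∂(volume : Measure (EuclideanSpace ℝ (Fin n))).toSphere)
      (∫ ω in upperSphere iN, ∑ i, (ω : EuclideanSpace ℝ (Fin n)) i *
        pd i u (r • (ω : EuclideanSpace ℝ (Fin n)))
        ∂(volume : Measure (EuclideanSpace ℝ (Fin n))).toSphere) r := by
  have hms := (isOpen_upperSphere iN).measurableSet
  refine (hasDerivAt_integral_of_dominated_loc_of_deriv_le (s := Set.Ioi 0)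
    (F := fun (r : ℝ) (ω : Metric.sphere (0 : EuclideanSpace ℝ (Fin n)) 1) =>
      u (r • (ω : EuclideanSpace ℝ (Fin n))))
    (F' := fun (r : ℝ) (ω : Metric.sphere (0 : EuclideanSpace ℝ (Fin n)) 1) =>
      ∑ i, (ω : EuclideanSpace ℝ (Fin n)) i * pd i u (r • (ω : EuclideanSpace ℝ (Fin n))))
    (bound := fun _ => n * D') (Ioi_mem_nhds hr) ?_ (integrableOn_comp_smul_sphere hr hu hD)
    (integrableOn_sum_coord_mul_pd (half_pos hr) (half_lt_self hr) hu
      fun i x hx _ => hD' i x hx).aestronglyMeasurable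
    ?_ (integrable_const _) ?_).2
  · filter_upwards [Ioi_mem_nhds hr] with t ht using
      (integrableOn_comp_smul_sphere ht hu hD).aestronglyMeasurable
  · refine (ae_restrict_iff' hms).2 (Eventually.of_forall fun ω hω t ht => ?_)
    refine (abs_sum_le_sum_abs _ _).trans ((sum_le_sum (g := fun _ => D') fun i _ => ?_).trans_eq
      (by simp))
    have h1 : |(ω : EuclideanSpace ℝ (Fin n)) i| ≤ 1 :=
      (abs_coord_le _ i).trans_eq (norm_eq_of_mem_sphere ω)
    rw [abs_mul]
    exact (mul_le_of_le_one_left (abs_nonneg _) h1).trans (hD' i _ (smul_upperSphere_pos ht hω))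
  · refine (ae_restrict_iff' hms).2 (Eventually.of_forall fun ω hω t ht => ?_)
    have hd : DifferentiableAt ℝ u (t • (ω : EuclideanSpace ℝ (Fin n))) :=
      (contDiffAt_of_pos hu (smul_upperSphere_pos ht hω)).differentiableAt two_ne_zero
    simpa using hasDerivAt_line (x := 0) (v := (ω : EuclideanSpace ℝ (Fin n))) (t := t)
      (by simpa using hd)

lemma tendsto_setIntegral_sphere {D τ : ℝ} (hτ : 0 < τ)
    (hD : ∀ x ∈ halfSpace iN, |u x| ≤ D * (1 + ‖x‖) ^ (-τ)) :
    Tendsto (fun r : ℝ => ∫ ω in upperSphere iN, u (r • (ω : EuclideanSpace ℝ (Fin n)))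
        ∂(volume : Measure (EuclideanSpace ℝ (Fin n))).toSphere) atTop (𝓝 0) := by
  have h : Tendsto (fun r : ℝ => D * (1 + r) ^ (-τ) *
      (volume : Measure (EuclideanSpace ℝ (Fin n))).toSphere.real (upperSphere iN))
      atTop (𝓝 0) := by
    simpa using (((tendsto_rpow_neg_atTop hτ).comp
      (tendsto_atTop_add_const_left _ (1 : ℝ) tendsto_id)).const_mul D).mul_const
        ((volume : Measure (EuclideanSpace ℝ (Fin n))).toSphere.real (upperSphere iN))
  refine squeeze_zero_norm' ?_ h
  filter_upwards [eventually_gt_atTop 0] with r hr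
  refine norm_setIntegral_le_of_norm_le_const (measure_lt_top _ _) fun ω hω => ?_
  simpa only [norm_smul_sphere hr] using! hD _ (smul_upperSphere_pos hr hω).le

end SphereIntegral

theorem pos_of_radialFlux_le {n : ℕ} {iN : Fin n} {α τ p ε K z R : ℝ} (hτ : 0 < τ)
    (hp : p < 2 * τ) {u : EuclideanSpace ℝ (Fin n) → ℝ} (hu : MemC2AlphaTau iN α τ u)
    (hε : 0 < ε) (hR : 1 ≤ R) (hlow : ∀ x ∈ halfSpace iN, R ≤ ‖x‖ → u x ≤ -ε * ‖x‖ ^ (-p))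
    (hflux : ∀ r, R < r →
      radialFlux iN (fun i => pd i u) r ≤ z + K * r ^ ((n : ℝ) - 2 - 2 * τ)) : 0 < z := by
  by_contra! hz
  obtain ⟨D, hD, hb⟩ := exists_pdw_bounds hu
  have hle : ∀ x : EuclideanSpace ℝ (Fin n), ∀ c : ℝ, c ≤ 0 → D * (1 + ‖x‖) ^ c ≤ D :=
    fun x c hc => mul_le_of_le_one_right hD.le (rpow_le_one_of_one_le_of_nonpos (by simp) hc)
  have hb0 : ∀ x ∈ halfSpace iN, |u x| ≤ D := fun x hx =>
    (hb x hx).1.trans (hle x _ (by linarith))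
  have hb1 : ∀ i x, 0 < x iN → |pd i u x| ≤ D := fun i x hx => by
    rw [← pdw_eq_pd i u hx]
    exact ((hb x hx.le).2.1 i).trans (hle x _ (by linarith))
  set A := (volume : Measure (EuclideanSpace ℝ (Fin n))).toSphere.real (upperSphere iN) with hAdef
  have hA : 0 < A := toSphere_upperSphere_pos iN
  set V : ℝ → ℝ := fun r => ∫ ω in upperSphere iN, u (r • (ω : EuclideanSpace ℝ (Fin n)))
    ∂(volume : Measure (EuclideanSpace ℝ (Fin n))).toSphere with hV
  set W : ℝ → ℝ := fun r => V r + K / (2 * τ) * r ^ (-(2 * τ)) with hW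
  have hWd : ∀ r, R < r → ∃ W', HasDerivAt W W' r ∧ W' ≤ 0 := by
    intro r hr
    have hr0 : 0 < r := by linarith
    refine ⟨_, (hasDerivAt_setIntegral_sphere hr0 hu.1 hb0 hb1).add
      ((hasDerivAt_rpow_const (p := -(2 * τ)) (Or.inl hr0.ne')).const_mul (K / (2 * τ))), ?_⟩
    have h := (hflux r hr).trans (add_le_of_nonpos_left hz)
    have h1 : r ^ (n - 1) * r ^ (-(2 * τ) - 1) = r ^ ((n : ℝ) - 2 - 2 * τ) := by
      rw [← rpow_natCast, ← rpow_add hr0, Nat.cast_sub iN.pos]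
      congr 1
      push_cast
      ring
    rw [radialFlux, ← h1, ← mul_assoc, mul_comm K, mul_assoc] at h
    have h2 := le_of_mul_le_mul_left h (by positivity)
    have h3 : K / (2 * τ) * (-(2 * τ) * r ^ (-(2 * τ) - 1)) = -(K * r ^ (-(2 * τ) - 1)) := by
      field_simp
    rw [h3]
    linarith
  have hWa : AntitoneOn W (Set.Ioi R) := by
    refine antitoneOn_of_deriv_nonpos (convex_Ioi R) (fun r hr => ?_) (fun r hr => ?_)
      fun r hr => ?_
    · obtain ⟨W', h, -⟩ := hWd r hr
      exact h.continuousAt.continuousWithinAt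
    · rw [interior_Ioi] at hr
      obtain ⟨W', h, -⟩ := hWd r hr
      exact h.differentiableAt.differentiableWithinAt
    · rw [interior_Ioi] at hr
      obtain ⟨W', h, h0⟩ := hWd r hr
      rwa [h.deriv]
  have hWt : Tendsto W atTop (𝓝 0) := by
    simpa using (tendsto_setIntegral_sphere hτ fun x hx => (hb x hx).1).add
      ((tendsto_rpow_neg_atTop (show 0 < 2 * τ by positivity)).const_mul (K / (2 * τ)))
  have hW0 : ∀ r, R < r → 0 ≤ W r := fun r hr => by
    refine le_of_tendsto hWt ?_
    filter_upwards [eventually_ge_atTop r] with t ht using hWa hr (hr.trans_le ht) ht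
  have hVle : ∀ r, R < r → V r ≤ -ε * r ^ (-p) * A := by
    intro r hr
    have hr0 : 0 < r := by linarith
    refine (setIntegral_mono_on (integrableOn_comp_smul_sphere hr0 hu.1 hb0)
      (integrable_const (-ε * r ^ (-p))) (isOpen_upperSphere iN).measurableSet
      fun ω hω => ?_).trans_eq ?_
    · have h := hlow _ (smul_upperSphere_pos hr0 hω).le
        (by rw [norm_smul_sphere hr0]; exact hr.le)
      rwa [norm_smul_sphere hr0] at h
    · rw [setIntegral_const, smul_eq_mul, mul_comm]
  obtain ⟨R', -, hR'⟩ := exists_rpow_neg_lt (sub_pos.2 hp) (K / (2 * τ)) (mul_pos hε hA)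
  set r := max R' (R + 1)
  have hrR : R < r := (lt_add_one R).trans_le (le_max_right _ _)
  have hr0 : 0 < r := by linarith
  have h1 := hR' r (le_max_left _ _)
  have h2 : r ^ (-(2 * τ)) = r ^ (-(2 * τ - p)) * r ^ (-p) := by
    rw [← rpow_add hr0]; ring_nf
  have h3 := (hW0 r hrR).trans (add_le_add_left (hVle r hrR) _)
  rw [h2] at h3
  have h4 := mul_lt_mul_of_pos_right h1 (rpow_pos_of_pos hr0 (-p))
  linarith

lemma exists_inv_mul_flux_eq {n : ℕ} (hn : 2 ≤ n) (iN : Fin n)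
    (u : EuclideanSpace ℝ (Fin n) → ℝ) :
    ∃ c > 0, ∀ r : ℝ, 0 < r → r⁻¹ * flux iN u r = c * radialFlux iN (fun i => pd i u) r := by
  obtain ⟨c, hc, h⟩ := exists_integral_halfSphere_eq hn iN
  refine ⟨c, hc, fun r hr => ?_⟩
  have hpow : r ^ ((n : ℝ) - 1) = r ^ (n - 1) := by
    rw [← rpow_natCast, Nat.cast_sub (by omega), Nat.cast_one]
  rw [flux, h r hr, radialFlux, hpow]
  simp only [PiLp.smul_apply, smul_eq_mul, mul_assoc, ← mul_sum, integral_const_mul]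
  field_simp

/-- asymptotic growth estimate for subharmonic functions:
if `u ∈ C^{2,α}_τ(ℝⁿ₊)` is negative, `Δ_g u ≥ 0` outside a compact set, `Δ_g u` is
integrable, and the normal derivative of `u` vanishes on the boundary outside a compact
set, then `lim_{λ→∞} λ⁻¹ ∫_{ℝⁿ₊∩S_λ} Σᵢ xⁱ ∂ᵢ u dμ(ḡ)` exists and is positive. -/
theorem stmt0 (n : ℕ) (hn : 3 ≤ n) (τ : ℝ) (hτ : ((n : ℝ) - 2) / 2 < τ)
    (iN : Fin n) (hiN : (iN : ℕ) = n - 1)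
    (g : EuclideanSpace ℝ (Fin n) → Matrix (Fin n) (Fin n) ℝ)
    (hg : IsCmMetric 2 iN g) (hgAF : IsAsymptoticallyFlat iN τ g)
    (α : ℝ) (hα0 : 0 < α) (hα1 : α < 1)
    (u : EuclideanSpace ℝ (Fin n) → ℝ)
    (hu : MemC2AlphaTau iN α τ u)
    (huneg : ∀ x ∈ halfSpace iN, u x < 0)
    (lam₀ : ℝ) (hlam₀ : 1 < lam₀)
    (hsub : ∀ x ∈ halfSpace iN, lam₀ ≤ ‖x‖ → 0 ≤ laplaceBeltrami g u x)
    (hint : MeasureTheory.IntegrableOn (laplaceBeltrami g u) (halfSpace iN)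
      MeasureTheory.volume)
    (hbd : ∀ y ∈ bdry iN, lam₀ ≤ ‖y‖ → nuDeriv iN g u y = 0) :
    ∃ z > 0, Filter.Tendsto (fun lam => lam⁻¹ * flux iN u lam) Filter.atTop (nhds z) := by
  have hn3 : (3 : ℝ) ≤ n := by exact_mod_cast hn
  have hτ0 : 0 < τ := by linarith
  obtain ⟨z, hz, K, -, R, hR, hflux⟩ :=
    exists_tendsto_radialFlux hτ0 hτ hg hgAF hα0 hu hsub hint hbd
  obtain ⟨ε, hε, R', hR', hlow⟩ := exists_le_neg_norm_rpow hτ0 hg hgAF hα0 hu huneg hsub hbd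
    (p := τ + ((n : ℝ) - 2) / 2) (by linarith) (by linarith)
  obtain ⟨c, hc, hfluxeq⟩ := exists_inv_mul_flux_eq (by omega) iN u
  have hz0 : 0 < z := pos_of_radialFlux_le (R := max R R') hτ0 (by linarith) hu hε
    (hR.le.trans (le_max_left _ _))
    (fun x hx hxR => hlow x hx ((le_max_right _ _).trans hxR))
    fun r hr => hflux r ((le_max_left _ _).trans_lt hr)
  refine ⟨c * z, mul_pos hc hz0, (hz.const_mul c).congr' ?_⟩
  filter_upwards [eventually_gt_atTop 0] with r hr using (hfluxeq r hr).symm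

end
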